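/- Let p be a prime, k a finite field extension of ℚ_p, and X an integral scheme that is projective and normal over k, with k relatively algebraically closed in the function field K = k(X). Then for every birational Galois section s : Gal_k → Gal_K there is EXACTLY ONE valuation subring Ō of K̄ with k ⊆ Ō such that s(Gal_k) ⊆ D_Ō and the residue field of the valuation subring Ō ∩ K of K is an algebraic extension of k; moreover, for this unique Ō the residue field of Ō ∩ K equals k. -/

import Mathlib

/-!
For a projective normal geometrically irreducible variety `X` over a finite extension
`k/ℚ_p`, every birational Galois section lies in the decomposition subgroup of exactly
one `k`-valuation `Ō` of `K̄ = k(X)‾` whose restriction to `K` has residue field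
algebraic over `k`; moreover for this unique `Ō` the residue field equals `k`.

Projectivity over `k` is expressed as the existence of a closed immersion into some
projective space `ℙⁿ_k = Proj k[x₀,…,xₙ]` over `Spec k`.
-/

open AlgebraicGeometry CategoryTheory

attribute [local instance] MvPolynomial.gradedAlgebra

/-- The restriction homomorphism `Gal(Kbar/F) →* Gal(kbar/k)`, where
`kbar = algebraicClosure k Kbar` is the relative algebraic closure of `k` in `Kbar`. -/
noncomputable def resHom (k F Kbar : Type*) [Field k] [Field F] [Field Kbar]
    [Algebra k F] [Algebra F Kbar] [Algebra k Kbar] [IsScalarTower k F Kbar]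
    [IsAlgClosed Kbar] :
    (Kbar ≃ₐ[F] Kbar) →* ((algebraicClosure k Kbar) ≃ₐ[k] (algebraicClosure k Kbar)) :=
  (AlgEquiv.restrictNormalHom (F := k) (K₁ := Kbar) (algebraicClosure k Kbar)).comp
    { toFun := fun σ => σ.restrictScalars k
      map_one' := rfl
      map_mul' := fun _ _ => rfl }

/-- The ring homomorphism `k → O → O/m_O` from `k` to the residue field of a valuation
subring `O` of a field extension `K` of `k` containing (the image of) `k`. -/
noncomputable def residueEmbedHom {k K : Type*} [Field k] [Field K] [Algebra k K]
    (O : ValuationSubring K) (h : ∀ a : k, algebraMap k K a ∈ O) :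
    k →+* IsLocalRing.ResidueField O :=
  (IsLocalRing.residue O).comp (RingHom.codRestrict (algebraMap k K) O.toSubring h)

/-- The structure morphism `ℙⁿ_k = Proj k[x₀,…,x_{n-1}] ⟶ Spec k`. -/
noncomputable def projectiveSpaceToSpec (k : Type) [Field k] (n : ℕ) :
    Proj (MvPolynomial.homogeneousSubmodule (Fin n) k) ⟶ Spec (CommRingCat.of k) :=
  Proj.toSpecZero (MvPolynomial.homogeneousSubmodule (Fin n) k) ≫
    Spec.map (CommRingCat.ofHom
      ((GradedRing.projZeroRingHom' (MvPolynomial.homogeneousSubmodule (Fin n) k)).comp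
        (algebraMap k (MvPolynomial (Fin n) k))))

/-- A nontrivial character of order `ℓ` of the multiplicative group of a finite field. -/
lemma exists_residue_character (κ : Type*) [Field κ] [Finite κ] {ℓ : ℕ} [Fact ℓ.Prime]
    (hℓ : ℓ ∣ Nat.card κ - 1) :
    ∃ χ : κ → ZMod ℓ, (∀ {x y : κ}, x ≠ 0 → y ≠ 0 → χ (x * y) = χ x + χ y) ∧
      (∀ x, x ≠ 0 → χ x = 0 → ∃ r, x = r ^ ℓ) ∧ ∃ u, u ≠ 0 ∧ χ u = 1 := by
  classical
  obtain ⟨g, hg⟩ := IsCyclic.exists_generator (α := κˣ)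
  have hord : orderOf g = Nat.card κ - 1 := by
    rw [orderOf_eq_card_of_forall_mem_zpowers hg, Nat.card_units]
  have hk : ∀ x : κˣ, ∃ n : ℤ, g ^ n = x := fun x => Subgroup.mem_zpowers_iff.1 (hg x)
  choose e he using hk
  have hdvd : (ℓ : ℤ) ∣ orderOf g := by rw [hord]; exact_mod_cast hℓ
  have key : ∀ (x : κˣ) (n : ℤ), g ^ n = x → (e x : ZMod ℓ) = n := by
    intro x n hn
    rw [ZMod.intCast_eq_intCast_iff]
    refine Int.ModEq.of_dvd hdvd ?_
    rw [← zpow_eq_zpow_iff_modEq, he, hn]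
  refine ⟨fun x => if h : x = 0 then 0 else (e (Units.mk0 x h) : ZMod ℓ), ?_, ?_, g, g.ne_zero, ?_⟩
  · intro x y hx hy
    simp only [hx, hy, mul_ne_zero hx hy, dite_false]
    rw [← Int.cast_add]
    refine key _ _ ?_
    rw [zpow_add, he, he, Units.mk0_mul]
  · intro x hx h
    simp only [hx, dite_false] at h
    rw [ZMod.intCast_zmod_eq_zero_iff_dvd] at h
    obtain ⟨m, hm⟩ := h
    refine ⟨(g ^ m : κˣ), ?_⟩
    have := he (Units.mk0 x hx)
    rw [hm, mul_comm, zpow_mul, zpow_natCast] at this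
    rw [← Units.val_pow_eq_pow_val, this, Units.val_mk0]
  · simp only [g.ne_zero, dite_false, Units.mk0_val]
    simpa using key g 1 (by simp)

lemma character_count {κ : Type*} [Field κ] [Finite κ] {ℓ : ℕ} [Fact ℓ.Prime] (h3 : 3 ≤ ℓ)
    (hq : ℓ ^ 4 ≤ Nat.card κ - 1) {χ : κ → ZMod ℓ}
    (hmul : ∀ {x y : κ}, x ≠ 0 → y ≠ 0 → χ (x * y) = χ x + χ y) {u : κ} (hu : u ≠ 0)
    (hu1 : χ u = 1) :
    {t : κ | t ≠ 0 ∧ χ t = 0}.ncard < {t : κ | t ≠ 0 ∧ χ t ≠ 0}.ncard ∧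
    ℓ ^ 2 < {t : κ | t ≠ 0 ∧ χ t ≠ 0}.ncard := by
  classical
  set S := {t : κ | t ≠ 0 ∧ χ t = 0} with hS
  set T := {t : κ | t ≠ 0 ∧ χ t ≠ 0} with hT
  have h2 : (2 : ZMod ℓ) ≠ 0 := by
    intro h
    have h2 : ((2 : ℕ) : ZMod ℓ) = 0 := by exact_mod_cast h
    rw [ZMod.natCast_eq_zero_iff] at h2
    have := Nat.le_of_dvd (by norm_num) h2
    omega
  have h12 : (1 : ZMod ℓ) ≠ 2 := fun h => one_ne_zero (α := ZMod ℓ) (by linear_combination -h)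
  have hχ1 : χ 1 = 0 := by
    have := hmul (x := 1) (y := 1) one_ne_zero one_ne_zero
    simpa using this
  have hS1 : 0 < S.ncard := (Set.ncard_pos (Set.toFinite _)).2 ⟨1, one_ne_zero, hχ1⟩
  have huu : χ (u * u) = 2 := by rw [hmul hu hu, hu1]; norm_num
  have hsub : ((fun t => u * t) '' S) ∪ ((fun t => u * u * t) '' S) ⊆ T := by
    rintro _ (⟨t, ⟨h0, h1⟩, rfl⟩ | ⟨t, ⟨h0, h1⟩, rfl⟩)
    · refine ⟨mul_ne_zero hu h0, ?_⟩
      simp only [hmul hu h0, hu1, h1, add_zero]; exact one_ne_zero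
    · refine ⟨mul_ne_zero (mul_ne_zero hu hu) h0, ?_⟩
      simp only [hmul (mul_ne_zero hu hu) h0, huu, h1, add_zero]; exact h2
  have hdisj : Disjoint ((fun t => u * t) '' S) ((fun t => u * u * t) '' S) := by
    rw [Set.disjoint_left]
    rintro _ ⟨t, ⟨h0, h1⟩, rfl⟩ ⟨t', ⟨h0', h1'⟩, h⟩
    have := congrArg χ h
    simp only [hmul hu h0, hmul (mul_ne_zero hu hu) h0', hu1, huu, h1, h1', add_zero] at this
    exact h12 this.symm
  have hc := Set.ncard_le_ncard hsub (Set.toFinite _)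
  rw [Set.ncard_union_eq hdisj (Set.toFinite _) (Set.toFinite _),
    Set.ncard_image_of_injective _ (mul_right_injective₀ hu),
    Set.ncard_image_of_injective _ (mul_right_injective₀ (mul_ne_zero hu hu))] at hc
  have hST : S ∪ T = {0}ᶜ := by
    ext t
    simp only [hS, hT, Set.mem_union, Set.mem_ofPred_eq, Set.mem_compl_iff, Set.mem_singleton_iff]
    tauto
  have hST' : Disjoint S T := by
    rw [Set.disjoint_left]; exact fun t h h' => h'.2 h.2
  have htot : S.ncard + T.ncard = Nat.card κ - 1 := by
    rw [← Set.ncard_union_eq hST' (Set.toFinite _) (Set.toFinite _), hST, Set.ncard_compl,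
      Set.ncard_singleton]
  refine ⟨by omega, ?_⟩
  have : ℓ ^ 4 = ℓ ^ 2 * ℓ ^ 2 := by ring
  have : 9 ≤ ℓ ^ 2 := by nlinarith
  nlinarith

/-- A discrete nonarchimedean absolute value with finite residue field, in elementary terms. -/
structure IsLocalAbs {E : Type*} [Field E] (w : AbsoluteValue E ℝ) : Prop where
  add_le : ∀ x y, w (x + y) ≤ max (w x) (w y)
  exists_unif : ∃ π, 0 < w π ∧ w π < 1 ∧ ∀ x, w x < 1 → w x ≤ w π

namespace IsLocalAbs

variable {E : Type*} [Field E] {w : AbsoluteValue E ℝ} (hw : IsLocalAbs w)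

/-- The ring of integers. -/
def integers : ValuationSubring E where
  carrier := {x | w x ≤ 1}
  mul_mem' := fun {a b} ha hb => by
    simp only [Set.mem_ofPred_eq, map_mul] at *
    exact mul_le_one₀ ha (w.nonneg _) hb
  one_mem' := by simp
  zero_mem' := by simp
  add_mem' := fun ha hb => (hw.add_le _ _).trans (max_le ha hb)
  neg_mem' := fun {a} ha => by simpa using ha
  mem_or_inv_mem' := fun x => by
    rcases le_total (w x) 1 with h | h
    · exact Or.inl h
    · exact Or.inr (by simpa using inv_le_one_of_one_le₀ h)

lemma mem_integers {x : E} : x ∈ hw.integers ↔ w x ≤ 1 := Iff.rfl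

lemma residue_eq_zero_iff (x : hw.integers) :
    IsLocalRing.residue hw.integers x = 0 ↔ w (x : E) < 1 := by
  rw [IsLocalRing.residue_eq_zero_iff, IsLocalRing.mem_maximalIdeal, mem_nonunits_iff,
    isUnit_iff_exists_inv]
  constructor
  · intro h
    refine lt_of_le_of_ne x.2 fun h1 => h ⟨⟨(x : E)⁻¹, ?_⟩, ?_⟩
    · rw [mem_integers, map_inv₀, h1, inv_one]
    · ext
      have : (x : E) ≠ 0 := fun h0 => by simp [h0] at h1
      simp [this]
  · rintro h ⟨y, hy⟩
    have := congrArg (fun z : hw.integers => w (z : E)) hy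
    simp only [MulMemClass.coe_mul, map_mul, OneMemClass.coe_one, map_one] at this
    have h2 : w (y : E) ≤ 1 := y.2
    have := mul_lt_one_of_nonneg_of_lt_one_left (w.nonneg _) h h2
    linarith

lemma add_eq_left (hw : IsLocalAbs w) {x y : E} (h : w y < w x) : w (x + y) = w x := by
  refine le_antisymm ((hw.add_le x y).trans (max_le le_rfl h.le)) ?_
  by_contra! hlt
  have := hw.add_le (x + y) (-y)
  rw [add_neg_cancel_right, map_neg_eq_map] at this
  exact absurd this (not_le.2 (max_lt hlt h))

lemma exists_zpow {π : E} (h0 : 0 < w π) (h1 : w π < 1) (hπ : ∀ x, w x < 1 → w x ≤ w π) {x : E}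
    (hx : x ≠ 0) : ∃ n : ℤ, w x = w π ^ n := by
  obtain ⟨n, hn1, hn2⟩ := exists_mem_Ioc_zpow (w.pos hx) ((one_lt_inv₀ h0).2 h1)
  have hπ0 : π ≠ 0 := w.pos_iff.1 h0
  refine ⟨-(n + 1), ?_⟩
  rw [inv_zpow'] at hn1 hn2
  by_contra hne
  have h2 : w (x * π ^ (n + 1)) < 1 := by
    rw [map_mul, map_zpow₀]
    have := lt_of_le_of_ne hn2 hne
    rwa [zpow_neg, lt_inv_comm₀ (w.pos hx) (by positivity), ← one_div, lt_div_iff₀ (w.pos hx),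
      mul_comm] at this
  have h3 := hπ _ h2
  rw [map_mul, map_zpow₀, zpow_add_one₀ h0.ne', ← mul_assoc] at h3
  have h4 : w x * w π ^ n ≤ 1 := by
    by_contra! h5
    nlinarith
  rw [zpow_neg] at hn1
  have : w x ≤ (w π ^ n)⁻¹ := by
    rwa [← one_div, le_div_iff₀ (by positivity)]
  linarith

end IsLocalAbs

/-- A class map `cl : L → (ℤ/ℓ)²` on a field `L`, multiplicative on nonzero elements, subject to the
collinearity property `cl (1 + x) ∈ ⟨cl x⟩`, together with a ring `A → L` of "constants" whose
classes factor through a character of a large finite residue field `κ`. -/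
structure RigidClass (L A κ : Type*) [Field L] [CommRing A] [Algebra A L] [Field κ] [Fintype κ]
    (ℓ : ℕ) where
  cl : L → ZMod ℓ × ZMod ℓ
  cl_mul : ∀ {x y : L}, x ≠ 0 → y ≠ 0 → cl (x * y) = cl x + cl y
  coll : ∀ {x : L}, x ≠ 0 → 1 + x ≠ 0 → cl x ≠ 0 → ∃ i : ZMod ℓ, cl (1 + x) = i • cl x
  red : A →+* κ
  red_surj : Function.Surjective red
  χ : κ → ZMod ℓ
  χ_mul : ∀ {x y : κ}, x ≠ 0 → y ≠ 0 → χ (x * y) = χ x + χ y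
  map_ne_zero : ∀ {c : A}, red c ≠ 0 → algebraMap A L c ≠ 0
  cl_unit : ∀ {c : A}, red c ≠ 0 → cl (algebraMap A L c) = (χ (red c), 0)
  odd : 3 ≤ ℓ
  count : {t : κ | t ≠ 0 ∧ χ t = 0}.ncard < {t : κ | t ≠ 0 ∧ χ t ≠ 0}.ncard
  count' : ℓ ^ 2 < {t : κ | t ≠ 0 ∧ χ t ≠ 0}.ncard

namespace RigidClass

variable {L A κ : Type*} [Field L] [CommRing A] [Algebra A L] [Field κ] [Fintype κ]
  {ℓ : ℕ} [Fact ℓ.Prime] (R : RigidClass L A κ ℓ)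

local notation "ι" => algebraMap A L

lemma two_ne (R : RigidClass L A κ ℓ) : (2 : ZMod ℓ) ≠ 0 := by
  intro h
  have h2 : ((2 : ℕ) : ZMod ℓ) = 0 := by exact_mod_cast h
  rw [ZMod.natCast_eq_zero_iff] at h2
  have := Nat.le_of_dvd (by norm_num) h2
  have := R.odd
  omega

lemma cl_one : R.cl 1 = 0 := by
  have := R.cl_mul (x := 1) (y := 1) one_ne_zero one_ne_zero
  simpa using this

lemma cl_neg_one : R.cl (-1) = 0 := by
  have h := R.cl_mul (x := -1) (y := -1) (by simp) (by simp)
  rw [neg_mul_neg, one_mul, R.cl_one, ← two_smul (ZMod ℓ)] at h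
  exact (smul_eq_zero.1 h.symm).resolve_left R.two_ne

lemma cl_neg (x : L) : R.cl (-x) = R.cl x := by
  by_cases h : x = 0
  · simp [h]
  · rw [← neg_one_mul, R.cl_mul (by simp) h, R.cl_neg_one, zero_add]

lemma cl_inv {x : L} (h : x ≠ 0) : R.cl x⁻¹ = -R.cl x := by
  have := R.cl_mul h (inv_ne_zero h)
  rw [mul_inv_cancel₀ h, R.cl_one] at this
  exact (neg_eq_of_add_eq_zero_right this.symm).symm

/-- The second component of the class, playing the role of a valuation modulo `ℓ`. -/
def v (x : L) : ZMod ℓ := (R.cl x).2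

lemma v_mul {x y : L} (hx : x ≠ 0) (hy : y ≠ 0) : R.v (x * y) = R.v x + R.v y := by
  simp [v, R.cl_mul hx hy]

lemma v_inv {x : L} (hx : x ≠ 0) : R.v x⁻¹ = -R.v x := by simp [v, R.cl_inv hx]

omit [Fact ℓ.Prime] in
lemma v_of_cl {x : L} {P : ZMod ℓ × ZMod ℓ} (h : R.cl x = P) : R.v x = P.2 := by rw [v, h]

lemma v_one : R.v 1 = 0 := by simp [v, R.cl_one]

lemma v_neg (x : L) : R.v (-x) = R.v x := by simp [v, R.cl_neg]

lemma v_unit {c : A} (hc : R.red c ≠ 0) : R.v (ι c) = 0 := by simp [v, R.cl_unit hc]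

omit [Fact ℓ.Prime] in
lemma cl_ne {x y : L} (h : R.v x ≠ R.v y) : R.cl x ≠ R.cl y := fun e => h (by rw [v, v, e])

lemma add_ne_zero_of_v {a b : L} (h : R.v a ≠ R.v b) : a + b ≠ 0 := fun e =>
  h (by rw [eq_neg_of_add_eq_zero_left e, R.v_neg])

lemma collinear {a b : L} (ha : a ≠ 0) (hb : b ≠ 0) (hab : a + b ≠ 0) (h : R.cl a ≠ R.cl b) :
    ∃ i : ZMod ℓ, R.cl (a + b) = R.cl a + i • (R.cl b - R.cl a) := by
  have e : a * (1 + a⁻¹ * b) = a + b := by field_simp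
  have hx : a⁻¹ * b ≠ 0 := mul_ne_zero (inv_ne_zero ha) hb
  have hx1 : 1 + a⁻¹ * b ≠ 0 := fun h0 => hab (by rw [← e, h0, mul_zero])
  have hc : R.cl (a⁻¹ * b) = R.cl b - R.cl a := by
    rw [R.cl_mul (inv_ne_zero ha) hb, R.cl_inv ha]; abel
  obtain ⟨i, hi⟩ := R.coll hx hx1 (by rw [hc]; exact sub_ne_zero.2 h.symm)
  exact ⟨i, by rw [← e, R.cl_mul ha hx1, hi, hc]⟩

/-- On a line joining a class with nonzero second coordinate to `(χ, 0)`, the number `χ` is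
determined by any point other than the first one. -/
lemma line_unique {P Q : ZMod ℓ × ZMod ℓ} {a b : ZMod ℓ} (hP : P.2 ≠ 0) (hQ : Q ≠ P)
    (ha : ∃ i : ZMod ℓ, Q = P + i • ((a, 0) - P)) (hb : ∃ i : ZMod ℓ, Q = P + i • ((b, 0) - P)) :
    a = b := by
  obtain ⟨i, hi⟩ := ha
  obtain ⟨j, hj⟩ := hb
  have hi2 := congrArg Prod.snd hi
  have hj2 := congrArg Prod.snd hj
  have hi1 := congrArg Prod.fst hi
  have hj1 := congrArg Prod.fst hj
  simp only [Prod.snd_add, Prod.smul_snd, Prod.snd_sub, Prod.fst_add, Prod.smul_fst, Prod.fst_sub,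
    smul_eq_mul, zero_sub] at hi1 hi2 hj1 hj2
  have hij : i = j := by
    have : (i - j) * P.2 = 0 := by linear_combination hi2 - hj2
    exact sub_eq_zero.1 ((mul_eq_zero.1 this).resolve_right hP)
  subst hij
  have hi0 : i ≠ 0 := by
    rintro rfl
    exact hQ (by simpa using hi)
  have : i * (a - b) = 0 := by linear_combination -hi1 + hj1
  exact sub_eq_zero.1 ((mul_eq_zero.1 this).resolve_left hi0)

lemma add_unit_ne_zero {x : L} {c : A} (hv : R.v x ≠ 0) (hc : R.red c ≠ 0) : x + ι c ≠ 0 :=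
  R.add_ne_zero_of_v (by rwa [R.v_unit hc])

lemma collinear_unit {x : L} {c : A} (hx : x ≠ 0) (hv : R.v x ≠ 0) (hc : R.red c ≠ 0) :
    ∃ i : ZMod ℓ, R.cl (x + ι c) = R.cl x + i • ((R.χ (R.red c), 0) - R.cl x) := by
  have := R.collinear hx (R.map_ne_zero hc) (R.add_unit_ne_zero hv hc)
    (R.cl_ne (by rwa [R.v_unit hc]))
  rwa [R.cl_unit hc] at this

lemma χ_sub_eq {x : L} {c s : A} (hx : x ≠ 0) (hv : R.v x ≠ 0) (hc : R.red c ≠ 0)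
    (hs : R.red s ≠ 0) (hcs : R.red (c - s) ≠ 0) (h : R.cl (x + ι c) ≠ R.cl x)
    (h' : R.cl (x + ι s) = R.cl x) : R.χ (R.red (c - s)) = R.χ (R.red c) := by
  refine line_unique (P := R.cl x) (Q := R.cl (x + ι c)) hv h ?_ (R.collinear_unit hx hv hc)
  have := R.collinear_unit (x := x + ι s) (R.add_unit_ne_zero hv hs)
    (by rwa [v, h']) hcs
  rw [h'] at this
  convert this using 4
  rw [map_sub]; ring

/-- The set of `a` with `χ (a - σ) ≠ χ a` is as large as the complement of `ker χ`. -/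
lemma ncard_shift {σ : κ} (hσ : σ ≠ 0) :
    {a : κ | a ≠ 0 ∧ a - σ ≠ 0 ∧ R.χ (a - σ) ≠ R.χ a}.ncard
      = {t : κ | t ≠ 0 ∧ R.χ t ≠ 0}.ncard := by
  have hχ1 : R.χ 1 = 0 := by
    have := R.χ_mul (x := 1) (y := 1) one_ne_zero one_ne_zero
    simpa using this
  refine Set.ncard_congr (fun a _ => (a - σ) * a⁻¹) ?_ ?_ ?_
  · rintro a ⟨h0, h1, h2⟩
    refine ⟨mul_ne_zero h1 (inv_ne_zero h0), fun h => h2 ?_⟩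
    have : a - σ = (a - σ) * a⁻¹ * a := by field_simp
    rw [this, R.χ_mul (mul_ne_zero h1 (inv_ne_zero h0)) h0, h, zero_add]
  · rintro a b ⟨h0, h1, h2⟩ ⟨h0', h1', h2'⟩ h
    have h3 : (a - σ) * b = (b - σ) * a := by field_simp at h; linear_combination h
    have : σ * (a - b) = 0 := by linear_combination h3
    exact sub_eq_zero.1 ((mul_eq_zero.1 this).resolve_left hσ)
  · rintro t ⟨h0, h1⟩
    have ht : 1 - t ≠ 0 := fun h => h1 (by rw [← sub_eq_zero.1 h, hχ1])
    have e1 : σ * (1 - t)⁻¹ - σ = t * (σ * (1 - t)⁻¹) := by field_simp; ring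
    have h2 : σ * (1 - t)⁻¹ ≠ 0 := mul_ne_zero hσ (inv_ne_zero ht)
    refine ⟨σ * (1 - t)⁻¹, ⟨h2, by rw [e1]; exact mul_ne_zero h0 h2, ?_⟩, ?_⟩
    · rw [e1, R.χ_mul h0 h2]; simpa using h1
    · simp only [e1]; field_simp

lemma cl_add_eq_of_exists {x : L} {s : A} (hx : x ≠ 0) (hv : R.v x ≠ 0) (hs : R.red s ≠ 0)
    (h' : R.cl (x + ι s) = R.cl x) {c : A} (hc : R.red c ≠ 0) : R.cl (x + ι c) = R.cl x := by
  by_contra h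
  set B := {a : κ | a ≠ 0 ∧ a - R.red s ≠ 0 ∧ R.χ (a - R.red s) ≠ R.χ a} with hB
  have hsub : B \ {R.red c} ⊆ {a | R.red c - a ≠ 0 ∧ R.χ (R.red c - a) = R.χ (R.red c)} \ {0} := by
    rintro a ⟨⟨h0, h1, h2⟩, h3⟩
    obtain ⟨d, rfl⟩ := R.red_surj a
    have h3' : R.red c - R.red d ≠ 0 := sub_ne_zero.2 (Ne.symm h3)
    refine ⟨⟨h3', ?_⟩, h0⟩
    have hd : R.cl (x + ι d) = R.cl x := by
      by_contra hd
      exact h2 (by rw [← map_sub]; exact R.χ_sub_eq hx hv h0 hs (by rwa [map_sub]) hd h')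
    rw [← map_sub]
    exact R.χ_sub_eq hx hv hc h0 (by rwa [map_sub]) h hd
  have hcard : {a | R.red c - a ≠ 0 ∧ R.χ (R.red c - a) = R.χ (R.red c)}.ncard
      = {t : κ | t ≠ 0 ∧ R.χ t = 0}.ncard := by
    refine Set.ncard_congr (fun a _ => (R.red c - a) * (R.red c)⁻¹) ?_ ?_ ?_
    · rintro a ⟨h0, h1⟩
      have h2 := mul_ne_zero h0 (inv_ne_zero hc)
      refine ⟨h2, ?_⟩
      have h3 := R.χ_mul h2 hc
      rw [inv_mul_cancel_right₀ hc, h1] at h3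
      simpa using h3
    · rintro a b _ _ h
      simpa [hc] using h
    · rintro t ⟨h0, h1⟩
      refine ⟨R.red c - t * R.red c, ⟨?_, ?_⟩, ?_⟩
      · simpa using ⟨h0, hc⟩
      · rw [sub_sub_cancel, R.χ_mul h0 hc, h1, zero_add]
      · simp [hc]
  have h1 := Set.ncard_le_ncard hsub (Set.toFinite _)
  have h2 : ({a | R.red c - a ≠ 0 ∧ R.χ (R.red c - a) = R.χ (R.red c)} \ {0}).ncard + 1
      = {a | R.red c - a ≠ 0 ∧ R.χ (R.red c - a) = R.χ (R.red c)}.ncard :=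
    Set.ncard_sdiff_singleton_add_one (by simpa using hc) (Set.toFinite _)
  have h3 : B.ncard - 1 ≤ (B \ {R.red c}).ncard := Set.pred_ncard_le_ncard_sdiff_singleton _ _
  have h4 := R.ncard_shift hs
  have h5 := R.count
  rw [← hB] at h4
  omega

lemma dichotomy {x : L} (hx : x ≠ 0) (hv : R.v x ≠ 0) :
    (∀ c : A, R.red c ≠ 0 → R.cl (x + ι c) = R.cl x) ∨
    (∀ c : A, R.red c ≠ 0 → R.cl (x + ι c) = R.cl (ι c)) := by
  by_cases hs : ∃ s : A, R.red s ≠ 0 ∧ R.cl (x + ι s) = R.cl x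
  · obtain ⟨s, hs, h⟩ := hs
    exact Or.inl fun c hc => R.cl_add_eq_of_exists hx hv hs h hc
  push Not at hs
  refine Or.inr fun c hc => ?_
  by_contra hne
  have hx1 := R.add_unit_ne_zero hv hc
  have line : ∀ {y : L} {d : A}, y ≠ 0 → R.v y ≠ 0 → R.red d ≠ 0 → R.v (y + ι d) = 0 →
      R.cl (y + ι d) = (R.χ (R.red d), 0) := by
    intro y d hy hvy hd h0
    obtain ⟨i, hi⟩ := R.collinear_unit hy hvy hd
    have h2 := congrArg Prod.snd hi
    rw [v] at h0
    simp only [Prod.snd_add, Prod.smul_snd, Prod.snd_sub, smul_eq_mul, zero_sub, h0] at h2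
    have : (1 - i) * (R.cl y).2 = 0 := by linear_combination -h2
    have : i = 1 := (sub_eq_zero.1 ((mul_eq_zero.1 this).resolve_right hvy)).symm
    rw [hi, this]; simp
  have hv1 : R.v (x + ι c) ≠ 0 := fun h0 => hne (by rw [line hx hv hc h0, R.cl_unit hc])
  set B := {a : κ | a ≠ 0 ∧ a - R.red c ≠ 0 ∧ R.χ (a - R.red c) ≠ R.χ a} with hB
  choose lift hlift using R.red_surj
  have hvB : ∀ a ∈ B, R.v (x + ι (lift a)) ≠ 0 := by
    rintro a ⟨h0, h1, h2⟩ h3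
    have e : x + ι c + ι (lift a - c) = x + ι (lift a) := by rw [map_sub]; ring
    have e1 := line hx hv (d := lift a) (by rwa [hlift]) h3
    have e2 := line hx1 hv1 (d := lift a - c) (by rwa [map_sub, hlift]) (by rwa [e])
    rw [e, e1, map_sub, hlift] at e2
    exact h2 (congrArg Prod.fst e2).symm
  have hinj : Set.InjOn (fun a => R.cl (x + ι (lift a))) B := by
    intro a ha b hb hab
    by_contra hne'
    have hab' : R.cl (x + ι (lift b)) = R.cl (x + ι (lift a)) := hab.symm
    have e : x + ι (lift a) + ι (lift b - lift a) = x + ι (lift b) := by rw [map_sub]; ring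
    have h1 := R.cl_add_eq_of_exists (x := x + ι (lift a)) (s := lift b - lift a) (c := -lift a)
      (R.add_unit_ne_zero hv (by rw [hlift]; exact ha.1)) (hvB a ha)
      (by rw [map_sub, hlift, hlift]; exact sub_ne_zero.2 (Ne.symm hne')) (by rw [e, hab'])
      (by rw [map_neg, hlift]; exact neg_ne_zero.2 ha.1)
    refine hs (lift a) (by rw [hlift]; exact ha.1) ?_
    rw [← h1, map_neg, add_neg_cancel_right]
  have h1 : B.ncard ≤ (Set.univ : Set (ZMod ℓ × ZMod ℓ)).ncard :=
    Set.ncard_le_ncard_of_injOn _ (fun _ _ => Set.mem_univ _) hinj (Set.toFinite _)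
  rw [Set.ncard_univ, Nat.card_prod, Nat.card_zmod, ← sq, hB, R.ncard_shift hc] at h1
  exact absurd R.count' (not_lt.2 h1)

/-- Elements of the maximal ideal whose class has nonzero second coordinate. -/
def Small (x : L) : Prop := x ≠ 0 ∧ R.v x ≠ 0 ∧ R.cl (1 + x) = 0

variable {R}

lemma cl_one_add_mul {x : L} (hx : x ≠ 0) (hv : R.v x ≠ 0) :
    (∀ c : A, R.red c ≠ 0 → R.cl (1 + ι c * x) = 0) ∨
    (∀ c : A, R.red c ≠ 0 → R.cl (1 + ι c * x) = R.cl (ι c * x)) := by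
  have hv' : R.v x⁻¹ ≠ 0 := by rw [R.v_inv hx]; exact neg_ne_zero.2 hv
  have key : ∀ c : A, R.red c ≠ 0 → R.cl (1 + ι c * x) = R.cl (x⁻¹ + ι c) + R.cl x := by
    intro c hc
    rw [← R.cl_mul (R.add_unit_ne_zero hv' hc) hx]
    congr 1
    field_simp
  refine (R.dichotomy (inv_ne_zero hx) hv').imp (fun h c hc => ?_) (fun h c hc => ?_)
  · rw [key c hc, h c hc, R.cl_inv hx, neg_add_cancel]
  · rw [key c hc, h c hc, R.cl_mul (R.map_ne_zero hc) hx]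

omit [Fact ℓ.Prime] in
lemma red_one_ne : R.red 1 ≠ 0 := by simp

namespace Small

variable {x y : L}

lemma cl_one_add_mul (h : R.Small x) {c : A} (hc : R.red c ≠ 0) : R.cl (1 + ι c * x) = 0 := by
  rcases RigidClass.cl_one_add_mul h.1 h.2.1 with h1 | h1
  · exact h1 c hc
  · have h2 := h1 1 red_one_ne
    rw [map_one, one_mul, h.2.2] at h2
    exact absurd (congrArg Prod.snd h2.symm) h.2.1

lemma const_mul (h : R.Small x) {c : A} (hc : R.red c ≠ 0) : R.Small (ι c * x) :=
  ⟨mul_ne_zero (R.map_ne_zero hc) h.1,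
    by rw [R.v_mul (R.map_ne_zero hc) h.1, R.v_unit hc, zero_add]; exact h.2.1,
    h.cl_one_add_mul hc⟩

lemma one_add_ne (h : R.Small x) : 1 + x ≠ 0 :=
  R.add_ne_zero_of_v (by rw [R.v_one]; exact h.2.1.symm)

end Small

lemma cl_of_not_small {x : L} (hx : x ≠ 0) (hv : R.v x ≠ 0) (h : ¬ R.Small x) {c : A}
    (hc : R.red c ≠ 0) : R.cl (1 + ι c * x) = R.cl (ι c * x) := by
  rcases RigidClass.cl_one_add_mul hx hv with h1 | h1
  · exact absurd ⟨hx, hv, by simpa using h1 1 red_one_ne⟩ h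
  · exact h1 c hc

lemma cl_of_not_small' {x : L} (hx : x ≠ 0) (hv : R.v x ≠ 0) (h : ¬ R.Small x) :
    R.cl (1 + x) = R.cl x := by
  simpa using cl_of_not_small hx hv h red_one_ne

lemma cl_add {a b : L} (ha : a ≠ 0) (hb : b ≠ 0) (h : R.v a ≠ R.v b) :
    R.cl (a + b) = R.cl a ∨ R.cl (a + b) = R.cl b := by
  have e : a * (1 + a⁻¹ * b) = a + b := by field_simp
  have hx : a⁻¹ * b ≠ 0 := mul_ne_zero (inv_ne_zero ha) hb
  have hvx : R.v (a⁻¹ * b) ≠ 0 := by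
    rw [R.v_mul (inv_ne_zero ha) hb, R.v_inv ha]
    intro h0; exact h (by linear_combination -h0)
  have hx1 : 1 + a⁻¹ * b ≠ 0 := R.add_ne_zero_of_v (by rw [R.v_one]; exact hvx.symm)
  by_cases hs : R.Small (a⁻¹ * b)
  · left; rw [← e, R.cl_mul ha hx1, hs.2.2, add_zero]
  · right; rw [← e, R.cl_mul ha hx1, cl_of_not_small' hx hvx hs,
      R.cl_mul (inv_ne_zero ha) hb, R.cl_inv ha, add_neg_cancel_left]

lemma small_inv {x : L} (hx : x ≠ 0) (hv : R.v x ≠ 0) (h : ¬ R.Small x) : R.Small x⁻¹ := by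
  refine ⟨inv_ne_zero hx, by rw [R.v_inv hx]; exact neg_ne_zero.2 hv, ?_⟩
  have h1 : 1 + x ≠ 0 := R.add_ne_zero_of_v (by rw [R.v_one]; exact hv.symm)
  have e : 1 + x⁻¹ = (1 + x) * x⁻¹ := by field_simp; ring
  rw [e, R.cl_mul h1 (inv_ne_zero hx), cl_of_not_small' hx hv h, R.cl_inv hx, add_neg_cancel]

lemma Small.not_inv {x : L} (h : R.Small x) : ¬ R.Small x⁻¹ := by
  intro h'
  have e : 1 + x⁻¹ = (1 + x) * x⁻¹ := by field_simp [h.1]; ring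
  have := h'.2.2
  rw [e, R.cl_mul h.one_add_ne (inv_ne_zero h.1), h.2.2, zero_add, R.cl_inv h.1,
    neg_eq_zero] at this
  exact h.2.1 (congrArg Prod.snd this)

lemma Small.cl_ne_zero {x : L} (h : R.Small x) : R.cl x ≠ 0 := fun h0 =>
  h.2.1 (congrArg Prod.snd h0)

lemma Small.mul {x y : L} (hx : R.Small x) (hy : R.Small y) (hv : R.v x + R.v y ≠ 0) :
    R.Small (x * y) := by
  have hxy := mul_ne_zero hx.1 hy.1
  have hvxy : R.v (x * y) ≠ 0 := by rwa [R.v_mul hx.1 hy.1]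
  have hclxy := R.cl_mul hx.1 hy.1
  refine ⟨hxy, hvxy, ?_⟩
  by_contra hns
  have h1 : R.cl (1 + x * y) = R.cl (x * y) :=
    cl_of_not_small' hxy hvxy fun h => hns h.2.2
  have hw : R.cl (1 + x + x * y) = 0 := by
    have hA := cl_add hx.one_add_ne hxy (by rw [R.v_of_cl hx.2.2]; exact hvxy.symm)
    have hB := cl_add (R := R) one_ne_zero (mul_ne_zero hx.1 hy.one_add_ne)
      (by rw [R.v_one, R.v_mul hx.1 hy.one_add_ne, R.v_of_cl hy.2.2]; simpa using hx.2.1.symm)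
    rw [R.cl_one, R.cl_mul hx.1 hy.one_add_ne, hy.2.2, add_zero,
      show 1 + x * (1 + y) = 1 + x + x * y by ring] at hB
    rw [hx.2.2] at hA
    rcases hA with hA | hA
    · exact hA
    rcases hB with hB | hB
    · exact hB
    · rw [hB, hclxy] at hA
      exact absurd (left_eq_add.1 hA) hy.cl_ne_zero
  have hC := cl_add hx.1 (b := 1 + x * y)
    (R.add_ne_zero_of_v (by rw [R.v_one]; exact hvxy.symm))
    (by
      rw [R.v_of_cl (h1.trans hclxy)]
      intro h0; exact hy.2.1 (left_eq_add.1 h0))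
  rw [show x + (1 + x * y) = 1 + x + x * y by ring, hw, h1] at hC
  rcases hC with hC | hC
  · exact hx.cl_ne_zero hC.symm
  · exact hvxy (congrArg Prod.snd hC.symm)

variable (R) in
/-- Elements of class `0` in the second coordinate which preserve `Small` under multiplication. -/
def Preserves (z : L) : Prop := z ≠ 0 ∧ R.v z = 0 ∧ ∀ y, R.Small y → R.Small (z * y)

lemma two_mul_ne {a : ZMod ℓ} (R : RigidClass L A κ ℓ) (h : a ≠ 0) : 2 * a ≠ 0 :=
  mul_ne_zero R.two_ne h

lemma Small.mul_preserves {x y : L} (hx : R.Small x) (hy : R.Small y) (hv : R.v x + R.v y = 0) :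
    R.Preserves (x * y) := by
  refine ⟨mul_ne_zero hx.1 hy.1, by rwa [R.v_mul hx.1 hy.1], fun w hw => ?_⟩
  by_cases h : R.v w + R.v x = 0
  · have h2 : R.v y + R.v w ≠ 0 := by
      intro h0
      exact R.two_mul_ne hw.2.1 (by linear_combination h + h0 - hv)
    have := hx.mul (hy.mul hw h2) (by
      rw [R.v_mul hy.1 hw.1, ← add_assoc, hv, zero_add]; exact hw.2.1)
    rwa [← mul_assoc] at this
  · have := hy.mul (hw.mul hx h) (by
      rw [R.v_mul hw.1 hx.1]
      intro h0; exact hw.2.1 (by linear_combination h0 - hv))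
    rwa [show y * (w * x) = x * y * w by ring] at this

lemma Preserves.mul {x y : L} (hx : R.Preserves x) (hy : R.Preserves y) :
    R.Preserves (x * y) :=
  ⟨mul_ne_zero hx.1 hy.1, by rw [R.v_mul hx.1 hy.1, hx.2.1, hy.2.1, add_zero],
    fun w hw => by rw [mul_assoc]; exact hx.2.2 _ (hy.2.2 _ hw)⟩

lemma preserves_unit {c : A} (hc : R.red c ≠ 0) : R.Preserves (ι c) :=
  ⟨R.map_ne_zero hc, R.v_unit hc, fun _ hy => hy.const_mul hc⟩

lemma preserves_or_inv {z : L} (hz : z ≠ 0) (hv : R.v z = 0) :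
    R.Preserves z ∨ R.Preserves z⁻¹ := by
  by_contra! hcon
  obtain ⟨h1, h2⟩ := hcon
  have hvi : R.v z⁻¹ = 0 := by rw [R.v_inv hz, hv, neg_zero]
  simp only [Preserves, hz, hv, hvi, ne_eq, not_false_eq_true, inv_eq_zero, true_and, not_forall,
    exists_prop] at h1 h2
  obtain ⟨x, hx, hzx⟩ := h1
  obtain ⟨y, hy, hzy⟩ := h2
  have small1 : ∀ {x : L}, R.Small x → ¬ R.Small (z * x) → R.Small (z * x)⁻¹ := fun hx h =>
    small_inv (mul_ne_zero hz hx.1) (by rw [R.v_mul hz hx.1, hv, zero_add]; exact hx.2.1) h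
  have hy' : R.Small (z⁻¹ * y)⁻¹ :=
    small_inv (mul_ne_zero (inv_ne_zero hz) hy.1)
      (by rw [R.v_mul (inv_ne_zero hz) hy.1, hvi, zero_add]; exact hy.2.1) hzy
  have hvy' : R.v (z⁻¹ * y)⁻¹ = -R.v y := by
    rw [R.v_inv (mul_ne_zero (inv_ne_zero hz) hy.1), R.v_mul (inv_ne_zero hz) hy.1, hvi, zero_add]
  have hvx' : ∀ {x : L}, R.Small x → R.v (z * x)⁻¹ = -R.v x := by
    intro x hx
    rw [R.v_inv (mul_ne_zero hz hx.1), R.v_mul hz hx.1, hv, zero_add]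
  have main : ∀ {x : L}, R.Small x → R.Small (z * x)⁻¹ → R.v x + R.v y ≠ 0 → False := by
    intro x hx hx' hne
    have h3 := hx'.mul hy' (by
      rw [hvx' hx, hvy']; intro h0; exact hne (by linear_combination -h0))
    refine (hx.mul hy hne).not_inv ?_
    convert h3 using 1
    have := hx.1; have := hy.1
    field_simp
  have hx' := small1 hx hzx
  by_cases hne : R.v x + R.v y = 0
  · have hxx : R.Small (x * x) := hx.mul hx (by
      rw [← two_mul]; exact R.two_mul_ne hx.2.1)
    refine main hxx ?_ (by
      rw [R.v_mul hx.1 hx.1]; intro h0; exact hx.2.1 (by linear_combination h0 - hne))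
    have h4 : R.Small ((z * x)⁻¹ * (z * x)⁻¹) := hx'.mul hx' (by
      rw [← two_mul]; exact R.two_mul_ne hx'.2.1)
    have v4 : R.v ((z * x)⁻¹ * (z * x)⁻¹) = -R.v x - R.v x := by
      rw [R.v_mul hx'.1 hx'.1, hvx' hx]; ring
    have h5 := h4.mul hy' (by
      rw [v4, hvy']; intro h0; exact hx.2.1 (by linear_combination -h0 - hne))
    have h6 := h5.mul hy (by
      rw [R.v_mul h4.1 hy'.1, v4, hvy']
      intro h0; exact R.two_mul_ne hx.2.1 (by linear_combination -h0))
    convert h6 using 1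
    have := hx.1; have := hy.1
    field_simp
  · exact main hx hx' hne

variable (R) in
/-- Membership in the valuation ring defined by a rigid class map. -/
def Mem (x : L) : Prop := x = 0 ∨ R.Small x ∨ R.Preserves x

lemma mem_mul {x y : L} (hx : R.Mem x) (hy : R.Mem y) : R.Mem (x * y) := by
  rcases hx with rfl | hx | hx
  · exact Or.inl (zero_mul y)
  · rcases hy with rfl | hy | hy
    · exact Or.inl (mul_zero x)
    · by_cases h : R.v x + R.v y = 0
      · exact Or.inr (Or.inr (hx.mul_preserves hy h))
      · exact Or.inr (Or.inl (hx.mul hy h))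
    · rw [mul_comm]
      exact Or.inr (Or.inl (hy.2.2 _ hx))
  · rcases hy with rfl | hy | hy
    · exact Or.inl (mul_zero x)
    · exact Or.inr (Or.inl (hx.2.2 _ hy))
    · exact Or.inr (Or.inr (hx.mul hy))

lemma mem_or_inv (x : L) : R.Mem x ∨ R.Mem x⁻¹ := by
  by_cases h : x = 0
  · exact Or.inl (Or.inl h)
  by_cases hv : R.v x = 0
  · exact (preserves_or_inv h hv).imp (fun h => Or.inr (Or.inr h)) (fun h => Or.inr (Or.inr h))
  · by_cases hs : R.Small x
    · exact Or.inl (Or.inr (Or.inl hs))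
    · exact Or.inr (Or.inr (Or.inl (small_inv h hv hs)))

lemma Preserves.v_mul {z y : L} (hz : R.Preserves z) (hy : y ≠ 0) : R.v (z * y) = R.v y := by
  rw [R.v_mul hz.1 hy, hz.2.1, zero_add]

lemma Small.one_add_mul {x y : L} (hx : R.Small x) (hy : R.Small y) (h : R.v x + R.v y ≠ 0) :
    R.Small ((1 + x) * y) := by
  have hv1 : R.v (1 + x) = 0 := R.v_of_cl hx.2.2
  have hs := mul_ne_zero hx.one_add_ne hy.1
  have hvs : R.v ((1 + x) * y) = R.v y := by rw [R.v_mul hx.one_add_ne hy.1, hv1, zero_add]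
  have hcs : R.cl ((1 + x) * y) = R.cl y := by
    rw [R.cl_mul hx.one_add_ne hy.1, hx.2.2, zero_add]
  have hxy := hx.mul hy h
  have hA := cl_add hy.one_add_ne hxy.1 (by rw [R.v_of_cl hy.2.2]; exact hxy.2.1.symm)
  have hB := cl_add (R := R) one_ne_zero hs (by rw [R.v_one, hvs]; exact hy.2.1.symm)
  rw [show 1 + (1 + x) * y = 1 + y + x * y by ring, R.cl_one, hcs] at hB
  rw [hy.2.2, R.cl_mul hx.1 hy.1] at hA
  refine ⟨hs, by rw [hvs]; exact hy.2.1, ?_⟩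
  rw [show 1 + (1 + x) * y = 1 + y + x * y by ring]
  rcases hA with hA | hA
  · exact hA
  rcases hB with hB | hB
  · exact hB
  · rw [hB] at hA
    exact absurd (right_eq_add.1 hA) hx.cl_ne_zero

lemma preserves_one_add_small {x : L} (hx : R.Small x) : R.Preserves (1 + x) := by
  have hv1 : R.v (1 + x) = 0 := R.v_of_cl hx.2.2
  refine ⟨hx.one_add_ne, hv1, fun y hy => ?_⟩
  by_cases h : R.v x + R.v y = 0
  · have hs := mul_ne_zero hx.one_add_ne hy.1
    have hvs : R.v ((1 + x) * y) = R.v y := by rw [R.v_mul hx.one_add_ne hy.1, hv1, zero_add]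
    by_contra hns
    have ha := small_inv hs (by rw [hvs]; exact hy.2.1) hns
    have hva : R.v ((1 + x) * y)⁻¹ = R.v x := by
      rw [R.v_inv hs, hvs]; linear_combination -h
    refine hy.not_inv ?_
    have h2 := hx.one_add_mul ha (by rw [hva, ← two_mul]; exact R.two_mul_ne hx.2.1)
    convert h2 using 1
    have := hx.one_add_ne; have := hy.1
    field_simp
  · exact hx.one_add_mul hy h

lemma exists_const : ∃ c : A, R.red c ≠ 0 ∧ R.red (c - 1) ≠ 0 ∧ R.χ (R.red c) ≠ 0 ∧
    R.χ (R.red (c - 1)) ≠ 0 := by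
  by_contra! hcon
  have hχ1 : R.χ 1 = 0 := by
    have := R.χ_mul (x := 1) (y := 1) one_ne_zero one_ne_zero
    simpa using this
  refine absurd R.count (not_lt.2 ?_)
  refine Set.ncard_le_ncard_of_injOn (fun t => t - 1) ?_ (fun a _ b _ h => by simpa using h)
    (Set.toFinite _)
  rintro t ⟨h0, h1⟩
  obtain ⟨c, rfl⟩ := R.red_surj t
  have h2 : R.red c - 1 ≠ 0 := fun h => h1 (by rw [sub_eq_zero.1 h, hχ1])
  have := hcon c h0 (by simpa using h2) h1
  exact ⟨h2, by simpa using this⟩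

lemma preserves_one_add_preserves {x : L} (hx : R.Preserves x) (hx1 : 1 + x ≠ 0)
    (hv1 : R.v (1 + x) = 0) : R.Preserves (1 + x) := by
  refine ⟨hx1, hv1, fun y hy => ?_⟩
  have hxy := hx.2.2 y hy
  have hvxy := hx.v_mul hy.1
  have hcxy := R.cl_mul hx.1 hy.1
  have hs := mul_ne_zero hx1 hy.1
  have hvs : R.v ((1 + x) * y) = R.v y := by rw [R.v_mul hx1 hy.1, hv1, zero_add]
  have hA := cl_add hy.one_add_ne hxy.1 (by rw [R.v_of_cl hy.2.2]; exact hxy.2.1.symm)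
  have hB := cl_add hxy.one_add_ne hy.1 (by rw [R.v_of_cl hxy.2.2]; exact hy.2.1.symm)
  rw [show 1 + x * y + y = 1 + y + x * y by ring, hxy.2.2] at hB
  rw [hy.2.2, hcxy] at hA
  by_contra hns
  have hne : R.cl (1 + y + x * y) ≠ 0 := fun h => hns ⟨hs, by rw [hvs]; exact hy.2.1, by
    rw [show 1 + (1 + x) * y = 1 + y + x * y by ring, h]⟩
  replace hA := hA.resolve_left hne
  replace hB := hB.resolve_left hne
  have hcx : R.cl x = 0 := right_eq_add.1 (hB.symm.trans hA)
  have hns1 := cl_of_not_small' hs (by rw [hvs]; exact hy.2.1) hns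
  rw [show 1 + (1 + x) * y = 1 + y + x * y by ring, hB] at hns1
  obtain ⟨c, hc, hc1, hχc, hχc1⟩ := R.exists_const
  have hcy := hy.const_mul hc
  have hclcy := R.cl_mul (R.map_ne_zero hc) hy.1
  have hvcy : R.v (ι c * y) = R.v y := by rw [R.v_mul (R.map_ne_zero hc) hy.1, R.v_unit hc, zero_add]
  have hW : R.cl (1 + ι c * y + x * y) = 0 := by
    have hA' := cl_add hcy.one_add_ne hxy.1 (by rw [R.v_of_cl hcy.2.2]; exact hxy.2.1.symm)
    have hB' := cl_add hxy.one_add_ne hcy.1 (by rw [R.v_of_cl hxy.2.2]; exact hcy.2.1.symm)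
    rw [show 1 + x * y + ι c * y = 1 + ι c * y + x * y by ring, hxy.2.2, hclcy] at hB'
    rw [hcy.2.2, hcxy, hcx, zero_add] at hA'
    rcases hA' with hA' | hA'
    · exact hA'
    rcases hB' with hB' | hB'
    · exact hB'
    · rw [hB', R.cl_unit hc] at hA'
      exact absurd (congrArg Prod.fst (add_eq_right.1 hA')) hχc
  have hclc1 := R.cl_mul (R.map_ne_zero hc1) hy.1
  have hvW : R.v (1 + ι c * y + x * y) = 0 := R.v_of_cl hW
  have hWne : 1 + ι c * y + x * y ≠ 0 := by
    rw [show 1 + ι c * y + x * y = (1 + x * y) + ι c * y by ring]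
    exact R.add_ne_zero_of_v (by rw [R.v_of_cl hxy.2.2, hvcy]; exact hy.2.1.symm)
  have e : 1 + ι c * y + x * y = (1 + (1 + x) * y) + ι (c - 1) * y := by
    rw [map_sub, map_one]; ring
  have hcls : R.cl (1 + (1 + x) * y) = R.cl y := by
    rw [show 1 + (1 + x) * y = 1 + y + x * y by ring, hB]
  have hs1 : 1 + (1 + x) * y ≠ 0 :=
    R.add_ne_zero_of_v (by rw [R.v_one, hvs]; exact hy.2.1.symm)
  obtain ⟨i, hi⟩ := R.collinear hs1 (mul_ne_zero (R.map_ne_zero hc1) hy.1) (e ▸ hWne) (by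
    rw [hclc1, hcls, R.cl_unit hc1]
    intro h0
    exact hχc1 (congrArg Prod.fst (right_eq_add.1 h0)))
  rw [← e, hW, hclc1, hcls, R.cl_unit hc1] at hi
  have := congrArg Prod.snd hi
  simp only [Prod.snd_zero, Prod.snd_add, Prod.smul_snd, Prod.snd_sub, zero_add, sub_self,
    smul_zero, add_zero] at this
  exact hy.2.1 this.symm

lemma mem_one_add {x : L} (hx : R.Mem x) : R.Mem (1 + x) := by
  rcases hx with rfl | hx | hx
  · rw [add_zero, ← map_one (algebraMap A L)]
    exact Or.inr (Or.inr (preserves_unit red_one_ne))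
  · exact Or.inr (Or.inr (preserves_one_add_small hx))
  · by_cases hx1 : 1 + x = 0
    · exact Or.inl hx1
    by_cases hv : R.v (1 + x) = 0
    · exact Or.inr (Or.inr (preserves_one_add_preserves hx hx1 hv))
    by_cases hs : R.Small (1 + x)
    · exact Or.inr (Or.inl hs)
    have h := cl_of_not_small hx1 hv hs (c := -1) (by simp)
    simp only [map_neg, map_one, neg_mul, one_mul, R.cl_neg] at h
    rw [show 1 + -(1 + x) = -x by ring, R.cl_neg] at h
    exact absurd (by rw [v, ← h]; exact hx.2.1) hv

variable (R) in
/-- The valuation ring attached to a rigid class map. -/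
def valuationSubring : ValuationSubring L where
  carrier := {x | R.Mem x}
  mul_mem' := mem_mul
  one_mem' := by
    have := mem_one_add (R := R) (Or.inl rfl)
    rwa [add_zero] at this
  zero_mem' := Or.inl rfl
  add_mem' := by
    intro a b ha hb
    by_cases ha0 : a = 0
    · simpa [ha0] using hb
    by_cases hb0 : b = 0
    · simpa [hb0] using ha
    change R.Mem (a + b)
    rcases mem_or_inv (R := R) (a * b⁻¹) with h | h
    · have e : a + b = b * (1 + a * b⁻¹) := by
        rw [mul_add, mul_one, mul_left_comm, mul_inv_cancel₀ hb0, mul_one, add_comm]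
      rw [e]
      exact mem_mul hb (mem_one_add h)
    · have e : a + b = a * (1 + (a * b⁻¹)⁻¹) := by
        rw [mul_inv, inv_inv, mul_add, mul_one, mul_inv_cancel_left₀ ha0]
      rw [e]
      exact mem_mul ha (mem_one_add h)
  neg_mem' := by
    intro a ha
    have h : R.Mem (ι (-1)) := Or.inr (Or.inr (preserves_unit (by simp)))
    have := mem_mul h ha
    rwa [map_neg, map_one, neg_one_mul] at this
  mem_or_inv_mem' := mem_or_inv

lemma mem_valuationSubring {x : L} : x ∈ R.valuationSubring ↔ R.Mem x := Iff.rfl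

lemma const_mem {c : A} (hc : R.red c ≠ 0) : ι c ∈ R.valuationSubring :=
  Or.inr (Or.inr (preserves_unit hc))

lemma Small.mem {x : L} (h : R.Small x) : x ∈ R.valuationSubring := Or.inr (Or.inl h)

lemma Small.inv_not_mem {x : L} (h : R.Small x) : x⁻¹ ∉ R.valuationSubring := by
  rintro (h0 | h0 | h0)
  · exact h.1 (inv_eq_zero.1 h0)
  · exact h.not_inv h0
  · exact h.2.1 (by have := h0.2.1; rwa [R.v_inv h.1, neg_eq_zero] at this)

end RigidClass

/-- A local field `E` (with absolute value `w`) inside a field `L` such that `L` and `E` have the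
same `ℓ`-th power classes and `L` satisfies the collinearity property. -/
structure TamePair (E L : Type*) [Field E] [Field L] [Algebra E L] (w : AbsoluteValue E ℝ)
    (ℓ : ℕ) : Prop where
  isLocal : IsLocalAbs w
  finite : Finite (IsLocalRing.ResidueField isLocal.integers)
  three_le : 3 ≤ ℓ
  card : ℓ ^ 4 ≤ Nat.card (IsLocalRing.ResidueField isLocal.integers) - 1
  dvd_card : ℓ ∣ Nat.card (IsLocalRing.ResidueField isLocal.integers) - 1
  hensel : ∀ s : E, w s < 1 → ∃ t, 1 + s = t ^ ℓ
  kummer : ∀ x : L, x ≠ 0 → ∃ c : E, ∃ z : L, c ≠ 0 ∧ z ≠ 0 ∧ x = algebraMap E L c * z ^ ℓ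
  descent : ∀ (c : E) (z : L), algebraMap E L c = z ^ ℓ → ∃ d, c = d ^ ℓ
  coll : ∀ x : L, x ≠ 0 → 1 + x ≠ 0 → (¬ ∃ z, x = z ^ ℓ) → ∃ i : ℕ, ∃ z, 1 + x = x ^ i * z ^ ℓ

/-- `x` is, up to an `ℓ`-th power, an element of `E` of absolute value `1`. -/
def IsUnitMulPow {E L : Type*} [Field E] [Field L] [Algebra E L] (w : AbsoluteValue E ℝ) (ℓ : ℕ)
    (x : L) : Prop := ∃ c : E, ∃ z : L, w c = 1 ∧ z ≠ 0 ∧ x = algebraMap E L c * z ^ ℓ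

/-- Intrinsic description of a set of elements of the maximal ideal of the rigid valuation. -/
def IsSmallElt {E L : Type*} [Field E] [Field L] [Algebra E L] (w : AbsoluteValue E ℝ) (ℓ : ℕ)
    (x : L) : Prop := x ≠ 0 ∧ ¬ IsUnitMulPow w ℓ x ∧ ∃ z : L, 1 + x = z ^ ℓ

namespace TamePair

variable {E L : Type*} [Field E] [Field L] [Algebra E L] {w : AbsoluteValue E ℝ}
  {ℓ : ℕ} [Fact ℓ.Prime]

lemma exists_local_class (h : TamePair E L w ℓ) :
    ∃ (χ : IsLocalRing.ResidueField h.isLocal.integers → ZMod ℓ)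
      (cl : E → ZMod ℓ × ZMod ℓ), (∀ {x y}, x ≠ 0 → y ≠ 0 → χ (x * y) = χ x + χ y) ∧
      (∃ u, u ≠ 0 ∧ χ u = 1) ∧
      (∀ x y, x ≠ 0 → y ≠ 0 → cl (x * y) = cl x + cl y) ∧
      (∀ x, x ≠ 0 → cl x = 0 → ∃ z, x = z ^ ℓ) ∧
      (∀ x : h.isLocal.integers, w x = 1 →
        cl x = (χ (IsLocalRing.residue h.isLocal.integers x), 0)) ∧
      (∀ x, x ≠ 0 → (cl x).2 = 0 → ∃ c z, w c = 1 ∧ z ≠ 0 ∧ x = c * z ^ ℓ) ∧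
      (∃ π, 0 < w π ∧ w π < 1 ∧ (∀ x, w x < 1 → w x ≤ w π) ∧ (cl π).2 = 1) := by
  have hw := h.isLocal
  have := h.finite
  obtain ⟨χ, hχ, hχ0, u, hu, hu1⟩ := exists_residue_character _ h.dvd_card
  obtain ⟨π, h0, h1, hπ⟩ := hw.exists_unif
  have hπ0 : π ≠ 0 := w.pos_iff.1 h0
  have hex : ∀ x : E, ∃ n : ℤ, x ≠ 0 → w x = w π ^ n := fun x => by
    by_cases hx : x = 0
    · exact ⟨0, fun h => absurd hx h⟩
    · obtain ⟨n, hn⟩ := IsLocalAbs.exists_zpow h0 h1 hπ hx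
      exact ⟨n, fun _ => hn⟩
  choose o ho using hex
  have hinj : Function.Injective (fun n : ℤ => w π ^ n) := zpow_right_injective₀ h0 h1.ne
  have o_mul : ∀ x y, x ≠ 0 → y ≠ 0 → o (x * y) = o x + o y := fun x y hx hy => hinj (by
    simp only
    rw [← ho _ (mul_ne_zero hx hy), map_mul, zpow_add₀ h0.ne', ho x hx, ho y hy])
  set un : E → E := fun x => x * π ^ (-o x) with hun
  have w_un : ∀ x, x ≠ 0 → w (un x) = 1 := fun x hx => by
    rw [hun]; simp only [map_mul, map_zpow₀]
    rw [ho x hx, ← zpow_add₀ h0.ne', add_neg_cancel, zpow_zero]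
  have un_mul : ∀ x y, x ≠ 0 → y ≠ 0 → un (x * y) = un x * un y := fun x y hx hy => by
    simp only [hun, o_mul x y hx hy, neg_add, zpow_add₀ hπ0]; ring
  have un_eq : ∀ x, x = un x * π ^ (o x) := fun x => by
    simp only [hun]; rw [mul_assoc, ← zpow_add₀ hπ0, neg_add_cancel, zpow_zero, mul_one]
  classical
  set r : E → ZMod ℓ := fun x => if hx : x ∈ hw.integers then
    χ (IsLocalRing.residue hw.integers ⟨x, hx⟩) else 0 with hr
  have r_eq : ∀ x (hx : w x = 1), r x = χ (IsLocalRing.residue hw.integers ⟨x, hx.le⟩) :=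
    fun x hx => by rw [hr]; exact dif_pos _
  have res_ne : ∀ x (hx : w x = 1), IsLocalRing.residue hw.integers ⟨x, hx.le⟩ ≠ 0 :=
    fun x hx => by rw [Ne, hw.residue_eq_zero_iff]; simp [hx]
  have r_mul : ∀ x y, w x = 1 → w y = 1 → r (x * y) = r x + r y := fun x y hx hy => by
    have hxy : w (x * y) = 1 := by rw [map_mul, hx, hy, one_mul]
    rw [r_eq _ hxy, r_eq x hx, r_eq y hy, ← hχ (res_ne x hx) (res_ne y hy), ← map_mul]
    rfl
  have hπo : o π = 1 := hinj (by simp only [zpow_one]; exact (ho π hπ0).symm)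
  refine ⟨χ, fun x => (r (un x), (o x : ZMod ℓ)), hχ, ⟨u, hu, hu1⟩, ?_, ?_, ?_, ?_,
    π, h0, h1, hπ, by simp [hπo]⟩
  · intro x y hx hy
    simp [un_mul x y hx hy, o_mul x y hx hy, r_mul _ _ (w_un x hx) (w_un y hy)]
  · intro x hx hcl
    have hcl1 := congrArg Prod.fst hcl
    have hcl2 := congrArg Prod.snd hcl
    simp only [Prod.fst_zero, Prod.snd_zero] at hcl1 hcl2
    rw [r_eq _ (w_un x hx)] at hcl1
    obtain ⟨t, ht⟩ := hχ0 _ (res_ne _ (w_un x hx)) hcl1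
    obtain ⟨b, rfl⟩ := IsLocalRing.residue_surjective t
    have hb : w (b : E) = 1 := by
      refine le_antisymm b.2 (not_lt.1 fun hlt => ?_)
      rw [(hw.residue_eq_zero_iff b).2 hlt, zero_pow (Nat.Prime.ne_zero Fact.out)] at ht
      exact res_ne _ (w_un x hx) ht
    have hb0 : (b : E) ≠ 0 := fun h0 => by simp [h0] at hb
    have hs : w (un x - (b : E) ^ ℓ) < 1 := by
      have h3 : IsLocalRing.residue hw.integers (⟨un x, (w_un x hx).le⟩ - b ^ ℓ) = 0 := by
        rw [map_sub, map_pow, ht, sub_self]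
      rwa [hw.residue_eq_zero_iff] at h3
    obtain ⟨t, ht'⟩ := h.hensel ((un x - (b : E) ^ ℓ) / (b : E) ^ ℓ) (by
      rw [map_div₀, map_pow, hb, one_pow, div_one]; exact hs)
    rw [ZMod.intCast_zmod_eq_zero_iff_dvd] at hcl2
    obtain ⟨m, hm⟩ := hcl2
    refine ⟨b * t * π ^ m, ?_⟩
    rw [un_eq x, hm, mul_comm (ℓ : ℤ) m, zpow_mul, zpow_natCast, mul_pow, mul_pow, ← ht']
    field_simp
    ring
  · intro x hx
    have hx0 : (x : E) ≠ 0 := fun h0 => by simp [h0] at hx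
    have ho0 : o (x : E) = 0 := hinj (by simp only [zpow_zero]; rw [← ho _ hx0, hx])
    have hun1 : un (x : E) = x := by simp [hun, ho0]
    simp only [hun1, ho0, Int.cast_zero, r_eq _ hx]
  · intro x hx h2
    rw [ZMod.intCast_zmod_eq_zero_iff_dvd] at h2
    obtain ⟨m, hm⟩ := h2
    refine ⟨un x, π ^ m, w_un x hx, zpow_ne_zero _ hπ0, ?_⟩
    conv_lhs => rw [un_eq x, hm, mul_comm (ℓ : ℤ) m, zpow_mul, zpow_natCast]

theorem exists_valuationSubring (h : TamePair E L w ℓ) :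
    ∃ O : ValuationSubring L,
      (∀ x, x ∈ O ↔ x = 0 ∨ IsSmallElt w ℓ x ∨
        (x ≠ 0 ∧ IsUnitMulPow w ℓ x ∧ ∀ y, IsSmallElt w ℓ y → IsSmallElt w ℓ (x * y))) ∧
      (∀ x, IsSmallElt w ℓ x → x⁻¹ ∉ O) ∧
      (∀ c : E, algebraMap E L c ∈ O ↔ w c ≤ 1) := by
  have hw := h.isLocal
  have := h.finite
  have hℓ : ℓ ≠ 0 := Nat.Prime.ne_zero Fact.out
  obtain ⟨χ, clE, hχ, ⟨u, hu, hu1⟩, clE_mul, clE_zero, clE_unit, clE_snd, π, hπ0, hπ1, hπ, hπ2⟩ :=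
    h.exists_local_class
  have clE_one : clE 1 = 0 := by
    have := clE_mul 1 1 one_ne_zero one_ne_zero
    simpa using this
  have clE_pow : ∀ (x : E) (n : ℕ), x ≠ 0 → clE (x ^ n) = n • clE x := fun x n hx => by
    induction n with
    | zero => simp [clE_one]
    | succ n ih => rw [pow_succ, clE_mul _ _ (pow_ne_zero _ hx) hx, ih, succ_nsmul]
  have clE_powℓ : ∀ x, x ≠ 0 → clE (x ^ ℓ) = 0 := fun x hx => by
    rw [clE_pow x ℓ hx]; ext <;> simp
  have hex : ∀ x : L, ∃ c : E, x ≠ 0 → c ≠ 0 ∧ ∃ z : L, z ≠ 0 ∧ x = algebraMap E L c * z ^ ℓ :=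
    fun x => by
      by_cases hx : x = 0
      · exact ⟨0, fun h => absurd hx h⟩
      · obtain ⟨c, z, hc, hz, e⟩ := h.kummer x hx
        exact ⟨c, fun _ => ⟨hc, z, hz, e⟩⟩
  choose f hf using hex
  have inj := (algebraMap E L).injective
  have map0 : ∀ {c : E}, c ≠ 0 → algebraMap E L c ≠ 0 := fun hc => by simpa using hc
  have cl_eq : ∀ {x : L} {c : E} {z : L}, c ≠ 0 → z ≠ 0 → x = algebraMap E L c * z ^ ℓ →
      clE (f x) = clE c := by
    intro x c z hc hz e
    have hx : x ≠ 0 := by rw [e]; exact mul_ne_zero (map0 hc) (pow_ne_zero _ hz)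
    obtain ⟨hc', z', hz', e'⟩ := hf x hx
    have := map0 hc'
    have := map0 hc
    have h1 : algebraMap E L (f x * c⁻¹) = (z * z'⁻¹) ^ ℓ := by
      rw [map_mul, map_inv₀, mul_pow, inv_pow, ← div_eq_mul_inv, ← div_eq_mul_inv,
        div_eq_div_iff (map0 hc) (pow_ne_zero _ hz'), ← e', e]
      ring
    obtain ⟨d, hd⟩ := h.descent _ _ h1
    have hd0 : d ≠ 0 := by
      rintro rfl
      rw [zero_pow hℓ] at hd
      exact mul_ne_zero hc' (inv_ne_zero hc) hd
    have e2 : f x = d ^ ℓ * c := by rw [← hd]; field_simp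
    rw [e2, clE_mul _ _ (pow_ne_zero _ hd0) hc, clE_powℓ d hd0, zero_add]
  set cl : L → ZMod ℓ × ZMod ℓ := fun x => clE (f x) with hcl
  have cl_mul : ∀ {x y : L}, x ≠ 0 → y ≠ 0 → cl (x * y) = cl x + cl y := by
    intro x y hx hy
    obtain ⟨h1, z1, hz1, e1⟩ := hf x hx
    obtain ⟨h2, z2, hz2, e2⟩ := hf y hy
    simp only [hcl]
    rw [← clE_mul _ _ h1 h2]
    refine cl_eq (mul_ne_zero h1 h2) (mul_ne_zero hz1 hz2) ?_
    rw [map_mul, mul_pow]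
    nth_rewrite 1 [e1, e2]
    ring
  have cl_map : ∀ {c : E}, c ≠ 0 → cl (algebraMap E L c) = clE c := fun {c} hc =>
    cl_eq hc one_ne_zero (by simp)
  have cl_powℓ : ∀ {z : L}, z ≠ 0 → cl (z ^ ℓ) = 0 := fun {z} hz => by
    rw [← clE_one]
    exact cl_eq one_ne_zero hz (by simp)
  have cl_zero : ∀ {x : L}, x ≠ 0 → cl x = 0 → ∃ z, x = z ^ ℓ := by
    intro x hx h0
    obtain ⟨h1, z1, hz1, e1⟩ := hf x hx
    obtain ⟨d, hd⟩ := clE_zero _ h1 h0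
    exact ⟨algebraMap E L d * z1, by rw [e1, hd, map_pow, mul_pow]⟩
  have cl_one : cl 1 = 0 := by simpa using cl_powℓ one_ne_zero
  have cl_pow : ∀ (x : L) (n : ℕ), x ≠ 0 → cl (x ^ n) = n • cl x := fun x n hx => by
    induction n with
    | zero => simp [cl_one]
    | succ n ih => rw [pow_succ, cl_mul (pow_ne_zero _ hx) hx, ih, succ_nsmul]
  obtain ⟨hc1, hc2⟩ := character_count h.three_le h.card hχ hu hu1
  let : Fintype (IsLocalRing.ResidueField hw.integers) := Fintype.ofFinite _
  let : Algebra hw.integers L := ((algebraMap E L).comp hw.integers.subtype).toAlgebra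
  have algmap : ∀ c : hw.integers, algebraMap hw.integers L c = algebraMap E L c := fun c => rfl
  have red_ne : ∀ c : hw.integers, IsLocalRing.residue _ c ≠ 0 ↔ w (c : E) = 1 := fun c => by
    rw [Ne, hw.residue_eq_zero_iff, not_lt]
    exact ⟨fun h => le_antisymm c.2 h, fun h => h.ge⟩
  have ne_of_w : ∀ {c : E}, w c = 1 → c ≠ 0 := fun h h0 => by simp [h0] at h
  let R : RigidClass L hw.integers (IsLocalRing.ResidueField hw.integers) ℓ :=
    { cl := cl
      cl_mul := cl_mul
      coll := by
        intro x hx hx1 hne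
        obtain ⟨i, z, e⟩ := h.coll x hx hx1 (by
          rintro ⟨z, rfl⟩
          exact hne (cl_powℓ (by rintro rfl; exact hx (zero_pow hℓ))))
        have hz : z ≠ 0 := by
          rintro rfl
          rw [zero_pow hℓ, mul_zero] at e
          exact hx1 e
        refine ⟨i, ?_⟩
        rw [e, cl_mul (pow_ne_zero _ hx) (pow_ne_zero _ hz), cl_pow _ _ hx, cl_powℓ hz, add_zero,
          Nat.cast_smul_eq_nsmul]
      red := IsLocalRing.residue _
      red_surj := IsLocalRing.residue_surjective
      χ := χ
      χ_mul := hχ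
      map_ne_zero := fun {c} hc => map0 (ne_of_w ((red_ne c).1 hc))
      cl_unit := fun {c} hc => by
        rw [algmap, cl_map (ne_of_w ((red_ne c).1 hc))]
        exact clE_unit c ((red_ne c).1 hc)
      odd := h.three_le
      count := hc1
      count' := hc2 }
  have hv : ∀ {x : L}, x ≠ 0 → (R.v x = 0 ↔ IsUnitMulPow w ℓ x) := by
    intro x hx
    constructor
    · intro h0
      obtain ⟨h1, z1, hz1, e1⟩ := hf x hx
      obtain ⟨c, z, hc, hz, e⟩ := clE_snd _ h1 h0
      refine ⟨c, algebraMap E L z * z1, hc, mul_ne_zero (map0 hz) hz1, ?_⟩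
      rw [e1, e, map_mul, map_pow]; ring
    · rintro ⟨c, z, hc, hz, e⟩
      have h1 : R.cl x = clE c := cl_eq (ne_of_w hc) hz e
      have h2 := clE_unit ⟨c, hc.le⟩ hc
      rw [RigidClass.v, h1]
      exact congrArg Prod.snd h2
  have hsmall : ∀ x, R.Small x ↔ IsSmallElt w ℓ x := by
    intro x
    constructor
    · intro hs
      exact ⟨hs.1, fun h' => hs.2.1 ((hv hs.1).2 h'), cl_zero hs.one_add_ne hs.2.2⟩
    · rintro ⟨h1, h2, z, hz⟩
      have h3 : R.v x ≠ 0 := fun h' => h2 ((hv h1).1 h')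
      have h4 : 1 + x ≠ 0 := R.add_ne_zero_of_v (by rw [R.v_one]; exact h3.symm)
      refine ⟨h1, h3, ?_⟩
      rw [hz]
      exact cl_powℓ (by rintro rfl; rw [hz, zero_pow hℓ] at h4; exact h4 rfl)
  have hmem : ∀ c : E, w c = 1 → algebraMap E L c ∈ R.valuationSubring := fun c hc =>
    RigidClass.const_mem (R := R) (c := ⟨c, hc.le⟩) ((red_ne _).2 hc)
  have hπE : π ≠ 0 := w.pos_iff.1 hπ0
  have hπsmall : R.Small (algebraMap E L π) := by
    have h1 : R.v (algebraMap E L π) ≠ 0 := by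
      change (cl (algebraMap E L π)).2 ≠ 0
      rw [cl_map hπE, hπ2]
      exact one_ne_zero
    refine (hsmall _).2 ⟨map0 hπE, fun h' => h1 ((hv (map0 hπE)).2 h'), ?_⟩
    obtain ⟨t, ht⟩ := h.hensel π hπ1
    exact ⟨algebraMap E L t, by rw [← map_one (algebraMap E L), ← map_add, ht, map_pow]⟩
  refine ⟨R.valuationSubring, ?_, ?_, ?_⟩
  · intro x
    rw [RigidClass.mem_valuationSubring, RigidClass.Mem, hsmall]
    refine or_congr_right (or_congr_right ⟨?_, ?_⟩)
    · rintro ⟨h1, h2, h3⟩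
      exact ⟨h1, (hv h1).1 h2, fun y hy => (hsmall _).1 (h3 y ((hsmall y).2 hy))⟩
    · rintro ⟨h1, h2, h3⟩
      exact ⟨h1, (hv h1).2 h2, fun y hy => (hsmall _).2 (h3 y ((hsmall y).1 hy))⟩
  · intro x hx
    exact ((hsmall x).2 hx).inv_not_mem
  · intro c
    by_cases hc : c = 0
    · simp [hc, R.valuationSubring.zero_mem]
    obtain ⟨n, hn⟩ := IsLocalAbs.exists_zpow hπ0 hπ1 hπ hc
    have hu : w (c * π ^ (-n)) = 1 := by
      rw [map_mul, map_zpow₀, hn, ← zpow_add₀ hπ0.ne', add_neg_cancel, zpow_zero]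
    rw [hn]
    rcases Int.eq_nat_or_neg n with ⟨m, rfl | rfl⟩
    · rw [zpow_natCast]
      refine iff_of_true ?_ (pow_le_one₀ (w.nonneg _) hπ1.le)
      have e : c = (c * π ^ (-(m : ℤ))) * π ^ m := by
        rw [mul_assoc, ← zpow_natCast, ← zpow_add₀ hπE, neg_add_cancel, zpow_zero, mul_one]
      rw [e, map_mul, map_pow]
      exact mul_mem (hmem _ hu) (pow_mem hπsmall.mem m)
    · rcases m with _ | m
      · simp only [Nat.cast_zero, neg_zero, zpow_zero, mul_one, le_refl, iff_true] at hu ⊢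
        exact hmem _ hu
      · rw [zpow_neg, zpow_natCast, ← inv_pow]
        refine iff_of_false (fun hcO => ?_)
          (not_le.2 (one_lt_pow₀ ((one_lt_inv₀ hπ0).2 hπ1) (Nat.succ_ne_zero m)))
        refine hπsmall.inv_not_mem ?_
        have e : (algebraMap E L π)⁻¹
            = algebraMap E L (c * π ^ (- -((m + 1 : ℕ) : ℤ)))⁻¹ * algebraMap E L c
              * (algebraMap E L π) ^ m := by
          rw [← map_inv₀, ← map_pow, ← map_mul, ← map_mul, neg_neg, zpow_natCast, pow_succ]
          congr 1
          field_simp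
        rw [e]
        exact mul_mem (mul_mem (hmem _ (by rw [map_inv₀, hu, inv_one])) hcO)
          (pow_mem hπsmall.mem m)

end TamePair

/-- A complete local field `E` in a field `L` with a valuation ring `O` of `L` extending the ring of
integers of `E`, whose principal units are `p`-th powers up to units of `E`. -/
structure WildPair (E L : Type*) [Field E] [Field L] [Algebra E L] (w : AbsoluteValue E ℝ)
    (p : ℕ) (O : ValuationSubring L) : Prop where
  isLocal : IsLocalAbs w
  complete : ∀ π : E, 0 < w π → w π < 1 → ∀ u : ℕ → E, (∀ n, w (u (n + 1) - u n) ≤ w π ^ n) →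
    ∃ a, ∀ n, w (a - u n) ≤ w π ^ n
  p_lt : w (p : E) < 1
  perfect : ∀ c : E, w c ≤ 1 → ∃ b : E, w (c - b ^ p) < 1
  mem_iff : ∀ c : E, algebraMap E L c ∈ O ↔ w c ≤ 1
  unit_pow : ∀ y : L, O.valuation y < 1 →
    ∃ c : E, ∃ t : L, w c = 1 ∧ 1 + y = algebraMap E L c * t ^ p
  descent : ∀ (c : E) (z : L), algebraMap E L c = z ^ p → ∃ d, c = d ^ p

namespace WildPair

variable {E L : Type*} [Field E] [Field L] [Algebra E L] {w : AbsoluteValue E ℝ}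
  {p : ℕ} {O : ValuationSubring L}

local notation "ι" => algebraMap E L
local notation "V" => ValuationSubring.valuation O

lemma V_mul_le {x y : L} (hx : V x ≤ 1) (hy : V y ≤ 1) : V (x * y) ≤ 1 := by
  rw [map_mul]; exact Left.mul_le_one hx hy

lemma V_mul_lt_left {x y : L} (hx : V x < 1) (hy : V y ≤ 1) : V (x * y) < 1 := by
  rw [map_mul]; exact mul_lt_one_of_lt_of_le hx hy

lemma V_mul_lt_right {x y : L} (hx : V x ≤ 1) (hy : V y < 1) : V (x * y) < 1 := by
  rw [mul_comm]; exact V_mul_lt_left hy hx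

lemma V_pow_lt {x : L} (hp : p ≠ 0) : V (x ^ p) < 1 ↔ V x < 1 := by
  rw [map_pow]; exact pow_lt_one_iff hp

lemma V_pow_le {x : L} (hp : p ≠ 0) : V (x ^ p) ≤ 1 ↔ V x ≤ 1 := by
  rw [map_pow]; exact pow_le_one_iff hp

lemma V_le (h : WildPair E L w p O) (c : E) : V (ι c) ≤ 1 ↔ w c ≤ 1 := by
  rw [O.valuation_le_one_iff, h.mem_iff]

lemma V_lt (h : WildPair E L w p O) (c : E) : V (ι c) < 1 ↔ w c < 1 := by
  by_cases hc : c = 0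
  · simp [hc]
  have h1 := h.V_le c⁻¹
  rw [map_inv₀, map_inv₀, map_inv₀, ← not_iff_not, not_le, not_le] at h1
  rwa [one_lt_inv₀ (w.pos hc), one_lt_inv₀ (by simpa [zero_lt_iff] using hc)] at h1

lemma V_eq (h : WildPair E L w p O) {c : E} (hc : w c = 1) : V (ι c) = 1 :=
  le_antisymm ((h.V_le c).2 hc.le) (not_lt.1 fun h' => by
    have := (h.V_lt c).1 h'
    linarith)

lemma V_p (h : WildPair E L w p O) : V (p : L) < 1 := by
  have := (h.V_lt p).2 h.p_lt
  rwa [map_natCast] at this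

lemma exists_add_pow [hp : Fact p.Prime] {x y : L} (hx : V x ≤ 1) (hy : V y ≤ 1) :
    ∃ r : L, V r ≤ 1 ∧ (x + y) ^ p = x ^ p + y ^ p + p * x * y * r := by
  rw [O.valuation_le_one_iff] at hx hy
  obtain ⟨r, hr⟩ := exists_add_pow_prime_eq (R := O) hp.out ⟨x, hx⟩ ⟨y, hy⟩
  refine ⟨r, (O.valuation_le_one_iff _).2 r.2, ?_⟩
  have := congrArg (fun z : O => (z : L)) hr
  simpa using this

lemma V_add_pow_sub [Fact p.Prime] (h : WildPair E L w p O) {x y : L} (hx : V x ≤ 1)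
    (hy : V y ≤ 1) : V ((x + y) ^ p - x ^ p - y ^ p) < 1 := by
  obtain ⟨r, hr, e⟩ := exists_add_pow (O := O) (p := p) hx hy
  rw [e, show x ^ p + y ^ p + p * x * y * r - x ^ p - y ^ p = p * x * y * r by ring, map_mul,
    map_mul, map_mul]
  calc V (p : L) * V x * V y * V r ≤ V (p : L) * 1 * 1 * 1 := by gcongr
    _ < 1 := by simpa using h.V_p

/-- Every principal unit is a `p`-th power of a principal unit up to a principal unit of `E`. -/
lemma principal_unit [hp : Fact p.Prime] (h : WildPair E L w p O) {π : E} (h0 : 0 < w π)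
    (hπ : ∀ x, w x < 1 → w x ≤ w π) {y : L} (hy : V y < 1) :
    ∃ (c : E) (s r : L), w c ≤ 1 ∧ V s < 1 ∧ V r ≤ 1 ∧
      1 + y = (1 + ι π * ι c) * (1 + s ^ p + ι π * s * r) := by
  have hp0 : p ≠ 0 := hp.out.ne_zero
  have hπ0 : π ≠ 0 := w.pos_iff.1 h0
  obtain ⟨c, t, hc, e⟩ := h.unit_pow y hy
  obtain ⟨b, hb⟩ := h.perfect c hc.le
  have hb1 : w b = 1 := by
    have h1 : w (b ^ p) = 1 := by
      have := h.isLocal.add_eq_left (x := c) (y := -(c - b ^ p)) (by rwa [map_neg_eq_map, hc])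
      rwa [← sub_eq_add_neg, sub_sub_cancel, hc] at this
    rw [map_pow] at h1
    exact (pow_eq_one_iff_of_nonneg (w.nonneg _) hp0).1 h1
  have hb0 : b ≠ 0 := by rintro rfl; simp at hb1
  have hVb := h.V_eq hb1
  -- replace `c, t` by `c / b ^ p` and `b * t`
  have e2 : 1 + y = ι (c / b ^ p) * (ι b * t) ^ p := by
    have : ι b ≠ 0 := by simpa using hb0
    rw [e, map_div₀, map_pow, mul_pow]; field_simp
  have hwc : w (c / b ^ p - 1) < 1 := by
    rw [div_sub_one (pow_ne_zero _ hb0), map_div₀, map_pow, hb1, one_pow, div_one]; exact hb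
  set c' := (c / b ^ p - 1) / π with hc'
  have hwc' : w c' ≤ 1 := by
    rw [hc', map_div₀]; exact div_le_one_of_le₀ (hπ _ hwc) h0.le
  have ec : c / b ^ p = 1 + π * c' := by rw [hc']; field_simp; ring
  set t' := ι b * t with ht'
  have hVπ : V (ι (c / b ^ p - 1)) < 1 := (h.V_lt _).2 hwc
  have hV1 : V (ι (c / b ^ p)) = 1 := h.V_eq (by rw [map_div₀, map_pow, hb1, hc]; simp)
  have hVt : V t' = 1 := by
    have h1 : V (t' ^ p) = 1 := by
      have h2 : V (1 + y) = 1 := by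
        rw [Valuation.map_add_eq_of_lt_left _ (by simpa using hy), map_one]
      rw [e2, map_mul, hV1, one_mul] at h2
      exact h2
    rw [map_pow] at h1
    exact (pow_eq_one_iff_left hp0).1 h1
  have hVs : V (t' - 1) < 1 := by
    have h1 : V (t' ^ p - 1) < 1 := by
      have h2 : t' ^ p - 1 = y - ι (c / b ^ p - 1) * t' ^ p := by
        rw [map_sub, map_one, sub_mul, ← e2]; ring
      rw [h2]
      refine Valuation.map_sub_lt _ hy ?_
      rw [map_mul, map_pow, hVt, one_pow, mul_one]
      exact hVπ
    have h3 := h.V_add_pow_sub (x := t' - 1) (y := 1)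
      (Valuation.map_sub_le _ hVt.le (by simp)) (by simp)
    rw [sub_add_cancel, one_pow] at h3
    have h4 : V ((t' - 1) ^ p) < 1 := by
      have : (t' - 1) ^ p = (t' ^ p - 1) - (t' ^ p - (t' - 1) ^ p - 1) := by ring
      rw [this]
      exact Valuation.map_sub_lt _ h1 h3
    exact (V_pow_lt hp0).1 h4
  obtain ⟨r, hr, er⟩ := exists_add_pow (O := O) (p := p) (x := 1) (y := t' - 1) (by simp) hVs.le
  have hpπ : w ((p : E) / π) ≤ 1 := by
    rw [map_div₀]; exact div_le_one_of_le₀ (hπ _ h.p_lt) h0.le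
  refine ⟨c', t' - 1, ι (p / π) * r, hwc', hVs, ?_, ?_⟩
  · exact V_mul_le ((h.V_le _).2 hpπ) hr
  · have : ι π ≠ 0 := by simpa using hπ0
    rw [e2, ec, ← map_mul, ← map_one ι, ← map_add, map_one]
    congr 1
    rw [add_sub_cancel, one_pow] at er
    rw [er, map_div₀, map_natCast]
    field_simp

/-- The value of the uniformizer of `E` is not a `p`-th power in the value group of `O`. -/
lemma unif_ne_pow [hp : Fact p.Prime] (h : WildPair E L w p O) {π : E} (h0 : 0 < w π)
    (h1 : w π < 1) (hπ : ∀ x, w x < 1 → w x ≤ w π) (x : L) : V (ι π) ≠ V x ^ p := by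
  intro hx
  have hp0 : p ≠ 0 := hp.out.ne_zero
  have hπ0 : π ≠ 0 := w.pos_iff.1 h0
  have hπL : ι π ≠ 0 := by simpa using hπ0
  have hx0 : x ≠ 0 := by
    rintro rfl
    rw [map_zero, zero_pow hp0] at hx
    exact hπL ((map_eq_zero _).1 hx)
  set ω := x ^ p / ι π with hω
  have hVω : V ω = 1 := by
    rw [hω, map_div₀, map_pow, hx, div_self (pow_ne_zero _ (by simpa using hx0))]
  have star : ∀ y, V y ≤ 1 → ∃ (c : E) (f : L), w c ≤ 1 ∧ V f ≤ 1 ∧ V (y - ι c - ω * f ^ p) < 1 := by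
    intro y hy
    have hπy : V (ι π * y) < 1 := by
      exact V_mul_lt_left ((h.V_lt π).2 h1) hy
    obtain ⟨c, s, r, hc, hs, hr, e⟩ := h.principal_unit h0 hπ hπy
    have hVc := (h.V_le c).2 hc
    have e2 : y - ι c - ω * (s / x) ^ p = s * r + ι c * s ^ p + ι π * ι c * s * r := by
      rw [hω, div_pow]
      field_simp
      linear_combination e
    have hlt : V (y - ι c - ω * (s / x) ^ p) < 1 := by
      rw [e2]
      have hVπ := (h.V_lt π).2 h1
      refine Valuation.map_add_lt _ (Valuation.map_add_lt _ ?_ ?_) ?_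
      · exact V_mul_lt_left hs hr
      · exact V_mul_lt_right hVc ((V_pow_lt hp0).2 hs)
      · exact V_mul_lt_left (V_mul_lt_right (V_mul_le hVπ.le hVc) hs) hr
    refine ⟨c, s / x, hc, ?_, hlt⟩
    have h3 : V (ω * (s / x) ^ p) ≤ 1 := by
      have : ω * (s / x) ^ p = (y - ι c) - (y - ι c - ω * (s / x) ^ p) := by ring
      rw [this]
      exact Valuation.map_sub_le _ (Valuation.map_sub_le _ hy hVc) hlt.le
    rw [map_mul, hVω, one_mul] at h3
    exact (V_pow_le hp0).1 h3
  have perf : ∀ c : E, w c ≤ 1 → ∃ b : E, w b ≤ 1 ∧ V (ι c - ι b ^ p) < 1 := by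
    intro c hc
    obtain ⟨b, hb⟩ := h.perfect c hc
    refine ⟨b, ?_, ?_⟩
    · have h3 : w (b ^ p) ≤ 1 := by
        have := h.isLocal.add_le c (-(c - b ^ p))
        rw [← sub_eq_add_neg, sub_sub_cancel, map_neg_eq_map] at this
        exact this.trans (max_le hc hb.le)
      rw [map_pow] at h3
      exact le_of_not_gt fun h5 => absurd h3 (not_le.2 (one_lt_pow₀ h5 hp0))
    · rw [← map_pow, ← map_sub]; exact (h.V_lt _).2 hb
  -- `ω` is a `p`-th power in the residue field
  have claim : ∃ v, V v ≤ 1 ∧ V (ω - v ^ p) < 1 := by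
    by_contra! hcon
    have all : ∀ g, V g ≤ 1 → ∃ b : E, w b ≤ 1 ∧ V (g - ι b) < 1 := by
      intro g hg
      obtain ⟨c, f, hc, hf, e⟩ := star (g ^ p) ((V_pow_le hp0).2 hg)
      obtain ⟨b, hb, e'⟩ := perf c hc
      have hVb := (h.V_le b).2 hb
      refine ⟨b, hb, ?_⟩
      have h3 := h.V_add_pow_sub (x := g - ι b) (y := ι b) (Valuation.map_sub_le _ hg hVb) hVb
      rw [sub_add_cancel] at h3
      have h4 : V ((g - ι b) ^ p - ω * f ^ p) < 1 := by
        have : (g - ι b) ^ p - ω * f ^ p = (g ^ p - ι c - ω * f ^ p) + (ι c - ι b ^ p)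
          - (g ^ p - (g - ι b) ^ p - ι b ^ p) := by ring
        rw [this]
        exact Valuation.map_sub_lt _ (Valuation.map_add_lt _ e e') h3
      have hf1 : V f < 1 := by
        refine lt_of_le_of_ne hf fun hf1 => ?_
        have hf0 : f ≠ 0 := by rintro rfl; simp at hf1
        have h5 := hcon ((g - ι b) / f) (by
          rw [map_div₀, hf1, div_one]; exact Valuation.map_sub_le _ hg hVb)
        rw [← not_lt] at h5
        refine h5 ?_
        have : ω - ((g - ι b) / f) ^ p = -((g - ι b) ^ p - ω * f ^ p) / f ^ p := by
          rw [div_pow]; field_simp; ring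
        rw [this, map_div₀, map_pow, hf1, one_pow, div_one, Valuation.map_neg]
        exact h4
      have h6 : V ((g - ι b) ^ p) < 1 := by
        have : (g - ι b) ^ p = ((g - ι b) ^ p - ω * f ^ p) + ω * f ^ p := by ring
        rw [this]
        refine Valuation.map_add_lt _ h4 ?_
        rw [map_mul, hVω, one_mul]
        exact (V_pow_lt hp0).2 hf1
      exact (V_pow_lt hp0).1 h6
    obtain ⟨b, hb, e⟩ := all ω hVω.le
    obtain ⟨b', hb', e'⟩ := perf b hb
    refine absurd (hcon (ι b') ((h.V_le _).2 hb')) (not_le.2 ?_)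
    have : ω - ι b' ^ p = (ω - ι b) + (ι b - ι b' ^ p) := by ring
    rw [this]
    exact Valuation.map_add_lt _ e e'
  obtain ⟨v, hv, e⟩ := claim
  have hvp : V (v ^ p) = 1 := by
    have := Valuation.map_sub_eq_of_lt_left V (x := ω) (y := ω - v ^ p) (by rwa [hVω])
    rwa [hVω, sub_sub_cancel] at this
  have hv0 : v ≠ 0 := by
    rintro rfl
    rw [zero_pow hp0, map_zero] at hvp
    exact zero_ne_one hvp
  obtain ⟨c, t, hc, et⟩ := h.unit_pow ((ω - v ^ p) / v ^ p) (by rwa [map_div₀, hvp, div_one])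
  have hc0 : c ≠ 0 := by rintro rfl; simp at hc
  have hcL : ι c ≠ 0 := by simpa using hc0
  have eω : ω = ι c * (t * v) ^ p := by
    rw [mul_pow, ← mul_assoc, ← et]; field_simp; ring
  have ht0 : t * v ≠ 0 := by
    intro h0
    rw [h0, zero_pow hp0, mul_zero] at eω
    rw [eω, map_zero] at hVω
    exact zero_ne_one hVω
  obtain ⟨d, hd⟩ := h.descent (π * c) (x / (t * v)) (by
    rw [map_mul, div_pow, eq_div_iff (pow_ne_zero _ ht0), mul_assoc, ← eω, hω]
    field_simp)
  have hw := congrArg w hd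
  rw [map_mul, hc, mul_one, map_pow] at hw
  have hd1 : w d < 1 := lt_of_not_ge fun h5 => by
    have := one_le_pow₀ h5 (n := p)
    linarith
  have h5 := pow_le_pow_left₀ (w.nonneg _) (hπ d hd1) p
  have h6 : w π ^ p < w π ^ 1 := pow_lt_pow_right_of_lt_one₀ h0 h1 hp.out.one_lt
  rw [pow_one] at h6
  linarith

lemma V_le_unif [hp : Fact p.Prime] (h : WildPair E L w p O) {π : E} (h0 : 0 < w π)
    (h1 : w π < 1) (hπ : ∀ x, w x < 1 → w x ≤ w π) {y : L} (hy : V y < 1) : V y ≤ V (ι π) := by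
  by_contra! hcon
  have hπ0 : ι π ≠ 0 := by simpa using w.pos_iff.1 h0
  have key : ∀ z, V z < 1 → V (ι π) < V z → ∃ s, V z = V s ^ p := by
    intro z hz hlt
    obtain ⟨c, s, r, hc, hs, hr, e⟩ := h.principal_unit h0 hπ hz
    refine ⟨s, ?_⟩
    have hVc := (h.V_le c).2 hc
    have e2 : z - s ^ p = ι π * (ι c + s * r + ι c * (s ^ p + ι π * (s * r))) := by
      linear_combination e
    have h3 : V (z - s ^ p) < V z := by
      rw [e2, map_mul]
      refine lt_of_le_of_lt ?_ hlt
      refine mul_le_of_le_one_right' ?_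
      have hsr := V_mul_le hs.le hr
      refine Valuation.map_add_le _ (Valuation.map_add_le _ hVc hsr) (V_mul_le hVc ?_)
      exact Valuation.map_add_le _ ((V_pow_le hp.out.ne_zero).2 hs.le)
        (V_mul_le ((h.V_lt π).2 h1).le hsr)
    rw [← map_pow, ← Valuation.map_sub_eq_of_lt_left V h3, sub_sub_cancel]
  have hy0 : y ≠ 0 := by rintro rfl; simp at hcon
  have hVy : 0 < V y := by simpa [zero_lt_iff] using hy0
  obtain ⟨s, hs⟩ := key y hy hcon
  obtain ⟨s', hs'⟩ := key (ι π / y) (by rwa [map_div₀, div_lt_one₀ hVy]) (by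
    rw [map_div₀, lt_div_iff₀ hVy]
    exact mul_lt_of_lt_one_right (by simpa [zero_lt_iff] using hπ0) hy)
  refine h.unif_ne_pow h0 h1 hπ (s * s') ?_
  rw [map_mul, mul_pow, ← hs, ← hs', ← map_mul, mul_div_cancel₀ _ hy0]

lemma exists_sub_lt [hp : Fact p.Prime] (h : WildPair E L w p O) {π : E} (h0 : 0 < w π)
    (h1 : w π < 1) (hπ : ∀ x, w x < 1 → w x ≤ w π) {y : L} (hy : V y ≤ 1) :
    ∃ c : E, w c ≤ 1 ∧ V (y - ι c) < 1 := by
  have hπ0 : ι π ≠ 0 := by simpa using w.pos_iff.1 h0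
  have hVπ := (h.V_lt π).2 h1
  obtain ⟨c, s, r, hc, hs, hr, e⟩ := h.principal_unit h0 hπ (V_mul_lt_left hVπ hy)
  refine ⟨c, hc, ?_⟩
  have hVc := (h.V_le c).2 hc
  obtain ⟨m, rfl⟩ : ∃ m, p = m + 2 := ⟨p - 2, (Nat.sub_add_cancel hp.out.two_le).symm⟩
  have e2 : y - ι c = (s / ι π) * s ^ m * s + s * r + ι c * (s ^ (m + 2) + ι π * (s * r)) := by
    field_simp
    linear_combination e
  have hsm : V (s ^ m) ≤ 1 := by rw [map_pow]; exact pow_le_one' hs.le _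
  have hsπ : V (s / ι π) ≤ 1 := by
    rw [map_div₀, div_le_one₀ (by simpa [zero_lt_iff] using hπ0)]
    exact h.V_le_unif h0 h1 hπ hs
  rw [e2]
  refine Valuation.map_add_lt _ (Valuation.map_add_lt _ (V_mul_lt_right (V_mul_le hsπ hsm) hs)
    (V_mul_lt_left hs hr)) (V_mul_lt_right hVc (Valuation.map_add_lt _ ?_ ?_))
  · exact (V_pow_lt (by lia)).2 hs
  · exact V_mul_lt_left hVπ (V_mul_le hs.le hr)

lemma exists_sub_mem [hp : Fact p.Prime] (h : WildPair E L w p O) {π : E} (h0 : 0 < w π)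
    (h1 : w π < 1) (hπ : ∀ x, w x < 1 → w x ≤ w π) {x : L} (hx : V x ≤ 1) :
    ∃ a : E, ∀ n : ℕ, V (x - ι a) ≤ V (ι π) ^ n := by
  have hπ0 : ι π ≠ 0 := by simpa using w.pos_iff.1 h0
  have hVπ : 0 < V (ι π) := by simpa [zero_lt_iff] using hπ0
  choose! c hc hcy using fun (y : L) (hy : V y ≤ 1) => h.exists_sub_lt h0 h1 hπ hy
  let z : ℕ → L := fun n => Nat.rec x (fun _ y => (y - ι (c y)) / ι π) n
  have hz : ∀ n, V (z n) ≤ 1 := by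
    intro n
    induction n with
    | zero => exact hx
    | succ n ih =>
      change V ((z n - ι (c (z n))) / ι π) ≤ 1
      rw [map_div₀, div_le_one₀ hVπ]
      exact h.V_le_unif h0 h1 hπ (hcy _ ih)
  let u : ℕ → E := fun n => ∑ i ∈ Finset.range n, c (z i) * π ^ i
  have hu : ∀ n, x - ι (u n) = ι π ^ n * z n := by
    intro n
    induction n with
    | zero => simp [u, z]
    | succ n ih =>
      have e : ι π * z (n + 1) = z n - ι (c (z n)) := by
        change ι π * ((z n - ι (c (z n))) / ι π) = _
        field_simp
      have e' : u (n + 1) = u n + c (z n) * π ^ n := Finset.sum_range_succ _ _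
      rw [e', map_add, map_mul, map_pow, pow_succ, mul_assoc, e]
      linear_combination ih
  obtain ⟨a, ha⟩ := h.complete π h0 h1 u (fun n => by
    have e' : u (n + 1) = u n + c (z n) * π ^ n := Finset.sum_range_succ _ _
    rw [e', add_sub_cancel_left, map_mul, map_pow]
    exact mul_le_of_le_one_left (by positivity) (hc _ (hz n)))
  refine ⟨a, fun n => ?_⟩
  have e : x - ι a = ι π ^ n * z n - ι π ^ n * ι ((a - u n) / π ^ n) := by
    rw [map_div₀, map_pow, mul_div_cancel₀ _ (pow_ne_zero _ hπ0), ← hu n, map_sub]; ring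
  rw [e, ← mul_sub, map_mul, map_pow]
  refine mul_le_of_le_one_right' (Valuation.map_sub_le _ (hz n) ((h.V_le _).2 ?_))
  rw [map_div₀, map_pow]
  exact div_le_one_of_le₀ (ha n) (by positivity)

/-- The coarsening of `O` obtained by inverting a uniformizer of `E`: it contains `E`, and `E`
maps onto its residue field. -/
theorem exists_coarsening [hp : Fact p.Prime] (h : WildPair E L w p O) :
    ∃ R : ValuationSubring L, (∀ c, ι c ∈ R) ∧
      ∀ x ∈ R, ∃ e : E, x - ι e = 0 ∨ (x - ι e)⁻¹ ∉ R := by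
  obtain ⟨π, h0, h1, hπ⟩ := h.isLocal.exists_unif
  have hπ0 : ι π ≠ 0 := by simpa using w.pos_iff.1 h0
  have hπO : ι π ∈ O := (h.mem_iff π).2 h1.le
  have hinv : (ι π)⁻¹ ∉ O := by
    rw [← map_inv₀, h.mem_iff, map_inv₀, not_le]
    exact (one_lt_inv₀ h0).2 h1
  let R : ValuationSubring L :=
    { carrier := {x | ∃ n : ℕ, ι π ^ n * x ∈ O}
      mul_mem' := by
        rintro x y ⟨n, hn⟩ ⟨m, hm⟩
        exact ⟨n + m, by simpa [pow_add, mul_mul_mul_comm] using O.mul_mem _ _ hn hm⟩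
      one_mem' := ⟨0, by simp⟩
      add_mem' := by
        rintro x y ⟨n, hn⟩ ⟨m, hm⟩
        refine ⟨n + m, ?_⟩
        have e : ι π ^ (n + m) * (x + y) = ι π ^ m * (ι π ^ n * x) + ι π ^ n * (ι π ^ m * y) := by
          ring
        rw [e]
        exact O.add_mem _ _ (O.mul_mem _ _ (pow_mem hπO _) hn) (O.mul_mem _ _ (pow_mem hπO _) hm)
      zero_mem' := ⟨0, by simp⟩
      neg_mem' := by
        rintro x ⟨n, hn⟩
        exact ⟨n, by simpa using O.neg_mem _ hn⟩
      mem_or_inv_mem' := fun x => (O.mem_or_inv_mem x).imp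
        (fun hx => ⟨0, by simpa using hx⟩) (fun hx => ⟨0, by simpa using hx⟩) }
  have hR : ∀ x, x ∈ R ↔ ∃ n : ℕ, ι π ^ n * x ∈ O := fun x => Iff.rfl
  refine ⟨R, fun c => (hR _).2 ?_, fun x hx => ?_⟩
  · by_cases hc : c = 0
    · exact ⟨0, by simp [hc]⟩
    obtain ⟨n, hn⟩ := exists_pow_lt_of_lt_one (inv_pos.2 (w.pos hc)) h1
    refine ⟨n, ?_⟩
    rw [← map_pow, ← map_mul, h.mem_iff, map_mul, map_pow]
    rw [← one_div, lt_div_iff₀ (w.pos hc)] at hn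
    exact hn.le
  · obtain ⟨n, hn⟩ := (hR x).1 hx
    obtain ⟨a, ha⟩ := h.exists_sub_mem h0 h1 hπ ((O.valuation_le_one_iff _).2 hn)
    refine ⟨a / π ^ n, or_iff_not_imp_left.2 fun hne hmem => ?_⟩
    obtain ⟨m, hm⟩ := (hR _).1 hmem
    have h2 := ha (n + m + 1)
    rw [← O.valuation_le_one_iff] at hm hinv
    refine hinv ?_
    have e : (ι π)⁻¹ = (ι π ^ m * (x - ι (a / π ^ n))⁻¹) *
        ((ι π ^ n * x - ι a) / ι π ^ (n + m + 1)) := by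
      have e3 : ι π ^ n * x - ι a = ι π ^ n * (x - ι (a / π ^ n)) := by
        rw [map_div₀, map_pow]; field_simp
      rw [e3, pow_succ, pow_add]
      field_simp
    rw [e]
    refine V_mul_le hm ?_
    rw [map_div₀, map_pow]
    exact div_le_one_of_le₀ h2 zero_le

end WildPair

/-- The subfield of `A` fixed by a subgroup `D` of a group acting on `A`. -/
abbrev FixF {G : Type*} [Group G] (D : Subgroup G) (A : Type*) [Field A] [MulSemiringAction G A] :
    Subfield A := FixedPoints.subfield D A

section FixF

variable {G A : Type*} [Group G] [Field A] [MulSemiringAction G A]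

lemma mem_FixF {D : Subgroup G} {x : A} : x ∈ FixF D A ↔ ∀ g ∈ D, g • x = x :=
  ⟨fun h g hg => h ⟨g, hg⟩, fun h g => h g g.2⟩

lemma smul_of_mem_FixF {D : Subgroup G} {x : A} (h : x ∈ FixF D A) {g : G} (hg : g ∈ D) :
    g • x = x := mem_FixF.1 h g hg

lemma FixF_anti {D D' : Subgroup G} (h : D' ≤ D) : FixF D A ≤ FixF D' A := fun _ hx =>
  mem_FixF.2 fun g hg => mem_FixF.1 hx g (h hg)

/-- The product of the first `n` iterates of `g` applied to `x`. -/
def cycNorm (g : G) (n : ℕ) (x : A) : A := ∏ i ∈ Finset.range n, g ^ i • x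

lemma cycNorm_mul (g : G) (n : ℕ) (x y : A) :
    cycNorm g n (x * y) = cycNorm g n x * cycNorm g n y := by
  simp [cycNorm, smul_mul', Finset.prod_mul_distrib]

lemma cycNorm_pow (g : G) (n : ℕ) (x : A) (m : ℕ) :
    cycNorm g n (x ^ m) = cycNorm g n x ^ m := by
  simp [cycNorm, smul_pow', Finset.prod_pow]

lemma cycNorm_ne_zero (g : G) (n : ℕ) {x : A} (hx : x ≠ 0) : cycNorm g n x ≠ 0 :=
  Finset.prod_ne_zero_iff.2 fun i _ => (smul_ne_zero_iff_ne (g ^ i)).2 hx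

lemma cycNorm_of_mem {D : Subgroup G} {g : G} (hg : g ∈ D) (n : ℕ) {x : A} (hx : x ∈ FixF D A) :
    cycNorm g n x = x ^ n := by
  rw [cycNorm, Finset.prod_congr rfl fun i _ => smul_of_mem_FixF hx (pow_mem hg i)]
  simp

lemma pow_smul_of_smul_eq {g : G} {a x : A} (ha : g • a = a) (hx : g • x = a * x) (i : ℕ) :
    g ^ i • x = a ^ i * x := by
  induction i with
  | zero => simp
  | succ i ih => rw [pow_succ', mul_smul, ih, smul_mul', smul_pow', ha, hx, pow_succ]; ring

lemma prod_sub_pow_mul {n : ℕ} [NeZero n] {ζ : A} (hζ : IsPrimitiveRoot ζ n) (a x : A) :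
    ∏ i ∈ Finset.range n, (a - ζ ^ i * x) = a ^ n - x ^ n := by
  classical
  rw [hζ.pow_sub_pow_eq_prod_sub_mul _ _ (NeZero.pos n)]
  have himg : Polynomial.nthRootsFinset n (1 : A) = (Finset.range n).image (ζ ^ ·) := by
    ext y
    rw [Polynomial.mem_nthRootsFinset (NeZero.pos n), Finset.mem_image]
    constructor
    · intro h
      obtain ⟨i, hi, e⟩ := hζ.eq_pow_of_pow_eq_one h
      exact ⟨i, Finset.mem_range.2 hi, e⟩
    · rintro ⟨i, -, rfl⟩
      rw [← pow_mul, mul_comm, pow_mul, hζ.pow_eq_one, one_pow]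
  rw [himg, Finset.prod_image fun i hi j hj h => hζ.pow_inj (Finset.mem_range.1 hi)
    (Finset.mem_range.1 hj) h]

lemma cycNorm_sub {g : G} {n : ℕ} [NeZero n] {ζ a x : A} (hζ : IsPrimitiveRoot ζ n)
    (hg : g • ζ = ζ) (ha : g • a = a) (hx : g • x = ζ * x) :
    cycNorm g n (a - x) = a ^ n - x ^ n := by
  have ha' : ∀ i : ℕ, g ^ i • a = a := fun i => by
    simpa using pow_smul_of_smul_eq (g := g) (smul_one g) (by rw [ha, one_mul]) i (x := a)
  rw [← prod_sub_pow_mul hζ, cycNorm]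
  exact Finset.prod_congr rfl fun i _ => by
    rw [smul_sub, ha', pow_smul_of_smul_eq hg hx]

end FixF

/-- `g` generates the group of a Kummer extension of prime degree `n` of the fixed field of `D`,
obtained by adjoining an `n`-th root `γ`. -/
structure KummerStep {G C : Type*} [Group G] [Field C] [MulSemiringAction G C] (D : Subgroup G)
    (n : ℕ) (ζ γ : C) (g : G) : Prop where
  prime : n.Prime
  prim : IsPrimitiveRoot ζ n
  zeta_mem : ζ ∈ FixF D C
  mem : g ∈ D
  smul : g • γ = ζ * γ
  ne_zero : γ ≠ 0
  pow_mem : γ ^ n ∈ FixF D C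

namespace KummerStep

open MulAction

variable {G C : Type*} [Group G] [Field C] [MulSemiringAction G C] {D : Subgroup G}
  {n : ℕ} {ζ γ : C} {g : G}

lemma exists_smul_eq (hn : n.Prime) (hζ : IsPrimitiveRoot ζ n) (hp : γ ^ n ∈ FixF D C)
    (h0 : γ ≠ 0) {h : G} (hh : h ∈ D) : ∃ j < n, h • γ = ζ ^ j * γ := by
  have : NeZero n := ⟨hn.ne_zero⟩
  have h1 : (h • γ / γ) ^ n = 1 := by
    rw [div_pow, ← smul_pow', smul_of_mem_FixF hp hh, div_self (pow_ne_zero _ h0)]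
  obtain ⟨j, hj, e⟩ := hζ.eq_pow_of_pow_eq_one h1
  exact ⟨j, hj, by rw [e, div_mul_cancel₀ _ h0]⟩

lemma exists_step (hn : n.Prime) (hζ : IsPrimitiveRoot ζ n) (hζD : ζ ∈ FixF D C)
    (hp : γ ^ n ∈ FixF D C) (hγ : γ ∉ FixF D C) : ∃ g, KummerStep D n ζ γ g := by
  have h0 : γ ≠ 0 := by rintro rfl; exact hγ (zero_mem _)
  rw [mem_FixF] at hγ
  push Not at hγ
  obtain ⟨h, hh, hne⟩ := hγ
  obtain ⟨j, hj, e⟩ := exists_smul_eq hn hζ hp h0 hh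
  have hj0 : j ≠ 0 := by rintro rfl; simp [e] at hne
  have hc : Nat.Coprime j n := (Nat.coprime_of_lt_prime hj0 hj hn).symm
  obtain ⟨m, hm⟩ := Nat.exists_mul_mod_eq_one_of_coprime hc hn.one_lt
  refine ⟨h ^ m, hn, hζ, hζD, _root_.pow_mem hh m, ?_, h0, hp⟩
  rw [pow_smul_of_smul_eq (by rw [smul_pow', smul_of_mem_FixF hζD hh]) e, ← pow_mul,
    ← Nat.div_add_mod (j * m) n, hm.2, pow_succ, pow_mul, hζ.pow_eq_one, one_pow, one_mul]

variable {A : Type*} [Field A] [MulSemiringAction G A]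

/-- The stabilizer of `γ` in `D`. -/
abbrev sub (D : Subgroup G) (γ : C) : Subgroup G := D ⊓ stabilizer G γ

lemma pow_smul (S : KummerStep D n ζ γ g) (i : ℕ) : g ^ i • γ = ζ ^ i * γ :=
  pow_smul_of_smul_eq (smul_of_mem_FixF S.zeta_mem S.mem) S.smul i

lemma smul_mem (S : KummerStep D n ζ γ g) {x : A} (hx : x ∈ FixF (sub D γ) A) {h : G}
    (hh : h ∈ D) : h • x ∈ FixF (sub D γ) A := by
  rw [mem_FixF] at hx ⊢
  intro d hd
  obtain ⟨hd1, hd2⟩ := Subgroup.mem_inf.1 hd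
  have e : d * h = h * (h⁻¹ * d * h) := by group
  rw [← mul_smul, e, mul_smul, hx]
  refine Subgroup.mem_inf.2 ⟨mul_mem (mul_mem (inv_mem hh) hd1) hh, ?_⟩
  obtain ⟨j, -, hj⟩ := exists_smul_eq S.prime S.prim S.pow_mem S.ne_zero hh
  rw [mem_stabilizer_iff] at hd2 ⊢
  rw [mul_smul, mul_smul, hj, smul_mul', smul_pow', smul_of_mem_FixF S.zeta_mem hd1, hd2, ← hj,
    inv_smul_smul]

lemma pow_smul_mem (S : KummerStep D n ζ γ g) {x : A} (hx : x ∈ FixF (sub D γ) A) (i : ℕ) :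
    g ^ i • x ∈ FixF (sub D γ) A := S.smul_mem hx (_root_.pow_mem S.mem i)

lemma period (S : KummerStep D n ζ γ g) {x : A} (hx : x ∈ FixF (sub D γ) A) : g ^ n • x = x := by
  refine smul_of_mem_FixF hx (Subgroup.mem_inf.2 ⟨_root_.pow_mem S.mem n, ?_⟩)
  rw [mem_stabilizer_iff, S.pow_smul, S.prim.pow_eq_one, one_mul]

lemma mem_of_smul (S : KummerStep D n ζ γ g) {x : A} (hx : x ∈ FixF (sub D γ) A)
    (hg : g • x = x) : x ∈ FixF D A := by
  refine mem_FixF.2 fun h hh => ?_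
  obtain ⟨j, -, hj⟩ := exists_smul_eq S.prime S.prim S.pow_mem S.ne_zero hh
  have hgj : g ^ j • x = x := by
    simpa using pow_smul_of_smul_eq (g := g) (smul_one g) (by rw [hg, one_mul]) j (x := x)
  have h1 : (g ^ j)⁻¹ * h ∈ sub D γ := by
    refine Subgroup.mem_inf.2 ⟨mul_mem (inv_mem (_root_.pow_mem S.mem j)) hh, ?_⟩
    rw [mem_stabilizer_iff, mul_smul, hj, ← S.pow_smul, inv_smul_smul]
  have h2 := smul_of_mem_FixF hx h1
  rw [mul_smul, inv_smul_eq_iff, hgj] at h2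
  exact h2

lemma cycNorm_mem (S : KummerStep D n ζ γ g) {x : A} (hx : x ∈ FixF (sub D γ) A) :
    cycNorm g n x ∈ FixF D A := by
  refine S.mem_of_smul (prod_mem fun i _ => S.pow_smul_mem hx i) ?_
  rw [cycNorm, Finset.smul_prod']
  have e : ∀ i, g • g ^ i • x = g ^ (i + 1) • x := fun i => by rw [pow_succ', mul_smul]
  simp only [e]
  obtain ⟨m, rfl⟩ := Nat.exists_eq_succ_of_ne_zero S.prime.ne_zero
  rw [Finset.prod_range_succ, Finset.prod_range_succ']
  congr 1
  simpa using S.period hx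

lemma le_sub (S : KummerStep D n ζ γ g) : FixF D A ≤ FixF (sub D γ) A := by
  have := S.prime
  exact FixF_anti inf_le_left

lemma gamma_mem (D : Subgroup G) (γ : C) : γ ∈ FixF (sub D γ) C :=
  mem_FixF.2 fun _ h => (Subgroup.mem_inf.1 h).2

/-- The `ζ ^ i`-eigencomponent of `e` under `g`. -/
def comp (g : G) (n : ℕ) (ζ : C) (e : C) (i : ℕ) : C :=
  (n : C)⁻¹ * ∑ j ∈ Finset.range n, (ζ ^ (i * j))⁻¹ * g ^ j • e

lemma sum_comp [CharZero C] (S : KummerStep D n ζ γ g) (e : C) :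
    ∑ i ∈ Finset.range n, comp g n ζ e i = e := by
  have hn : (n : C) ≠ 0 := Nat.cast_ne_zero.2 S.prime.ne_zero
  simp only [comp, ← Finset.mul_sum]
  rw [Finset.sum_comm, inv_mul_eq_iff_eq_mul₀ hn]
  obtain ⟨m, hm⟩ := Nat.exists_eq_succ_of_ne_zero S.prime.ne_zero
  have key : ∀ j ∈ Finset.range n, j ≠ 0 → ∑ i ∈ Finset.range n, (ζ ^ (i * j))⁻¹ * g ^ j • e = 0 := by
    intro j hj hj0
    rw [← Finset.sum_mul]
    have h1 : IsPrimitiveRoot (ζ ^ j)⁻¹ n :=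
      (S.prim.pow_of_coprime j
        (Nat.coprime_of_lt_prime hj0 (Finset.mem_range.1 hj) S.prime).symm).inv
    have h2 := h1.geom_sum_eq_zero S.prime.one_lt
    simp only [inv_pow, ← pow_mul, mul_comm j] at h2
    rw [h2, zero_mul]
  rw [hm] at key ⊢
  rw [Finset.sum_eq_single 0 key (fun h => absurd (Finset.mem_range.2 (Nat.succ_pos _)) h)]
  simp

lemma comp_mem (S : KummerStep D n ζ γ g) {e : C} (he : e ∈ FixF (sub D γ) C) (i : ℕ) :
    comp g n ζ e i ∈ FixF (sub D γ) C :=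
  mul_mem (inv_mem (natCast_mem _ _)) (sum_mem fun j _ =>
    mul_mem (inv_mem (_root_.pow_mem (S.le_sub S.zeta_mem) _)) (S.pow_smul_mem he j))

lemma smul_comp (S : KummerStep D n ζ γ g) {e : C} (he : e ∈ FixF (sub D γ) C) (i : ℕ) :
    g • comp g n ζ e i = ζ ^ i * comp g n ζ e i := by
  have hζ : ζ ≠ 0 := S.prim.ne_zero S.prime.ne_zero
  have hg : ∀ m : ℕ, g • ζ ^ m = ζ ^ m := fun m =>
    smul_of_mem_FixF (_root_.pow_mem S.zeta_mem m) S.mem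
  have hgn : g • (n : C) = n := smul_of_mem_FixF (natCast_mem (FixF D C) n) S.mem
  rw [comp, smul_mul', smul_inv'', hgn, mul_left_comm]
  congr 1
  rw [Finset.smul_sum, Finset.mul_sum]
  have e1 : ∀ j, g • ((ζ ^ (i * j))⁻¹ * g ^ j • e) =
      ζ ^ i * ((ζ ^ (i * (j + 1)))⁻¹ * g ^ (j + 1) • e) := fun j => by
    rw [smul_mul', smul_inv'', hg, ← mul_smul, ← pow_succ', Nat.mul_succ, pow_add ζ, mul_inv,
      ← mul_assoc, mul_comm (ζ ^ i), inv_mul_cancel_right₀ (pow_ne_zero _ hζ)]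
  simp only [e1]
  obtain ⟨m, rfl⟩ := Nat.exists_eq_succ_of_ne_zero S.prime.ne_zero
  rw [Finset.sum_range_succ, Finset.sum_range_succ' (fun j => ζ ^ i * _)]
  congr 2
  rw [S.period he, mul_comm i, pow_mul, S.prim.pow_eq_one]
  simp

lemma comp_div_mem (S : KummerStep D n ζ γ g) {e : C} (he : e ∈ FixF (sub D γ) C) (i : ℕ) :
    comp g n ζ e i / γ ^ i ∈ FixF D C := by
  refine S.mem_of_smul (div_mem (S.comp_mem he i) (_root_.pow_mem (gamma_mem D γ) i)) ?_
  have hζ : ζ ≠ 0 := S.prim.ne_zero S.prime.ne_zero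
  rw [smul_div₀', S.smul_comp he, smul_pow', S.smul, mul_pow, mul_div_mul_left _ _
    (pow_ne_zero _ hζ)]

end KummerStep

/-- A group `G` acting compatibly on an algebraically closed valued field `C`, algebraic over a
local field, and on an extension `Ω` of `C`, such that Kummer theory for `Ω` descends to `C`. -/
structure GaloisSetup (G C Ω : Type*) [Group G] [TopologicalSpace G] [Field C] [Field Ω]
    [MulSemiringAction G C] [MulSemiringAction G Ω] [Algebra C Ω] (w : AbsoluteValue C ℝ)
    (p : ℕ) : Prop where
  add_le : ∀ x y, w (x + y) ≤ max (w x) (w y)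
  w_smul : ∀ (g : G) x, w (g • x) = w x
  w_p : w p < 1
  w_coprime : ∀ n : ℕ, n.Coprime p → w n = 1
  isOpen_stabilizer : ∀ c : C, IsOpen (MulAction.stabilizer G c : Set G)
  kummer : ∀ (D : Subgroup G) (n : ℕ), 0 < n → ∀ x ∈ FixF D Ω, x ≠ 0 →
    ∃ c ∈ FixF D C, ∃ z ∈ FixF D Ω, x = algebraMap C Ω c * z ^ n
  unif : ∀ D : Subgroup G, IsOpen (D : Set G) → ∃ π ∈ FixF D C, 0 < w π ∧ w π < 1 ∧
    ∀ x ∈ FixF D C, w x < 1 → w x ≤ w π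
  finite : ∀ D : Subgroup G, IsOpen (D : Set G) → ∃ T : Set C, T.Finite ∧
    ∀ x ∈ FixF D C, w x ≤ 1 → ∃ t ∈ T, t ∈ FixF D C ∧ w t ≤ 1 ∧ w (x - t) < 1
  complete : ∀ D : Subgroup G, IsOpen (D : Set G) → ∀ π ∈ FixF D C, 0 < w π → w π < 1 →
    ∀ u : ℕ → C, (∀ n, u n ∈ FixF D C) → (∀ n, w (u (n + 1) - u n) ≤ w π ^ n) →
    ∃ a ∈ FixF D C, ∀ n, w (a - u n) ≤ w π ^ n

/-- The restriction of an absolute value to a fixed field. -/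
noncomputable def fixAbs {G C : Type*} [Group G] [Field C] [MulSemiringAction G C]
    (w : AbsoluteValue C ℝ) (D : Subgroup G) : AbsoluteValue (FixF D C) ℝ :=
  w.comp (f := (FixF D C).subtype) Subtype.val_injective

lemma fixAbs_apply {G C : Type*} [Group G] [Field C] [MulSemiringAction G C]
    (w : AbsoluteValue C ℝ) (D : Subgroup G) (x : FixF D C) : fixAbs w D x = w x := rfl

lemma pow_of_coprime_pow {A : Type*} [Field A] (F : Subfield A) {m n : ℕ} (h : m.Coprime n)
    {x z : A} (hx : x ∈ F) (hx0 : x ≠ 0) (hz : z ∈ F) (e : x ^ m = z ^ n) :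
    ∃ y ∈ F, x = y ^ n := by
  have hb : (m : ℤ) * m.gcdA n + n * m.gcdB n = 1 := by
    rw [← Nat.gcd_eq_gcd_ab, h]; simp
  refine ⟨z ^ m.gcdA n * x ^ m.gcdB n, mul_mem (zpow_mem hz _) (zpow_mem hx _), ?_⟩
  conv_lhs => rw [← zpow_one x, ← hb, zpow_add₀ hx0, zpow_mul, zpow_natCast, e]
  have hz' : (z ^ n) ^ m.gcdA n = (z ^ m.gcdA n) ^ n := by
    rw [← zpow_natCast, ← zpow_natCast, ← zpow_mul, ← zpow_mul, mul_comm]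
  have hx' : x ^ ((n : ℤ) * m.gcdB n) = (x ^ m.gcdB n) ^ n := by
    rw [← zpow_natCast, ← zpow_mul, mul_comm]
  rw [hz', hx', mul_pow]

lemma abs_eq_one_of_pow_eq_one {C : Type*} [Field C] (w : AbsoluteValue C ℝ) {x : C} {n : ℕ} (hn : n ≠ 0) (h : x ^ n = 1) : w x = 1 := by
  have := congrArg w h
  rw [map_pow, map_one] at this
  exact (pow_eq_one_iff_of_nonneg (w.nonneg _) hn).1 this

lemma exists_lt_one_of_prod_lt_one {C : Type*} [Field C] (w : AbsoluteValue C ℝ) {n : ℕ} {f : ℕ → C} (h : w (∏ i ∈ Finset.range n, f i) < 1) :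
    ∃ i < n, w (f i) < 1 := by
  by_contra! hcon
  rw [map_prod] at h
  refine absurd h (not_lt.2 ?_)
  have := Finset.prod_le_prod (s := Finset.range n) (f := fun _ => (1 : ℝ))
    (g := fun i => w (f i)) (fun _ _ => zero_le_one) fun i hi => hcon i (Finset.mem_range.1 hi)
  simpa using this

namespace GaloisSetup

open MulAction KummerStep

variable {G C Ω : Type*} [Group G] [TopologicalSpace G] [Field C] [Field Ω]
  [MulSemiringAction G C] [MulSemiringAction G Ω] [Algebra C Ω] {w : AbsoluteValue C ℝ} {p : ℕ}
  (S : GaloisSetup G C Ω w p)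

include S

lemma sub_le (x y : C) : w (x - y) ≤ max (w x) (w y) := by
  have := S.add_le x (-y)
  rwa [map_neg_eq_map, ← sub_eq_add_neg] at this

lemma add_eq_left {x y : C} (h : w y < w x) : w (x + y) = w x := by
  refine le_antisymm ((S.add_le x y).trans (max_le le_rfl h.le)) ?_
  by_contra! hlt
  have := S.sub_le (x + y) y
  rw [add_sub_cancel_right] at this
  exact absurd this (not_le.2 (max_lt hlt h))

lemma eq_of_sub_lt {x y : C} (h : w (y - x) < w x) : w y = w x := by
  have := S.add_eq_left h
  rwa [add_sub_cancel] at this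

lemma sum_le {α : Type*} (s : Finset α) (f : α → C) {r : ℝ} (hr : 0 ≤ r)
    (h : ∀ i ∈ s, w (f i) ≤ r) : w (∑ i ∈ s, f i) ≤ r := by
  classical
  induction s using Finset.induction_on with
  | empty => simpa
  | insert a s ha ih =>
    rw [Finset.sum_insert ha]
    exact (S.add_le _ _).trans (max_le (h a (Finset.mem_insert_self _ _))
      (ih fun i hi => h i (Finset.mem_insert_of_mem hi)))

lemma sum_lt {α : Type*} (s : Finset α) (f : α → C) {r : ℝ} (hr : 0 < r)
    (h : ∀ i ∈ s, w (f i) < r) : w (∑ i ∈ s, f i) < r := by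
  classical
  induction s using Finset.induction_on with
  | empty => simpa
  | insert a s ha ih =>
    rw [Finset.sum_insert ha]
    exact (S.add_le _ _).trans_lt (max_lt (h a (Finset.mem_insert_self _ _))
      (ih fun i hi => h i (Finset.mem_insert_of_mem hi)))

lemma prod_one_add {α : Type*} (s : Finset α) (f : α → C) (h : ∀ i ∈ s, w (f i) < 1) :
    w (∏ i ∈ s, (1 + f i) - 1) < 1 := by
  classical
  induction s using Finset.induction_on with
  | empty => simp
  | insert a s ha ih =>
    rw [Finset.prod_insert ha]
    have e : (1 + f a) * ∏ i ∈ s, (1 + f i) - 1 =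
      f a * (∏ i ∈ s, (1 + f i) - 1) + (f a + (∏ i ∈ s, (1 + f i) - 1)) := by ring
    have h1 := h a (Finset.mem_insert_self _ _)
    have h2 := ih fun i hi => h i (Finset.mem_insert_of_mem hi)
    rw [e]
    refine (S.add_le _ _).trans_lt (max_lt ?_ ((S.add_le _ _).trans_lt (max_lt h1 h2)))
    rw [map_mul]
    exact mul_lt_one_of_nonneg_of_lt_one_left (w.nonneg _) h1 h2.le

lemma sub_one_eq_one {x : C} {n : ℕ} (hn0 : n ≠ 0) (hn : n.Coprime p) (h : x ^ n = 1)
    (h1 : x ≠ 1) : w (x - 1) = 1 := by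
  have hx := abs_eq_one_of_pow_eq_one w hn0 h
  refine le_antisymm ((S.sub_le x 1).trans (by simp [hx])) ?_
  by_contra! hlt
  have h2 : ∑ i ∈ Finset.range n, x ^ i = 0 := by
    have := geom_sum_mul x n
    rw [h, sub_self, mul_eq_zero, sub_eq_zero] at this
    exact this.resolve_right h1
  have h3 : ∀ i, w (x ^ i - 1) < 1 := by
    intro i
    rw [← mul_geom_sum, map_mul]
    refine mul_lt_one_of_nonneg_of_lt_one_left (w.nonneg _) hlt
      (S.sum_le _ _ zero_le_one fun i _ => ?_)
    rw [map_pow, hx, one_pow]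
  have h4 := S.sum_lt (Finset.range n) (fun i => x ^ i - 1) one_pos fun i _ => h3 i
  rw [Finset.sum_sub_distrib, h2, Finset.sum_const, Finset.card_range, nsmul_one, zero_sub,
    map_neg_eq_map, S.w_coprime n hn] at h4
  exact lt_irrefl _ h4

lemma eq_of_pow_eq {x y : C} {n : ℕ} (hn0 : n ≠ 0) (hn : n.Coprime p) (h : x ^ n = y ^ n)
    (hy : w y = 1) (hxy : w (x - y) < 1) : x = y := by
  have hy0 : y ≠ 0 := by rintro rfl; simp at hy
  by_contra hne
  have := S.sub_one_eq_one (x := x / y) hn0 hn (by rw [div_pow, h, div_self (pow_ne_zero _ hy0)])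
    (by rwa [ne_eq, div_eq_one_iff_eq hy0])
  rw [div_sub_one hy0, map_div₀, hy, div_one] at this
  exact hxy.ne this

lemma hensel [IsAlgClosed C] {D : Subgroup G} {n : ℕ} {ζ : C} (hn : n.Coprime p) [NeZero n]
    (hζ : IsPrimitiveRoot ζ n) {s : C} (hs : s ∈ FixF D C) (hs1 : w s < 1) :
    ∃ t ∈ FixF D C, 1 + s = t ^ n := by
  obtain ⟨z, hz⟩ := IsAlgClosed.exists_pow_nat_eq (1 + s) (NeZero.pos n)
  have h1 := prod_sub_pow_mul hζ 1 z
  rw [hz, one_pow, sub_add_cancel_left] at h1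
  obtain ⟨i, -, hi⟩ := exists_lt_one_of_prod_lt_one w (f := fun i => 1 - ζ ^ i * z) (n := n)
    (by rwa [h1, map_neg_eq_map])
  set t := ζ ^ i * z with ht
  have htn : t ^ n = 1 + s := by
    rw [ht, mul_pow, ← pow_mul, mul_comm i, pow_mul, hζ.pow_eq_one, one_pow, one_mul, hz]
  have hwt : w t = 1 := by
    rw [← map_one w]
    exact S.eq_of_sub_lt (by rwa [map_one, w.map_sub])
  refine ⟨t, mem_FixF.2 fun g hg => ?_, htn.symm⟩
  refine S.eq_of_pow_eq (NeZero.ne n) hn ?_ hwt ?_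
  · rw [← smul_pow', htn, smul_add, smul_one, smul_of_mem_FixF hs hg]
  · have e : g • t - t = (1 - t) - g • (1 - t) := by rw [smul_sub, smul_one]; ring
    rw [e]
    exact (S.sub_le _ _).trans_lt (max_lt hi (by rwa [S.w_smul]))

lemma isLocalAbs {D : Subgroup G} (hD : IsOpen (D : Set G)) : IsLocalAbs (fixAbs w D) where
  add_le x y := S.add_le x y
  exists_unif := by
    obtain ⟨π, hπ, h0, h1, h⟩ := S.unif D hD
    exact ⟨⟨π, hπ⟩, h0, h1, fun x hx => h x x.2 hx⟩

lemma residue_eq_iff {D : Subgroup G} (hD : IsOpen (D : Set G))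
    (x y : (S.isLocalAbs hD).integers) :
    IsLocalRing.residue _ x = IsLocalRing.residue _ y ↔ w ((x : FixF D C) - (y : FixF D C) : C) < 1 := by
  rw [← sub_eq_zero, ← map_sub, IsLocalAbs.residue_eq_zero_iff]
  rfl

lemma finite_residue {D : Subgroup G} (hD : IsOpen (D : Set G)) :
    Finite (IsLocalRing.ResidueField (S.isLocalAbs hD).integers) := by
  obtain ⟨T, hT, h⟩ := S.finite D hD
  have := hT.to_subtype
  have key : ∀ y : IsLocalRing.ResidueField (S.isLocalAbs hD).integers, ∃ t : T,
      ∃ (h1 : (t : C) ∈ FixF D C) (h2 : w (t : C) ≤ 1),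
        IsLocalRing.residue (S.isLocalAbs hD).integers ⟨⟨t, h1⟩, h2⟩ = y := by
    intro y
    obtain ⟨x, rfl⟩ := IsLocalRing.residue_surjective y
    obtain ⟨t, ht, h1, h2, h3⟩ := h x x.1.2 x.2
    exact ⟨⟨t, ht⟩, h1, h2, ((S.residue_eq_iff hD _ _).2 h3).symm⟩
  choose f hf1 hf2 hf using key
  refine Finite.of_injective f fun a b hab => ?_
  rw [← hf a, ← hf b]
  congr 3
  rw [hab]

lemma dvd_card {D : Subgroup G} (hD : IsOpen (D : Set G)) {n : ℕ} (hn0 : n ≠ 0)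
    (hn : n.Coprime p) {ξ : C} (hξ : IsPrimitiveRoot ξ n) (hξD : ξ ∈ FixF D C) :
    n ∣ Nat.card (IsLocalRing.ResidueField (S.isLocalAbs hD).integers) - 1 := by
  set O := (S.isLocalAbs hD).integers with hO
  let x : O := ⟨⟨ξ, hξD⟩, (abs_eq_one_of_pow_eq_one w hn0 hξ.pow_eq_one).le⟩
  have hx : IsPrimitiveRoot (IsLocalRing.residue O x) n := by
    refine ⟨?_, fun l hl => hξ.dvd_of_pow_eq_one l ?_⟩
    · rw [← map_pow, ← map_one (IsLocalRing.residue O), S.residue_eq_iff hD]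
      change w (ξ ^ n - 1) < 1
      simp [hξ.pow_eq_one]
    · rw [← map_pow, ← map_one (IsLocalRing.residue O), S.residue_eq_iff hD] at hl
      replace hl : w (ξ ^ l - 1) < 1 := hl
      by_contra hne
      refine hl.ne (S.sub_one_eq_one hn0 hn ?_ hne)
      rw [← pow_mul, mul_comm, pow_mul, hξ.pow_eq_one, one_pow]
  obtain ⟨u, hu⟩ := hx.isUnit hn0
  have h1 : IsPrimitiveRoot u n := by
    rw [← hu] at hx
    exact IsPrimitiveRoot.coe_units_iff.1 hx
  rw [← Nat.card_units, h1.eq_orderOf]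
  exact orderOf_dvd_natCard u

lemma exists_pow_mul_pow [IsAlgClosed C] {D : Subgroup G} (hD : IsOpen (D : Set G)) {ℓ : ℕ}
    [hℓ : Fact ℓ.Prime] (hℓp : ℓ.Coprime p) {ζ : C} (hζ : IsPrimitiveRoot ζ ℓ)
    (hζD : ζ ∈ FixF D C) {c ν : C} (hc : c ∈ FixF D C) (hwc : w c = 1)
    (hcn : ¬ ∃ d ∈ FixF D C, c = d ^ ℓ) (hν : ν ∈ FixF D C) (hwν : w ν = 1) :
    ∃ i : ℕ, ∃ r ∈ FixF D C, ν = c ^ i * r ^ ℓ := by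
  have : NeZero ℓ := ⟨hℓ.out.ne_zero⟩
  have := S.finite_residue hD
  have hdvd := S.dvd_card hD hℓ.out.ne_zero hℓp hζ hζD
  set O := (S.isLocalAbs hD).integers with hO
  obtain ⟨χ, hχ, hχ0, -⟩ := exists_residue_character _ hdvd
  have key : ∀ x : O, w (x : FixF D C) = 1 → χ (IsLocalRing.residue O x) = 0 →
      ∃ d ∈ FixF D C, ((x : FixF D C) : C) = d ^ ℓ := by
    intro x hx hx0
    have hne : IsLocalRing.residue O x ≠ 0 := by
      rw [ne_eq, IsLocalAbs.residue_eq_zero_iff, fixAbs_apply, hx]; simp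
    obtain ⟨r, hr⟩ := hχ0 _ hne hx0
    obtain ⟨y, rfl⟩ := IsLocalRing.residue_surjective r
    rw [← map_pow, S.residue_eq_iff hD] at hr
    replace hr : w ((x : FixF D C) - ((y : FixF D C) : C) ^ ℓ) < 1 := hr
    set y' : C := ((y : FixF D C) : C) with hy'
    have hy1 : w (y' ^ ℓ) = 1 := by
      rw [← hx]
      exact S.eq_of_sub_lt (by rwa [hx, w.map_sub])
    have hy0 : y' ≠ 0 := by rintro h; simp [h, hℓ.out.ne_zero] at hy1
    obtain ⟨t, ht, e⟩ := S.hensel hℓp hζ (D := D) (s := ((x : FixF D C) - y' ^ ℓ) / y' ^ ℓ)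
      (div_mem (sub_mem x.1.2 (pow_mem y.1.2 _)) (pow_mem y.1.2 _))
      (by rwa [map_div₀, hy1, div_one])
    refine ⟨y' * t, mul_mem y.1.2 ht, ?_⟩
    rw [mul_pow, ← e]
    field_simp
    ring
  let c' : O := ⟨⟨c, hc⟩, hwc.le⟩
  let ν' : O := ⟨⟨ν, hν⟩, hwν.le⟩
  have hc0 : IsLocalRing.residue O c' ≠ 0 := by
    rw [ne_eq, IsLocalAbs.residue_eq_zero_iff, fixAbs_apply, hwc]; simp
  have hν0 : IsLocalRing.residue O ν' ≠ 0 := by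
    rw [ne_eq, IsLocalAbs.residue_eq_zero_iff, fixAbs_apply, hwν]; simp
  have hχc : χ (IsLocalRing.residue O c') ≠ 0 := fun h => hcn (key c' hwc h)
  have hχpow : ∀ i : ℕ, χ (IsLocalRing.residue O c' ^ i) = i * χ (IsLocalRing.residue O c') := by
    intro i
    induction i with
    | zero => simpa using hχ (x := 1) (y := 1) one_ne_zero one_ne_zero
    | succ i ih =>
      rw [pow_succ, hχ (pow_ne_zero _ hc0) hc0, ih]
      push_cast; ring
  -- choose `j` with `ν * c ^ j` an `ℓ`-th power
  set a := -χ (IsLocalRing.residue O ν') / χ (IsLocalRing.residue O c') with ha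
  obtain ⟨d, hd, e⟩ := key (ν' * c' ^ a.val) (by
    change w (ν * c ^ a.val) = 1
    rw [map_mul, map_pow, hwc, hwν]; simp) (by
    rw [map_mul, map_pow, hχ hν0 (pow_ne_zero _ hc0), hχpow, ZMod.natCast_val, ZMod.cast_id, ha,
      div_mul_cancel₀ _ hχc, add_neg_cancel])
  replace e : ν * c ^ a.val = d ^ ℓ := e
  have hcne : c ≠ 0 := by rintro rfl; simp at hwc
  have hle := a.val_lt.le
  refine ⟨ℓ - a.val, d / c, div_mem hd hc, ?_⟩
  rw [div_pow, ← e, eq_comm, mul_div_assoc', div_eq_iff (pow_ne_zero _ hcne)]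
  rw [mul_left_comm, ← pow_add, Nat.sub_add_cancel hle]

end GaloisSetup

namespace KummerStep

variable {G C : Type*} [Group G] [Field C] [MulSemiringAction G C] {D : Subgroup G}
  {n : ℕ} {ζ γ : C} {g : G}

lemma not_exists_pow (K : KummerStep D n ζ γ g) : ¬ ∃ d ∈ FixF D C, γ ^ n = d ^ n := by
  rintro ⟨d, hd, e⟩
  have : NeZero n := ⟨K.prime.ne_zero⟩
  have hd0 : d ≠ 0 := by
    rintro rfl
    rw [zero_pow K.prime.ne_zero] at e
    exact K.ne_zero (pow_eq_zero_iff K.prime.ne_zero |>.1 e)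
  obtain ⟨i, -, hi⟩ := K.prim.eq_pow_of_pow_eq_one (ξ := γ / d)
    (by rw [div_pow, e, div_self (pow_ne_zero _ hd0)])
  have hmem : γ ∈ FixF D C := by
    rw [eq_div_iff hd0] at hi
    rw [← hi]
    exact mul_mem (_root_.pow_mem K.zeta_mem i) hd
  have h1 := K.smul
  rw [smul_of_mem_FixF hmem K.mem] at h1
  exact K.prim.ne_one K.prime.one_lt (mul_right_cancel₀ K.ne_zero (by rw [← h1, one_mul]))

lemma cycNorm_gamma (K : KummerStep D n ζ γ g) (hn : Odd n) : cycNorm g n γ = γ ^ n := by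
  have : NeZero n := ⟨K.prime.ne_zero⟩
  have h1 := cycNorm_sub (a := 0) K.prim (smul_of_mem_FixF K.zeta_mem K.mem) (smul_zero g) K.smul
  rw [zero_sub, neg_eq_neg_one_mul, cycNorm_mul,
    cycNorm_of_mem K.mem n (neg_mem (one_mem (FixF D C))), hn.neg_one_pow,
    zero_pow K.prime.ne_zero, zero_sub, neg_one_mul] at h1
  exact neg_injective h1

end KummerStep

namespace GaloisSetup

open MulAction KummerStep

variable {G C Ω : Type*} [Group G] [TopologicalSpace G] [Field C] [Field Ω]
  [MulSemiringAction G C] [MulSemiringAction G Ω] [Algebra C Ω] {w : AbsoluteValue C ℝ} {p : ℕ}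
  (S : GaloisSetup G C Ω w p)

include S

lemma abs_cycNorm (g : G) (n : ℕ) (x : C) : w (cycNorm g n x) = w x ^ n := by
  rw [cycNorm, map_prod, Finset.prod_congr rfl fun i _ => S.w_smul (g ^ i) x]
  simp

lemma cycNorm_one_add_sub (g : G) (n : ℕ) {s : C} (h : w s < 1) :
    w (cycNorm g n (1 + s) - 1) < 1 := by
  rw [cycNorm, Finset.prod_congr rfl fun i _ => show g ^ i • (1 + s) = 1 + g ^ i • s by
    rw [smul_add, smul_one]]
  exact S.prod_one_add _ _ fun i _ => by rwa [S.w_smul]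

lemma cycNorm_class [IsAlgClosed C] [CharZero C] {D : Subgroup G} (hD : IsOpen (D : Set G)) {ℓ : ℕ}
    [hℓ : Fact ℓ.Prime] (hℓ2 : Odd ℓ) (hℓp : ℓ.Coprime p) {ζ γ : C} {g : G}
    (K : KummerStep D ℓ ζ γ g) {e : C} (he : e ∈ FixF (sub D γ) C) (he0 : e ≠ 0) :
    ∃ m : ℕ, ∃ d ∈ FixF D C, cycNorm g ℓ e = (γ ^ ℓ) ^ m * d ^ ℓ := by
  have : NeZero ℓ := ⟨hℓ.out.ne_zero⟩
  have hζ1 : w ζ = 1 := abs_eq_one_of_pow_eq_one w hℓ.out.ne_zero K.prim.pow_eq_one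
  have hle : ∀ i, w (comp g ℓ ζ e i) ≤ w e := by
    intro i
    rw [comp, map_mul, map_inv₀, S.w_coprime ℓ hℓp, inv_one, one_mul]
    refine S.sum_le _ _ (w.nonneg _) fun j _ => ?_
    rw [map_mul, map_inv₀, map_pow, hζ1, one_pow, inv_one, one_mul, S.w_smul]
  have hwe : 0 < w e := w.pos he0
  obtain ⟨i, hi, hwi⟩ : ∃ i < ℓ, w (comp g ℓ ζ e i) = w e := by
    by_contra! hcon
    have := S.sum_lt (Finset.range ℓ) (comp g ℓ ζ e) hwe
      fun i hi => lt_of_le_of_ne (hle i) (hcon i (Finset.mem_range.1 hi))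
    rw [K.sum_comp] at this
    exact lt_irrefl _ this
  have hγ0 := K.ne_zero
  set a : ℕ → C := fun i => comp g ℓ ζ e i / γ ^ i with ha
  have haD : ∀ i, a i ∈ FixF D C := K.comp_div_mem he
  have hcomp : ∀ i, comp g ℓ ζ e i = a i * γ ^ i := fun i => by
    rw [ha]; simp only; rw [div_mul_cancel₀ _ (pow_ne_zero _ hγ0)]
  have hai : a i ≠ 0 := fun h => by
    rw [hcomp, h, zero_mul, map_zero] at hwi
    exact hwe.ne hwi
  by_cases hram : ∃ b ∈ FixF D C, w b = w γ
  · obtain ⟨b, hb, hwb⟩ := hram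
    have hb0 : b ≠ 0 := w.pos_iff.1 (by rw [hwb]; exact w.pos hγ0)
    set b' := a i * b ^ i with hb'
    have hb'D : b' ∈ FixF D C := mul_mem (haD i) (_root_.pow_mem hb i)
    have hb'0 : b' ≠ 0 := mul_ne_zero hai (pow_ne_zero _ hb0)
    have hwb' : w b' = w e := by
      rw [hb', map_mul, map_pow, hwb, ← map_pow, ← map_mul, ← hcomp, hwi]
    have hu : e / b' ∈ FixF (sub D γ) C := div_mem he (K.le_sub hb'D)
    have hwu : w (e / b') = 1 := by rw [map_div₀, hwb', div_self hwe.ne']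
    obtain ⟨m, r, hr, h⟩ := S.exists_pow_mul_pow hD hℓp K.prim K.zeta_mem
      (c := γ ^ ℓ / b ^ ℓ) (ν := cycNorm g ℓ (e / b'))
      (div_mem K.pow_mem (_root_.pow_mem hb ℓ))
      (by rw [map_div₀, map_pow, map_pow, hwb, div_self (pow_ne_zero _ (w.pos hγ0).ne')])
      (by
        rintro ⟨d, hd, h⟩
        refine K.not_exists_pow ⟨d * b, mul_mem hd hb, ?_⟩
        rw [mul_pow, ← h, div_mul_cancel₀ _ (pow_ne_zero _ hb0)])
      (K.cycNorm_mem hu) (by rw [S.abs_cycNorm, hwu, one_pow])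
    refine ⟨m, r * b' / b ^ m, div_mem (mul_mem hr hb'D) (_root_.pow_mem hb m), ?_⟩
    have h1 : e = b' * (e / b') := by field_simp
    rw [h1, cycNorm_mul, h, cycNorm_of_mem K.mem ℓ hb'D, div_pow, div_pow, mul_pow, ← pow_mul,
      ← pow_mul, ← pow_mul, ← pow_mul, mul_comm ℓ m]
    field_simp
    rw [hb']
    ring
  · have hlt : ∀ j ∈ (Finset.range ℓ).erase i, w (comp g ℓ ζ e j) < w e := by
      intro j hj
      obtain ⟨hji, hjℓ⟩ := Finset.mem_erase.1 hj
      refine lt_of_le_of_ne (hle j) fun h => hram ?_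
      have haj : a j ≠ 0 := fun h0 => by
        rw [hcomp, h0, zero_mul, map_zero] at h
        exact hwe.ne h
      have hcop : IsCoprime ((i : ℤ) - j) ℓ := by
        rw [isCoprime_comm, Prime.coprime_iff_not_dvd (Nat.prime_iff_prime_int.1 hℓ.out)]
        intro hd
        have h2 := Int.eq_zero_of_abs_lt_dvd hd (by
          have := Finset.mem_range.1 hjℓ
          rw [abs_lt]; omega)
        omega
      obtain ⟨u, v, huv⟩ := hcop
      have hg := (w.pos hγ0).ne'
      have h3 : w γ ^ ((i : ℤ) - j) = w (a j / a i) := by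
        rw [zpow_sub₀ hg, zpow_natCast, zpow_natCast, map_div₀,
          div_eq_div_iff (pow_ne_zero _ hg) (w.pos hai).ne', ← map_pow, ← map_pow, ← map_mul,
          ← map_mul, mul_comm, ← hcomp, ← hcomp, hwi, h]
      refine ⟨(a j / a i) ^ u * (γ ^ ℓ) ^ v, mul_mem (zpow_mem (div_mem (haD j) (haD i)) u)
        (zpow_mem K.pow_mem v), ?_⟩
      rw [map_mul, map_zpow₀, ← h3, map_zpow₀, map_pow, ← zpow_natCast, ← zpow_mul, ← zpow_mul,
        ← zpow_add₀ hg, mul_comm _ u, mul_comm _ v, huv, zpow_one]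
    have hc0 : comp g ℓ ζ e i ≠ 0 := w.pos_iff.1 (by rw [hwi]; exact hwe)
    set s := (e - comp g ℓ ζ e i) / comp g ℓ ζ e i with hs
    have hws : w s < 1 := by
      have h1 := K.sum_comp e
      rw [← Finset.add_sum_erase _ _ (Finset.mem_range.2 hi), add_comm, ← eq_sub_iff_add_eq] at h1
      rw [hs, map_div₀, hwi, div_lt_one hwe, ← h1]
      exact S.sum_lt _ _ hwe hlt
    have hsD : s ∈ FixF (sub D γ) C := div_mem (sub_mem he (K.comp_mem he i)) (K.comp_mem he i)
    obtain ⟨t, ht, h⟩ := S.hensel hℓp K.prim (D := D) (s := cycNorm g ℓ (1 + s) - 1)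
      (sub_mem (K.cycNorm_mem (add_mem (one_mem _) hsD)) (one_mem _))
      (S.cycNorm_one_add_sub g ℓ hws)
    have h1 : e = comp g ℓ ζ e i * (1 + s) := by rw [hs]; field_simp; ring
    refine ⟨i, a i * t, mul_mem (haD i) ht, ?_⟩
    rw [add_sub_cancel] at h
    conv_lhs => rw [h1, cycNorm_mul, hcomp, cycNorm_mul, cycNorm_pow, K.cycNorm_gamma hℓ2, h,
      cycNorm_of_mem K.mem ℓ (haD i)]
    rw [mul_pow]; ring

end GaloisSetup

section FixAlgebra

variable {G C Ω : Type*} [Group G] [Field C] [Field Ω] [MulSemiringAction G C]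
  [MulSemiringAction G Ω] [Algebra C Ω]

lemma smul_algebraMap_eq [SMulDistribClass G C Ω] (g : G) (c : C) :
    g • algebraMap C Ω c = algebraMap C Ω (g • c) := by
  rw [Algebra.algebraMap_eq_smul_one, Algebra.algebraMap_eq_smul_one, smul_distrib_smul, smul_one]

lemma algebraMap_mem_FixF_iff [SMulDistribClass G C Ω] {D : Subgroup G} {c : C} :
    algebraMap C Ω c ∈ FixF D Ω ↔ c ∈ FixF D C := by
  simp only [mem_FixF, smul_algebraMap_eq, (algebraMap C Ω).injective.eq_iff]

/-- The fixed field of `D` on `Ω` as an algebra over the fixed field of `D` on `C`. -/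
noncomputable instance fixAlgebra [SMulDistribClass G C Ω] (D : Subgroup G) :
    Algebra (FixF D C) (FixF D Ω) :=
  (((algebraMap C Ω).comp (FixF D C).subtype).codRestrict (FixF D Ω) fun c =>
    (algebraMap_mem_FixF_iff (c := (c : C))).2 c.2).toAlgebra

lemma coe_algebraMap_FixF [SMulDistribClass G C Ω] (D : Subgroup G) (c : FixF D C) :
    ((algebraMap (FixF D C) (FixF D Ω) c : FixF D Ω) : Ω) = algebraMap C Ω c := rfl

lemma cycNorm_map [SMulDistribClass G C Ω] (g : G) (n : ℕ) (c : C) :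
    cycNorm g n (algebraMap C Ω c) = algebraMap C Ω (cycNorm g n c) := by
  simp only [cycNorm, map_prod, smul_algebraMap_eq]

/-- If a fixed element of `C` is an `n`-th power in the fixed field of `Ω`, then it is one in the
fixed field of `C`. -/
lemma exists_pow_of_map_eq_pow [IsAlgClosed C] [SMulDistribClass G C Ω] {D : Subgroup G} {n : ℕ}
    [NeZero n] {ζ : C} (hζ : IsPrimitiveRoot ζ n) (hζD : ζ ∈ FixF D C) {c : C} {z : Ω}
    (hz : z ∈ FixF D Ω) (e : algebraMap C Ω c = z ^ n) : ∃ d ∈ FixF D C, c = d ^ n := by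
  obtain ⟨d, hd⟩ := IsAlgClosed.exists_pow_nat_eq c (NeZero.pos n)
  refine ⟨d, ?_, hd.symm⟩
  by_cases hz0 : z = 0
  · rw [hz0, zero_pow (NeZero.ne n), map_eq_zero] at e
    rw [e, pow_eq_zero_iff (NeZero.ne n)] at hd
    rw [hd]
    exact zero_mem _
  obtain ⟨i, -, hi⟩ := (hζ.map_of_injective (algebraMap C Ω).injective).eq_pow_of_pow_eq_one
    (ξ := algebraMap C Ω d / z)
    (by rw [div_pow, ← map_pow, hd, e, div_self (pow_ne_zero _ hz0)])
  rw [eq_div_iff hz0] at hi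
  rw [← algebraMap_mem_FixF_iff (Ω := Ω), ← hi]
  exact mul_mem (pow_mem (algebraMap_mem_FixF_iff.2 hζD) i) hz

end FixAlgebra

/-- An open subgroup fixing the roots of unity needed for the construction of valuations. -/
structure GoodSubgroup {G C : Type*} [Group G] [TopologicalSpace G] [Field C]
    [MulSemiringAction G C] (p ℓ : ℕ) (ξ ζ : C) (D : Subgroup G) : Prop where
  isOpen : IsOpen (D : Set G)
  three_le : 3 ≤ ℓ
  coprime : ℓ.Coprime p
  prim_xi : IsPrimitiveRoot ξ (ℓ ^ 4)
  prim_zeta : IsPrimitiveRoot ζ p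
  xi_mem : ξ ∈ FixF D C
  zeta_mem : ζ ∈ FixF D C

namespace GaloisSetup

open MulAction KummerStep

variable {G C Ω : Type*} [Group G] [TopologicalSpace G] [Field C] [Field Ω]
  [MulSemiringAction G C] [MulSemiringAction G Ω] [Algebra C Ω] {w : AbsoluteValue C ℝ} {p : ℕ}
  (S : GaloisSetup G C Ω w p)

include S

lemma goodSubgroup_sub {ℓ : ℕ} {ξ ζ : C} {D : Subgroup G} (hD : GoodSubgroup p ℓ ξ ζ D) (γ : C) :
    GoodSubgroup p ℓ ξ ζ (sub D γ) :=
  { hD with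
    isOpen := hD.isOpen.inter (S.isOpen_stabilizer γ)
    xi_mem := FixF_anti inf_le_left hD.xi_mem
    zeta_mem := FixF_anti inf_le_left hD.zeta_mem }

lemma exists_one_add_eq [IsAlgClosed C] [CharZero C] [SMulDistribClass G C Ω] {D : Subgroup G}
    (hD : IsOpen (D : Set G)) {ℓ : ℕ} [hℓ : Fact ℓ.Prime] (hℓ2 : Odd ℓ) (hℓp : ℓ.Coprime p) {ζ : C}
    (hζ : IsPrimitiveRoot ζ ℓ) (hζD : ζ ∈ FixF D C) {x : Ω} (hx : x ∈ FixF D Ω) (hx0 : x ≠ 0)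
    (hx1 : 1 + x ≠ 0) (hxn : ¬ ∃ z ∈ FixF D Ω, x = z ^ ℓ) :
    ∃ i : ℕ, ∃ z ∈ FixF D Ω, 1 + x = x ^ i * z ^ ℓ := by
  have : NeZero ℓ := ⟨hℓ.out.ne_zero⟩
  obtain ⟨c, hc, z, hz, e⟩ := S.kummer D ℓ hℓ.out.pos x hx hx0
  have hz0 : z ≠ 0 := by
    rintro rfl
    rw [zero_pow hℓ.out.ne_zero, mul_zero] at e
    exact hx0 e
  obtain ⟨γ, hγ⟩ := IsAlgClosed.exists_pow_nat_eq c hℓ.out.pos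
  set τ := algebraMap C Ω γ * z with hτ
  have hτx : τ ^ ℓ = x := by rw [hτ, mul_pow, ← map_pow, hγ, e]
  obtain ⟨g, K⟩ := exists_step (γ := γ) hℓ.out hζ hζD (by rwa [hγ]) fun h => hxn
    ⟨τ, mul_mem (algebraMap_mem_FixF_iff.2 h) hz, hτx.symm⟩
  have hgτ : g • τ = algebraMap C Ω ζ * τ := by
    rw [hτ, smul_mul', smul_algebraMap_eq, K.smul, map_mul, smul_of_mem_FixF hz K.mem, mul_assoc]
  have hτD : τ ∈ FixF (sub D γ) Ω :=
    mul_mem (algebraMap_mem_FixF_iff.2 (gamma_mem D γ)) (K.le_sub hz)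
  have hN : cycNorm g ℓ (1 + τ) = 1 + x := by
    have := cycNorm_sub (a := 1) (x := -τ) (hζ.map_of_injective (algebraMap C Ω).injective)
      (by rw [smul_algebraMap_eq, smul_of_mem_FixF hζD K.mem]) (smul_one g)
      (by rw [smul_neg, hgτ, mul_neg])
    rwa [hℓ2.neg_pow, hτx, sub_neg_eq_add, sub_neg_eq_add, one_pow] at this
  have hτ1 : 1 + τ ≠ 0 := by
    intro h
    rw [h, cycNorm, Finset.prod_congr rfl fun i _ => smul_zero _] at hN
    rw [← hN] at hx1
    simp [hℓ.out.ne_zero] at hx1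
  obtain ⟨a, ha, v, hv, hav⟩ := S.kummer _ ℓ hℓ.out.pos _ (add_mem (one_mem _) hτD) hτ1
  have ha0 : a ≠ 0 := by
    rintro rfl
    rw [map_zero, zero_mul] at hav
    exact hτ1 hav
  obtain ⟨m, d, hd, hNa⟩ := S.cycNorm_class hD hℓ2 hℓp K ha ha0
  refine ⟨m, algebraMap C Ω d * cycNorm g ℓ v / z ^ m,
    div_mem (mul_mem (algebraMap_mem_FixF_iff.2 hd) (K.cycNorm_mem hv)) (pow_mem hz m), ?_⟩
  rw [← hN, hav, cycNorm_mul, cycNorm_pow, cycNorm_map, hNa, hγ, e, map_mul, map_pow, map_pow,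
    mul_pow, div_pow, mul_pow, ← pow_mul, ← pow_mul, mul_comm m ℓ]
  field_simp

lemma tamePair [IsAlgClosed C] [CharZero C] [SMulDistribClass G C Ω] {ℓ : ℕ} [hℓ : Fact ℓ.Prime]
    {ξ ζ : C} {D : Subgroup G} (hD : GoodSubgroup p ℓ ξ ζ D) :
    TamePair (FixF D C) (FixF D Ω) (fixAbs w D) ℓ := by
  have : NeZero ℓ := ⟨hℓ.out.ne_zero⟩
  have hodd : Odd ℓ := hℓ.out.odd_of_ne_two (by have := hD.three_le; omega)
  have hξ : IsPrimitiveRoot (ξ ^ ℓ ^ 3) ℓ := hD.prim_xi.pow (pow_pos hℓ.out.pos 4) (by ring)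
  have hξD : ξ ^ ℓ ^ 3 ∈ FixF D C := _root_.pow_mem hD.xi_mem _
  have hfin := S.finite_residue hD.isOpen
  exact
  { isLocal := S.isLocalAbs hD.isOpen
    finite := hfin
    three_le := hD.three_le
    card := Nat.le_of_dvd (Nat.sub_pos_of_lt Finite.one_lt_card) <|
      S.dvd_card hD.isOpen (pow_ne_zero 4 hℓ.out.ne_zero) (hD.coprime.pow_left 4) hD.prim_xi
        hD.xi_mem
    dvd_card := S.dvd_card hD.isOpen hℓ.out.ne_zero hD.coprime hξ hξD
    hensel := fun s hs => by
      obtain ⟨t, ht, h⟩ := S.hensel hD.coprime hξ s.2 hs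
      exact ⟨⟨t, ht⟩, Subtype.ext h⟩
    kummer := fun x hx => by
      have hx0 : (x : Ω) ≠ 0 := by simpa using hx
      obtain ⟨c, hc, z, hz, h⟩ := S.kummer D ℓ hℓ.out.pos x x.2 hx0
      refine ⟨⟨c, hc⟩, ⟨z, hz⟩, ?_, ?_, Subtype.ext h⟩
      · rintro h0
        rw [Subtype.ext_iff] at h0
        exact hx0 (by rw [h, show c = 0 from h0, map_zero, zero_mul])
      · rintro h0
        rw [Subtype.ext_iff] at h0
        exact hx0 (by rw [h, show z = 0 from h0, zero_pow hℓ.out.ne_zero, mul_zero])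
    descent := fun c z e => by
      obtain ⟨d, hd, h⟩ := exists_pow_of_map_eq_pow hξ hξD z.2 (congrArg Subtype.val e)
      exact ⟨⟨d, hd⟩, Subtype.ext h⟩
    coll := fun x hx0 hx1 hxn => by
      obtain ⟨i, z, hz, h⟩ := S.exists_one_add_eq hD.isOpen hodd hD.coprime hξ hξD x.2
        (fun h => hx0 (Subtype.ext h)) (fun h => hx1 (Subtype.ext h))
        (fun ⟨z, hz, h⟩ => hxn ⟨⟨z, hz⟩, Subtype.ext h⟩)
      exact ⟨i, ⟨z, hz⟩, Subtype.ext h⟩ }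

end GaloisSetup

set_option linter.unusedSectionVars false

namespace GaloisSetup

open MulAction KummerStep

variable {G C Ω : Type*} [Group G] [TopologicalSpace G] [Field C] [Field Ω]
  [MulSemiringAction G C] [MulSemiringAction G Ω] [Algebra C Ω] [SMulDistribClass G C Ω]
  [IsAlgClosed C] [CharZero C] {w : AbsoluteValue C ℝ} {p ℓ : ℕ} [hp : Fact p.Prime]
  [hℓ : Fact ℓ.Prime] {ξ ζ γ : C} {D : Subgroup G} {g : G} (S : GaloisSetup G C Ω w p)

include S in
lemma isUnitMulPow_of_sub (hD : GoodSubgroup p ℓ ξ ζ D) (K : KummerStep D p ζ γ g) {x : FixF D Ω}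
    {x' : FixF (sub D γ) Ω} (e : (x : Ω) = x') (h : IsUnitMulPow (fixAbs w (sub D γ)) ℓ x') :
    IsUnitMulPow (fixAbs w D) ℓ x := by
  obtain ⟨c, z, hc, hz, h⟩ := h
  have h1 : (x : Ω) = algebraMap C Ω c * (z : Ω) ^ ℓ := by
    rw [e, h]; rfl
  have hz' : (z : Ω) ≠ 0 := fun h0 => hz (Subtype.ext h0)
  replace hc : w c = 1 := hc
  have hc0 : (c : C) ≠ 0 := w.ne_zero_iff.1 (by rw [hc]; exact one_ne_zero)
  have hx0 : (x : Ω) ≠ 0 := by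
    rw [h1]
    exact mul_ne_zero (by simpa using hc0) (pow_ne_zero _ hz')
  have hN : (x : Ω) ^ p = algebraMap C Ω (cycNorm g p (c : C)) * cycNorm g p (z : Ω) ^ ℓ := by
    rw [← cycNorm_of_mem K.mem p x.2, h1, cycNorm_mul, cycNorm_pow, cycNorm_map]
  obtain ⟨u, v, huv⟩ := Nat.isCoprime_iff_coprime.2 hD.coprime.symm
  refine ⟨⟨cycNorm g p (c : C), K.cycNorm_mem c.2⟩ ^ u,
    ⟨cycNorm g p (z : Ω), K.cycNorm_mem z.2⟩ ^ u * x ^ v, ?_, ?_, Subtype.ext ?_⟩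
  · rw [map_zpow₀, fixAbs_apply]
    change w (cycNorm g p (c : C)) ^ u = 1
    rw [S.abs_cycNorm, hc, one_pow, one_zpow]
  · refine mul_ne_zero (zpow_ne_zero _ fun h0 => ?_) (zpow_ne_zero _ fun h0 => ?_)
    · exact cycNorm_ne_zero g p hz' (congrArg Subtype.val h0)
    · exact hx0 (congrArg Subtype.val h0)
  · have h2 : (x : Ω) = ((x : Ω) ^ p) ^ u * ((x : Ω) ^ v) ^ ℓ := by
      rw [← zpow_natCast, ← zpow_natCast, ← zpow_mul, ← zpow_mul, ← zpow_add₀ hx0, mul_comm _ u,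
        huv, zpow_one]
    have hco : ∀ (a : FixF D Ω) (n : ℤ), ((a ^ n : FixF D Ω) : Ω) = (a : Ω) ^ n :=
      fun a n => map_zpow₀ (FixF D Ω).subtype a n
    rw [h2, hN, map_zpow₀]
    push_cast
    rw [hco, hco, hco, coe_algebraMap_FixF, mul_zpow, mul_pow, mul_assoc]
    congr 2
    rw [← zpow_natCast, ← zpow_natCast, ← zpow_mul, ← zpow_mul, mul_comm]

include S in
lemma isUnitMulPow_sub_iff (hD : GoodSubgroup p ℓ ξ ζ D) (K : KummerStep D p ζ γ g) {x : FixF D Ω}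
    {x' : FixF (sub D γ) Ω} (e : (x : Ω) = x') :
    IsUnitMulPow (fixAbs w (sub D γ)) ℓ x' ↔ IsUnitMulPow (fixAbs w D) ℓ x := by
  refine ⟨S.isUnitMulPow_of_sub hD K e, fun ⟨c, z, hc, hz, h⟩ =>
    ⟨⟨c, K.le_sub c.2⟩, ⟨z, K.le_sub z.2⟩, hc, fun h0 => hz (Subtype.ext ?_),
      Subtype.ext ?_⟩⟩
  · exact congrArg (fun t : FixF (sub D γ) Ω => (t : Ω)) h0
  · rw [← e, h]
    rfl

include S in
lemma isSmallElt_sub_iff (hD : GoodSubgroup p ℓ ξ ζ D) (K : KummerStep D p ζ γ g) {x : FixF D Ω}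
    {x' : FixF (sub D γ) Ω} (e : (x : Ω) = x') :
    IsSmallElt (fixAbs w (sub D γ)) ℓ x' ↔ IsSmallElt (fixAbs w D) ℓ x := by
  refine and_congr (not_congr ?_) (and_congr (not_congr (S.isUnitMulPow_sub_iff hD K e)) ?_)
  · rw [Subtype.ext_iff, Subtype.ext_iff, ← e]; rfl
  · constructor
    · rintro ⟨z, hz⟩
      have hz' : 1 + (x : Ω) = (z : Ω) ^ ℓ := by rw [e]; exact congrArg Subtype.val hz
      have hN : (1 + (x : Ω)) ^ p = cycNorm g p (z : Ω) ^ ℓ := by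
        rw [← cycNorm_of_mem K.mem p (add_mem (one_mem _) x.2), hz', cycNorm_pow]
      by_cases h0 : 1 + (x : Ω) = 0
      · exact ⟨0, Subtype.ext (by simpa [hℓ.out.ne_zero] using h0)⟩
      · obtain ⟨y, hy, h⟩ := pow_of_coprime_pow (FixF D Ω) hD.coprime.symm
          (add_mem (one_mem _) x.2) h0 (K.cycNorm_mem z.2) hN
        exact ⟨⟨y, hy⟩, Subtype.ext h⟩
    · rintro ⟨z, hz⟩
      refine ⟨⟨z, K.le_sub z.2⟩, Subtype.ext ?_⟩
      have hz' : 1 + (x : Ω) = (z : Ω) ^ ℓ := congrArg Subtype.val hz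
      change 1 + (x' : Ω) = (z : Ω) ^ ℓ
      rw [← hz', e]

include S in
lemma isUnitMulPow_smul (K : KummerStep D p ζ γ g) {h : G} (hh : h ∈ D)
    {x y : FixF (sub D γ) Ω} (e : h • (x : Ω) = y) (hx : IsUnitMulPow (fixAbs w (sub D γ)) ℓ x) :
    IsUnitMulPow (fixAbs w (sub D γ)) ℓ y := by
  obtain ⟨c, z, hc, hz, hx⟩ := hx
  refine ⟨⟨h • (c : C), K.smul_mem c.2 hh⟩, ⟨h • (z : Ω), K.smul_mem z.2 hh⟩, ?_, fun h0 => ?_,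
    Subtype.ext ?_⟩
  · exact (S.w_smul h c).trans hc
  · exact hz (Subtype.ext ((smul_eq_zero_iff_eq h).1 (congrArg Subtype.val h0)))
  · rw [← e, hx]
    change h • (algebraMap C Ω c * (z : Ω) ^ ℓ) = algebraMap C Ω (h • (c : C)) * (h • (z : Ω)) ^ ℓ
    rw [smul_mul', smul_pow', smul_algebraMap_eq]

include S in
lemma isSmallElt_smul (K : KummerStep D p ζ γ g) {h : G} (hh : h ∈ D)
    {x y : FixF (sub D γ) Ω} (e : h • (x : Ω) = y) (hx : IsSmallElt (fixAbs w (sub D γ)) ℓ x) :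
    IsSmallElt (fixAbs w (sub D γ)) ℓ y := by
  obtain ⟨h0, h1, z, hz⟩ := hx
  refine ⟨fun hy => h0 (Subtype.ext ((smul_eq_zero_iff_eq h).1 ?_)), fun hy => h1 ?_,
    ⟨h • (z : Ω), K.smul_mem z.2 hh⟩, Subtype.ext ?_⟩
  · rw [e, hy]; rfl
  · exact S.isUnitMulPow_smul K (inv_mem hh) (by rw [← e, inv_smul_smul]) hy
  · change 1 + (y : Ω) = (h • (z : Ω)) ^ ℓ
    rw [← smul_pow', show (z : Ω) ^ ℓ = 1 + x from (congrArg Subtype.val hz).symm, smul_add,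
      smul_one, e]

/-- The valuation ring of the fixed field of `D` obtained from `ℓ`-th powers. -/
noncomputable def tameRing (hD : GoodSubgroup p ℓ ξ ζ D) : ValuationSubring (FixF D Ω) :=
  (S.tamePair hD).exists_valuationSubring.choose

lemma mem_tameRing (hD : GoodSubgroup p ℓ ξ ζ D) (x : FixF D Ω) : x ∈ S.tameRing hD ↔
    x = 0 ∨ IsSmallElt (fixAbs w D) ℓ x ∨ (x ≠ 0 ∧ IsUnitMulPow (fixAbs w D) ℓ x ∧
      ∀ y : FixF D Ω, IsSmallElt (fixAbs w D) ℓ y → IsSmallElt (fixAbs w D) ℓ (x * y)) :=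
  (S.tamePair hD).exists_valuationSubring.choose_spec.1 x

lemma map_mem_tameRing (hD : GoodSubgroup p ℓ ξ ζ D) (c : FixF D C) :
    algebraMap _ (FixF D Ω) c ∈ S.tameRing hD ↔ w c ≤ 1 :=
  (S.tamePair hD).exists_valuationSubring.choose_spec.2.2 c

/-- Elements of the maximal ideal of `tameRing`. -/
def InMax (hD : GoodSubgroup p ℓ ξ ζ D) (x : Ω) : Prop :=
  ∃ h : x ∈ FixF D Ω, (S.tameRing hD).valuation ⟨x, h⟩ < 1

variable {S} {hD : GoodSubgroup p ℓ ξ ζ D} {x y : Ω}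

lemma InMax.sub (hx : S.InMax hD x) (hy : S.InMax hD y) : S.InMax hD (x - y) :=
  ⟨sub_mem hx.1 hy.1, ((S.tameRing hD).valuation.map_sub ⟨x, hx.1⟩ ⟨y, hy.1⟩).trans_lt
    (max_lt hx.2 hy.2)⟩

lemma valuation_map_le (c : FixF D C) :
    (S.tameRing hD).valuation (algebraMap _ (FixF D Ω) c) ≤ 1 ↔ w c ≤ 1 := by
  rw [ValuationSubring.valuation_le_one_iff, S.map_mem_tameRing]

lemma valuation_map_lt (c : FixF D C) :
    (S.tameRing hD).valuation (algebraMap _ (FixF D Ω) c) < 1 ↔ w c < 1 := by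
  by_cases hc : c = 0
  · simp [hc]
  have h1 := valuation_map_le (S := S) (hD := hD) c⁻¹
  have hc' : (c : C) ≠ 0 := by simpa using hc
  rw [map_inv₀, map_inv₀, show ((c⁻¹ : FixF D C) : C) = (c : C)⁻¹ from rfl, map_inv₀, ← not_iff_not,
    not_le, not_le] at h1
  rwa [one_lt_inv₀ (w.pos hc'), one_lt_inv₀ (by simpa [zero_lt_iff] using hc)] at h1

lemma InMax.map_iff {c : C} (hc : c ∈ FixF D C) : S.InMax hD (algebraMap C Ω c) ↔ w c < 1 := by
  rw [← valuation_map_lt (S := S) (hD := hD) ⟨c, hc⟩]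
  exact ⟨fun h => h.2, fun h => ⟨algebraMap_mem_FixF_iff.2 hc, h⟩⟩

lemma InMax.map_mul {c : C} (hc : c ∈ FixF D C) (h : w c ≤ 1) (hx : S.InMax hD x) :
    S.InMax hD (algebraMap C Ω c * x) := by
  refine ⟨mul_mem (algebraMap_mem_FixF_iff.2 hc) hx.1, ?_⟩
  have := (S.tameRing hD).valuation.map_mul
    (algebraMap (FixF D C) (FixF D Ω) ⟨c, hc⟩) ⟨x, hx.1⟩
  exact (this.trans (mul_comm _ _)).trans_lt (mul_lt_one_of_lt_of_le hx.2 ((valuation_map_le ⟨c, hc⟩).2 h))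

lemma InMax.exists_of_prod {f : ℕ → Ω} {n : ℕ} (hf : ∀ i, f i ∈ FixF D Ω)
    (h : S.InMax hD (∏ i ∈ Finset.range n, f i)) : ∃ i < n, S.InMax hD (f i) := by
  obtain ⟨h1, h2⟩ := h
  by_contra! hcon
  have e : (⟨_, h1⟩ : FixF D Ω) = ∏ i ∈ Finset.range n, ⟨f i, hf i⟩ :=
    Subtype.ext (by push_cast; rfl)
  rw [e, map_prod] at h2
  refine absurd h2 (not_lt.2 (Finset.one_le_prod' fun i hi => ?_))
  exact not_lt.1 fun h3 => hcon i (Finset.mem_range.1 hi) ⟨hf i, h3⟩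

lemma InMax.of_forall {D' : Subgroup G} {hD' : GoodSubgroup p ℓ ξ ζ D'} (hx : S.InMax hD x)
    (hy : y ∈ FixF D' Ω) (h : ∀ z : FixF D' Ω, (z : Ω) = y⁻¹ → z ∈ S.tameRing hD' →
      ∃ u : FixF D Ω, (u : Ω) = x⁻¹ ∧ u ∈ S.tameRing hD) (hxy : x = 0 → y = 0) :
    S.InMax hD' y := by
  refine ⟨hy, ?_⟩
  by_cases hy0 : y = 0
  · subst hy0
    rw [show (⟨0, hy⟩ : FixF D' Ω) = 0 from rfl, map_zero]
    exact zero_lt_one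
  have hx0 : x ≠ 0 := fun h => hy0 (hxy h)
  by_contra hcon
  rw [not_lt] at hcon
  obtain ⟨u, hu, hu'⟩ := h (⟨y, hy⟩⁻¹) rfl (by
    rw [← ValuationSubring.valuation_le_one_iff, map_inv₀]
    exact inv_le_one_of_one_le₀ hcon)
  obtain ⟨hx1, hx2⟩ := hx
  have e : u = (⟨x, hx1⟩ : FixF D Ω)⁻¹ := Subtype.ext hu
  rw [e, ← ValuationSubring.valuation_le_one_iff, map_inv₀] at hu'
  refine absurd hu' (not_le.2 ((one_lt_inv₀ ?_).2 hx2))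
  rw [zero_lt_iff, ne_eq, map_eq_zero, Subtype.ext_iff]
  exact hx0

lemma InMax.sub_step (K : KummerStep D p ζ γ g) (hx : S.InMax hD x) :
    S.InMax (S.goodSubgroup_sub hD γ) x := by
  refine hx.of_forall (K.le_sub hx.1) (fun z hz hzm => ?_) id
  refine ⟨⟨x, hx.1⟩⁻¹, rfl, ?_⟩
  set u : FixF D Ω := ⟨x, hx.1⟩⁻¹ with hu
  have e : (u : Ω) = z := hz.symm
  rw [mem_tameRing] at hzm ⊢
  refine hzm.imp (fun h => Subtype.ext ?_) (Or.imp (S.isSmallElt_sub_iff hD K e).1 ?_)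
  · rw [e, h]; rfl
  · rintro ⟨h0, h1, h2⟩
    refine ⟨fun h => h0 (Subtype.ext ?_), (S.isUnitMulPow_sub_iff hD K e).1 h1, fun y hy => ?_⟩
    · rw [← e, h]; rfl
    · refine (S.isSmallElt_sub_iff hD K (x' := z * ⟨y, K.le_sub y.2⟩) ?_).1
        (h2 ⟨y, K.le_sub y.2⟩ ((S.isSmallElt_sub_iff hD K rfl).2 hy))
      push_cast
      rw [e]

lemma InMax.smul_step (K : KummerStep D p ζ γ g) {h : G} (hh : h ∈ D)
    (hx : S.InMax (S.goodSubgroup_sub hD γ) x) : S.InMax (S.goodSubgroup_sub hD γ) (h • x) := by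
  refine hx.of_forall (K.smul_mem hx.1 hh) (fun z hz hzm => ?_) fun h0 => by rw [h0, smul_zero]
  refine ⟨⟨x, hx.1⟩⁻¹, rfl, ?_⟩
  set u : FixF (KummerStep.sub D γ) Ω := ⟨x, hx.1⟩⁻¹ with hu
  have e : h⁻¹ • (z : Ω) = u := by
    rw [hz, smul_inv'', inv_smul_smul]; rfl
  rw [mem_tameRing] at hzm ⊢
  refine hzm.imp (fun h => Subtype.ext ?_) (Or.imp (S.isSmallElt_smul K (inv_mem hh) e) ?_)
  · rw [← e, h]; exact smul_zero _
  · rintro ⟨h0, h1, h2⟩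
    refine ⟨fun h => h0 (Subtype.ext ?_), S.isUnitMulPow_smul K (inv_mem hh) e h1, fun y hy => ?_⟩
    · rw [h] at e
      exact (smul_eq_zero_iff_eq _).1 e
    · refine S.isSmallElt_smul K (inv_mem hh) (x := z * ⟨h • (y : Ω), K.smul_mem y.2 hh⟩) ?_
        (h2 _ (S.isSmallElt_smul K hh rfl hy))
      push_cast
      rw [smul_mul', e, inv_smul_smul]

end GaloisSetup

namespace GaloisSetup

open MulAction KummerStep

variable {G C Ω : Type*} [Group G] [TopologicalSpace G] [Field C] [Field Ω]
  [MulSemiringAction G C] [MulSemiringAction G Ω] [Algebra C Ω] [SMulDistribClass G C Ω]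
  [IsAlgClosed C] [CharZero C] {w : AbsoluteValue C ℝ} {p ℓ : ℕ} [hp : Fact p.Prime]
  [hℓ : Fact ℓ.Prime] {ξ ζ γ : C} {D : Subgroup G} {g : G} (S : GaloisSetup G C Ω w p)

include S in
lemma abs_pow_sub_one (hζ : IsPrimitiveRoot ζ p) {i : ℕ} (hi : i.Coprime p) :
    w (ζ ^ i - 1) = w (ζ - 1) := by
  have key : ∀ (x : C) (n : ℕ), w x = 1 → w (x ^ n - 1) ≤ w (x - 1) := by
    intro x n hx
    rw [← geom_sum_mul, map_mul]
    refine mul_le_of_le_one_left (w.nonneg _) (S.sum_le _ _ zero_le_one fun i _ => ?_)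
    rw [map_pow, hx, one_pow]
  have hwζ := abs_eq_one_of_pow_eq_one w hp.out.ne_zero hζ.pow_eq_one
  refine le_antisymm (key ζ i hwζ) ?_
  obtain ⟨m, hm⟩ := Nat.exists_mul_mod_eq_one_of_coprime hi hp.out.one_lt
  have h1 : (ζ ^ i) ^ m = ζ := by
    rw [← pow_mul, ← Nat.div_add_mod (i * m) p, hm.2, pow_succ, pow_mul, hζ.pow_eq_one, one_pow,
      one_mul]
  have := key (ζ ^ i) m (by rw [map_pow, hwζ, one_pow])
  rwa [h1] at this

include S in
lemma abs_pow_sub_one_le (hζ : IsPrimitiveRoot ζ p) (i : ℕ) : w (ζ ^ i - 1) ≤ w (ζ - 1) := by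
  by_cases h : i.Coprime p
  · exact (S.abs_pow_sub_one hζ h).le
  · rw [Nat.coprime_comm, hp.out.coprime_iff_not_dvd, not_not] at h
    rw [(hζ.pow_eq_one_iff_dvd i).2 h]
    simp

include S in
lemma abs_zeta_sub_one_pow (hζ : IsPrimitiveRoot ζ p) : w (ζ - 1) ^ p = w (p * (ζ - 1)) := by
  obtain ⟨m, hm⟩ := Nat.exists_eq_succ_of_ne_zero hp.out.ne_zero
  rw [Nat.succ_eq_add_one] at hm
  have h1 := (hm ▸ hζ : IsPrimitiveRoot ζ (m + 1)).prod_one_sub_pow_eq_order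
  have h2 := congrArg w h1
  rw [map_prod, Finset.prod_congr rfl (g := fun _ => w (ζ - 1)) fun i hi => by
    rw [w.map_sub]
    refine S.abs_pow_sub_one hζ (Nat.coprime_of_lt_prime (Nat.succ_ne_zero i) ?_ hp.out).symm
    rw [hm]
    have := Finset.mem_range.1 hi
    omega] at h2
  rw [Finset.prod_const, Finset.card_range] at h2
  rw [map_mul, hm, pow_succ, h2]
  push_cast
  rfl

lemma zeta_sub_one_ne_zero (hζ : IsPrimitiveRoot ζ p) : ζ - 1 ≠ 0 :=
  sub_ne_zero.2 (hζ.ne_one hp.out.one_lt)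

variable {S} in
/-- Elements sufficiently close to `1` are `p`-th powers. -/
lemma exists_pow_of_inMax {hD : GoodSubgroup p ℓ ξ ζ D} {z : Ω} (hz : S.InMax hD z) :
    ∃ t ∈ FixF D Ω, 1 + algebraMap C Ω (p * (ζ - 1)) * z = t ^ p := by
  have : NeZero p := ⟨hp.out.ne_zero⟩
  have hζ := hD.prim_zeta
  have hlD : ζ - 1 ∈ FixF D C := sub_mem hD.zeta_mem (one_mem _)
  have hl0 := zeta_sub_one_ne_zero hζ
  set x := 1 + algebraMap C Ω (p * (ζ - 1)) * z with hx
  have hxD : x ∈ FixF D Ω := add_mem (one_mem _) (mul_mem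
    (algebraMap_mem_FixF_iff.2 (mul_mem (natCast_mem _ _) hlD)) hz.1)
  by_cases hx0 : x = 0
  · exact ⟨0, zero_mem _, by rw [hx0, zero_pow hp.out.ne_zero]⟩
  obtain ⟨c, hc, y, hy, e⟩ := S.kummer D p hp.out.pos x hxD hx0
  obtain ⟨γ, hγ⟩ := IsAlgClosed.exists_pow_nat_eq c hp.out.pos
  set τ := algebraMap C Ω γ * y with hτ
  have hτx : τ ^ p = x := by rw [hτ, mul_pow, ← map_pow, hγ, e]
  by_cases hγD : γ ∈ FixF D C
  · exact ⟨τ, mul_mem (algebraMap_mem_FixF_iff.2 hγD) hy, hτx.symm⟩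
  exfalso
  obtain ⟨g, K⟩ := exists_step hp.out hζ hD.zeta_mem (by rwa [hγ]) hγD
  have hgτ : g • τ = algebraMap C Ω ζ * τ := by
    rw [hτ, smul_mul', smul_algebraMap_eq, K.smul, _root_.map_mul, smul_of_mem_FixF hy K.mem, mul_assoc]
  have hτD : τ ∈ FixF (KummerStep.sub D γ) Ω :=
    mul_mem (algebraMap_mem_FixF_iff.2 (gamma_mem D γ)) (K.le_sub hy)
  set l := algebraMap C Ω (ζ - 1) with hl
  have hlΩ : l ≠ 0 := (map_ne_zero _).2 hl0
  set ζ' := algebraMap C Ω ζ with hζ'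
  have hζ'D : ζ' ∈ FixF D Ω := algebraMap_mem_FixF_iff.2 hD.zeta_mem
  have hl'D : l ∈ FixF D Ω := algebraMap_mem_FixF_iff.2 hlD
  set σ : ℕ → Ω := fun i => (τ - ζ' ^ i) / l with hσ
  have hσD : ∀ i, σ i ∈ FixF (KummerStep.sub D γ) Ω := fun i => div_mem
    (sub_mem hτD (_root_.pow_mem (K.le_sub hζ'D) i)) (K.le_sub hl'D)
  have hprod : ∏ i ∈ Finset.range p, σ i =
      algebraMap C Ω (p * (ζ - 1) / (ζ - 1) ^ p) * z := by
    have h1 := prod_sub_pow_mul (hζ.map_of_injective (algebraMap C Ω).injective) τ 1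
    simp only [mul_one, one_pow] at h1
    rw [hσ, Finset.prod_div_distrib, h1, Finset.prod_const, Finset.card_range, hτx, hx,
      add_sub_cancel_left, map_div₀, map_pow, ← hl, mul_div_right_comm]
  have hmem : S.InMax (S.goodSubgroup_sub hD γ) (∏ i ∈ Finset.range p, σ i) := by
    rw [hprod]
    refine (hz.sub_step K).map_mul (K.le_sub (div_mem (mul_mem (natCast_mem _ _) hlD)
      (_root_.pow_mem hlD p))) ?_
    rw [map_div₀, map_pow, S.abs_zeta_sub_one_pow hζ, ← S.abs_zeta_sub_one_pow hζ, div_self]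
    exact pow_ne_zero _ (w.ne_zero_iff.2 hl0)
  obtain ⟨i, -, hi⟩ := InMax.exists_of_prod hσD hmem
  have h1 := InMax.smul_step (hD := hD) K K.mem hi
  have hwζ := abs_eq_one_of_pow_eq_one w hp.out.ne_zero hζ.pow_eq_one
  have h2 := hi.map_mul (K.le_sub hD.zeta_mem) hwζ.le
  have h3 := h1.sub h2
  have h4 : g • σ i - algebraMap C Ω ζ * σ i = algebraMap C Ω (ζ ^ i) := by
    have e1 : l = ζ' - 1 := by rw [hl, map_sub, map_one]
    rw [hσ, smul_div₀', smul_sub, smul_pow', hgτ, smul_of_mem_FixF hζ'D K.mem,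
      smul_of_mem_FixF hl'D K.mem, map_pow, ← hζ', mul_div_assoc', ← sub_div, div_eq_iff hlΩ, e1]
    ring
  rw [h4, InMax.map_iff (K.le_sub (_root_.pow_mem hD.zeta_mem i)), map_pow, hwζ, one_pow] at h3
  exact lt_irrefl _ h3

include S in
/-- There is a unit `η` such that adjoining a `p`-th root of `1 + p(ζ - 1)η` gives an unramified
extension of degree `p`. -/
lemma exists_unit_not_pow (hD : GoodSubgroup p ℓ ξ ζ D) : ∃ η ∈ FixF D C, w η = 1 ∧
    ¬ ∃ t ∈ FixF D C, 1 + p * (ζ - 1) * η = t ^ p := by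
  have : NeZero p := ⟨hp.out.ne_zero⟩
  have hζ := hD.prim_zeta
  have hlD : ζ - 1 ∈ FixF D C := sub_mem hD.zeta_mem (one_mem _)
  have hl0 := zeta_sub_one_ne_zero hζ
  have hwl : 0 < w (ζ - 1) := w.pos hl0
  have hfin := S.finite_residue hD.isOpen
  have hres := S.residue_eq_iff hD.isOpen
  set O := (S.isLocalAbs hD.isOpen).integers with hO
  let β : ℕ → O := fun i => ⟨⟨(ζ ^ i - 1) / (ζ - 1), div_mem (sub_mem
    (_root_.pow_mem hD.zeta_mem i) (one_mem _)) hlD⟩, by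
      change w ((ζ ^ i - 1) / (ζ - 1)) ≤ 1
      rw [map_div₀, div_le_one hwl]
      exact S.abs_pow_sub_one_le hζ i⟩
  have hp0 : (p : C) ≠ 0 := Nat.cast_ne_zero.2 hp.out.ne_zero
  have hwε : w ((ζ - 1) ^ p / (p * (ζ - 1))) = 1 := by
    rw [map_div₀, map_pow, S.abs_zeta_sub_one_pow hζ, div_self]
    exact w.ne_zero_iff.2 (mul_ne_zero hp0 hl0)
  let ε : O := ⟨⟨(ζ - 1) ^ p / (p * (ζ - 1)), div_mem (_root_.pow_mem hlD p)
    (mul_mem (natCast_mem _ _) hlD)⟩, hwε.le⟩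
  let F : IsLocalRing.ResidueField O → IsLocalRing.ResidueField O := fun x =>
    IsLocalRing.residue O ε * ∏ i ∈ Finset.range p, (x - IsLocalRing.residue O (β i))
  have hβ0 : IsLocalRing.residue O (β 0) = 0 := by
    rw [← map_zero (IsLocalRing.residue O)]
    congr 1
    refine Subtype.ext (Subtype.ext ?_)
    change (ζ ^ 0 - 1) / (ζ - 1) = 0
    simp
  have hβ1 : IsLocalRing.residue O (β 1) = 1 := by
    rw [← map_one (IsLocalRing.residue O)]
    congr 1
    refine Subtype.ext (Subtype.ext ?_)
    change (ζ ^ 1 - 1) / (ζ - 1) = 1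
    rw [pow_one, div_self hl0]
  have hF0 : F 0 = 0 := by
    simp only [F]
    rw [Finset.prod_eq_zero (Finset.mem_range.2 hp.out.pos) (by rw [hβ0, sub_zero]), mul_zero]
  have hF1 : F 1 = 0 := by
    simp only [F]
    rw [Finset.prod_eq_zero (Finset.mem_range.2 hp.out.one_lt) (by rw [hβ1, sub_self]), mul_zero]
  have hsurj : ¬ Function.Surjective F := fun h =>
    zero_ne_one ((Finite.injective_iff_surjective.2 h) (hF0.trans hF1.symm))
  rw [Function.Surjective] at hsurj
  push Not at hsurj
  obtain ⟨b, hb⟩ := hsurj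
  obtain ⟨η, rfl⟩ := IsLocalRing.residue_surjective b
  refine ⟨(η : FixF D C), η.1.2, ?_, ?_⟩
  · refine le_antisymm η.2 (not_lt.1 fun h => hb 0 ?_)
    rw [hF0, eq_comm, IsLocalAbs.residue_eq_zero_iff]
    exact h
  · rintro ⟨t, ht, e⟩
    set θ := (t - 1) / (ζ - 1) with hθ
    have hθD : θ ∈ FixF D C := div_mem (sub_mem ht (one_mem _)) hlD
    have hprod : ∏ i ∈ Finset.range p, (θ - (ζ ^ i - 1) / (ζ - 1)) =
        p * (ζ - 1) * ((η : FixF D C) : C) / (ζ - 1) ^ p := by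
      have h1 := prod_sub_pow_mul hζ t 1
      simp only [mul_one, one_pow] at h1
      have h2 : ∀ i, θ - (ζ ^ i - 1) / (ζ - 1) = (t - ζ ^ i) / (ζ - 1) := fun i => by
        rw [hθ, ← sub_div, sub_sub_sub_cancel_right]
      simp only [h2]
      rw [Finset.prod_div_distrib, h1, Finset.prod_const, Finset.card_range, ← e,
        add_sub_cancel_left]
    have hFη : (ζ - 1) ^ p / (p * (ζ - 1)) *
        ∏ i ∈ Finset.range p, (θ - (ζ ^ i - 1) / (ζ - 1)) = ((η : FixF D C) : C) := by
      rw [hprod]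
      field_simp
    have hθ1 : w θ ≤ 1 := by
      by_contra! hlt
      have h3 : ∀ i, w (θ - (ζ ^ i - 1) / (ζ - 1)) = w θ := fun i => by
        rw [sub_eq_add_neg]
        refine S.add_eq_left ?_
        rw [map_neg_eq_map]
        exact lt_of_le_of_lt (β i).2 hlt
      have h4 := congrArg w hFη
      rw [map_mul, hwε, one_mul, map_prod, Finset.prod_congr rfl fun i _ => h3 i,
        Finset.prod_const, Finset.card_range] at h4
      have h5 := one_lt_pow₀ hlt hp.out.ne_zero
      rw [h4] at h5
      exact absurd η.2 (not_le.2 h5)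
    refine hb (IsLocalRing.residue O ⟨⟨θ, hθD⟩, hθ1⟩) ?_
    simp only [F, ← map_sub, ← map_prod, ← map_mul]
    congr 1
    refine Subtype.ext (Subtype.ext ?_)
    rw [← hFη]
    push_cast
    rfl

include S in
lemma cycTrace_mem (K : KummerStep D p ζ γ g) {x : C} (hx : x ∈ FixF (KummerStep.sub D γ) C) :
    ∑ i ∈ Finset.range p, g ^ i • x ∈ FixF D C := by
  refine K.mem_of_smul (sum_mem fun i _ => K.pow_smul_mem hx i) ?_
  rw [Finset.smul_sum]
  have e : ∀ i, g • g ^ i • x = g ^ (i + 1) • x := fun i => by rw [pow_succ', mul_smul]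
  simp only [e]
  obtain ⟨m, rfl⟩ := Nat.exists_eq_succ_of_ne_zero K.prime.ne_zero
  rw [Finset.sum_range_succ, Finset.sum_range_succ']
  congr 1
  simpa using K.period hx

include S in
/-- Adjoining a `p`-th root `γ` of an element `1 + p(ζ - 1)η` gives an unramified extension. -/
lemma exists_abs_eq (hD : GoodSubgroup p ℓ ξ ζ D) (K : KummerStep D p ζ γ g) {η : C}
    (hη : w η = 1) (hγ : 1 + p * (ζ - 1) * η = γ ^ p) {e : C}
    (he : e ∈ FixF (KummerStep.sub D γ) C) (he0 : e ≠ 0) : ∃ b ∈ FixF D C, w b = w e := by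
  have : NeZero p := ⟨hp.out.ne_zero⟩
  have hζ := hD.prim_zeta
  have hD' := S.goodSubgroup_sub hD γ
  have hlD : ζ - 1 ∈ FixF D C := sub_mem hD.zeta_mem (one_mem _)
  have hl0 := zeta_sub_one_ne_zero hζ
  have hwl : 0 < w (ζ - 1) := w.pos hl0
  set θ := (γ - 1) / (ζ - 1) with hθ
  have hθD : θ ∈ FixF (KummerStep.sub D γ) C :=
    div_mem (sub_mem (gamma_mem D γ) (one_mem _)) (K.le_sub hlD)
  have hwpl : w (p * (ζ - 1)) < 1 := by
    have h1 := S.abs_zeta_sub_one_pow hζ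
    have h2 : w (ζ - 1) < 1 := by
      have h3 : w (ζ - 1) ≤ 1 := (S.sub_le _ _).trans (by
        simp [abs_eq_one_of_pow_eq_one w hp.out.ne_zero hζ.pow_eq_one])
      refine lt_of_le_of_ne h3 fun h4 => ?_
      rw [map_mul, h4, one_pow, mul_one] at h1
      exact S.w_p.ne h1.symm
    rw [← h1]
    exact pow_lt_one₀ (w.nonneg _) h2 hp.out.ne_zero
  have hwγ : w γ = 1 := by
    have h1 : w (γ ^ p) = 1 := by
      rw [← hγ, ← map_one w]
      refine S.add_eq_left ?_
      rw [map_mul w, hη, mul_one, map_one]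
      exact hwpl
    rw [map_pow] at h1
    exact (pow_eq_one_iff_of_nonneg (w.nonneg _) hp.out.ne_zero).1 h1
  have hwθ : w θ ≤ 1 := by
    by_contra! hlt
    have h3 : ∀ i, w (θ - (ζ ^ i - 1) / (ζ - 1)) = w θ := fun i => by
      rw [sub_eq_add_neg]
      refine S.add_eq_left ?_
      rw [map_neg_eq_map, map_div₀]
      exact lt_of_le_of_lt ((div_le_one hwl).2 (S.abs_pow_sub_one_le hζ i)) hlt
    have h1 := prod_sub_pow_mul hζ γ 1
    simp only [mul_one, one_pow] at h1
    have h2 : ∀ i, θ - (ζ ^ i - 1) / (ζ - 1) = (γ - ζ ^ i) / (ζ - 1) := fun i => by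
      rw [hθ, ← sub_div, sub_sub_sub_cancel_right]
    have h4 : ∏ i ∈ Finset.range p, (θ - (ζ ^ i - 1) / (ζ - 1)) =
        p * (ζ - 1) * η / (ζ - 1) ^ p := by
      simp only [h2]
      rw [Finset.prod_div_distrib, h1, Finset.prod_const, Finset.card_range, ← hγ,
        add_sub_cancel_left]
    have h5 : w (p * (ζ - 1) * η / (ζ - 1) ^ p) = 1 := by
      rw [map_div₀, map_mul w _ η, hη, mul_one, map_pow, ← S.abs_zeta_sub_one_pow hζ,
        div_self (pow_ne_zero _ hwl.ne')]
    rw [← h4, map_prod, Finset.prod_congr rfl fun i _ => h3 i, Finset.prod_const,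
      Finset.card_range] at h5
    exact (one_lt_pow₀ hlt hp.out.ne_zero).ne' h5
  have hgθ : ∀ i j, i < p → j < p → i ≠ j → w (g ^ i • θ - g ^ j • θ) = 1 := by
    have key : ∀ i j, i < j → j < p → w (g ^ i • θ - g ^ j • θ) = 1 := by
      intro i j hij hj
      have h1 : ∀ i : ℕ, g ^ i • θ = (ζ ^ i * γ - 1) / (ζ - 1) := fun i => by
        rw [hθ, smul_div₀', smul_sub, smul_one, K.pow_smul,
          smul_of_mem_FixF hlD (_root_.pow_mem K.mem i)]
      obtain ⟨m, rfl⟩ := Nat.exists_eq_add_of_lt hij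
      rw [h1, h1, ← sub_div, show ζ ^ i * γ - 1 - (ζ ^ (i + m + 1) * γ - 1) =
        -(ζ ^ i * γ * (ζ ^ (m + 1) - 1)) by ring, map_div₀, map_neg_eq_map, map_mul, map_mul,
        map_pow, hwγ, abs_eq_one_of_pow_eq_one w hp.out.ne_zero hζ.pow_eq_one, one_pow, one_mul,
        one_mul, S.abs_pow_sub_one hζ, div_self hwl.ne']
      exact (Nat.coprime_of_lt_prime (Nat.succ_ne_zero m) (by omega) hp.out).symm
    intro i j hi hj hij
    rcases lt_or_gt_of_ne hij with h | h
    · exact key i j h hj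
    · rw [w.map_sub]; exact key j i h hi
  have hwe := w.pos he0
  by_contra! hcon
  have hlt : ∀ i : ℕ, w (∑ j ∈ Finset.range p, g ^ j • (e * θ ^ i)) < w e := fun i => by
    refine lt_of_le_of_ne (S.sum_le _ _ (w.nonneg _) fun j _ => ?_)
      (hcon _ (S.cycTrace_mem K (mul_mem he (_root_.pow_mem hθD i))))
    rw [S.w_smul, map_mul, map_pow]
    exact mul_le_of_le_one_right (w.nonneg _) (pow_le_one₀ (w.nonneg _) hwθ)
  have hres := S.residue_eq_iff hD'.isOpen
  set O := (S.isLocalAbs hD'.isOpen).integers with hO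
  let t : Fin p → O := fun j => ⟨⟨g ^ (j : ℕ) • θ, K.pow_smul_mem hθD j⟩, by
    change w (g ^ (j : ℕ) • θ) ≤ 1
    rwa [S.w_smul]⟩
  let v : Fin p → O := fun j => ⟨⟨g ^ (j : ℕ) • e / e, div_mem (K.pow_smul_mem he j) he⟩, by
    change w (g ^ (j : ℕ) • e / e) ≤ 1
    rw [map_div₀, S.w_smul, div_self hwe.ne']⟩
  have hv : (fun j => IsLocalRing.residue O (v j)) = 0 := by
    refine Matrix.eq_zero_of_forall_pow_sum_mul_pow_eq_zero
      (f := fun j => IsLocalRing.residue O (t j)) (fun i j hij => ?_) fun i => ?_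
    · simp only at hij
      rw [hres] at hij
      by_contra hne
      exact hij.ne (hgθ i j i.2 j.2 fun h => hne (Fin.ext h))
    · simp only [← map_pow, ← map_mul, ← map_sum]
      rw [IsLocalAbs.residue_eq_zero_iff, fixAbs_apply]
      have h1 : (((∑ j, v j * t j ^ (i : ℕ) : O) : FixF (KummerStep.sub D γ) C) : C) =
          (∑ j ∈ Finset.range p, g ^ j • (e * θ ^ (i : ℕ))) / e := by
        push_cast
        rw [← Fin.sum_univ_eq_sum_range (fun j => g ^ j • (e * θ ^ (i : ℕ))), Finset.sum_div]
        refine Finset.sum_congr rfl fun j _ => ?_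
        rw [smul_mul', smul_pow', mul_div_right_comm]
      rw [h1, map_div₀, div_lt_one hwe]
      exact hlt i
  have h0 := congrFun hv 0
  simp only [Pi.zero_apply] at h0
  rw [IsLocalAbs.residue_eq_zero_iff] at h0
  refine h0.ne ?_
  change w (g ^ 0 • e / e) = 1
  rw [pow_zero, one_smul, div_self he0, map_one]

variable {S} in
lemma exists_unit_mul_pow {hD : GoodSubgroup p ℓ ξ ζ D} {y : Ω} (hy : S.InMax hD y) :
    ∃ c ∈ FixF D C, ∃ t ∈ FixF D Ω, w c = 1 ∧ 1 + y = algebraMap C Ω c * t ^ p := by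
  have : NeZero p := ⟨hp.out.ne_zero⟩
  have hζ := hD.prim_zeta
  have hlD : ζ - 1 ∈ FixF D C := sub_mem hD.zeta_mem (one_mem _)
  have hl0 := zeta_sub_one_ne_zero hζ
  have hp0 : (p : C) ≠ 0 := Nat.cast_ne_zero.2 hp.out.ne_zero
  obtain ⟨η, hη, hwη, hδ⟩ := S.exists_unit_not_pow hD
  have hη0 : η ≠ 0 := w.ne_zero_iff.1 (by rw [hwη]; exact one_ne_zero)
  obtain ⟨γ, hγ⟩ := IsAlgClosed.exists_pow_nat_eq (1 + p * (ζ - 1) * η) hp.out.pos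
  have hpl : (p : C) * (ζ - 1) ∈ FixF D C := mul_mem (natCast_mem _ _) hlD
  have hδD : γ ^ p ∈ FixF D C := by
    rw [hγ]
    exact add_mem (one_mem _) (mul_mem hpl hη)
  have hγD : γ ∉ FixF D C := fun h => hδ ⟨γ, h, hγ.symm⟩
  obtain ⟨g, K⟩ := exists_step hp.out hζ hD.zeta_mem hδD hγD
  obtain ⟨τ, hτ, e1⟩ := exists_pow_of_inMax (InMax.map_mul (neg_mem hη)
    (by rw [map_neg_eq_map]; exact hwη.le) hy)
  have hγΩ : algebraMap C Ω γ ∈ FixF (KummerStep.sub D γ) Ω :=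
    algebraMap_mem_FixF_iff.2 (gamma_mem D γ)
  have hne : τ - algebraMap C Ω γ ≠ 0 := fun h => hγD (by
    rw [sub_eq_zero] at h
    rw [← algebraMap_mem_FixF_iff (Ω := Ω), ← h]
    exact hτ)
  have hN : cycNorm g p (τ - algebraMap C Ω γ) = algebraMap C Ω (-(p * (ζ - 1) * η)) * (1 + y) := by
    rw [cycNorm_sub (hζ.map_of_injective (algebraMap C Ω).injective)
      (by rw [smul_algebraMap_eq, smul_of_mem_FixF hD.zeta_mem K.mem]) (smul_of_mem_FixF hτ K.mem)
      (by rw [smul_algebraMap_eq, K.smul, map_mul]), ← e1, ← map_pow, hγ]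
    simp only [map_add, map_mul, map_neg, map_one]
    ring
  obtain ⟨e, he, v, hv, hev⟩ := S.kummer _ p hp.out.pos _ (sub_mem (K.le_sub hτ) hγΩ) hne
  have he0 : e ≠ 0 := by
    rintro rfl
    rw [map_zero, zero_mul] at hev
    exact hne hev
  obtain ⟨b, hb, hwb⟩ := S.exists_abs_eq hD K hwη hγ.symm he he0
  have hb0 : b ≠ 0 := w.pos_iff.1 (by rw [hwb]; exact w.pos he0)
  have hNe : cycNorm g p e = b ^ p * cycNorm g p (e / b) := by
    rw [← cycNorm_of_mem K.mem p hb, ← cycNorm_mul, mul_div_cancel₀ _ hb0]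
  have heb : e / b ∈ FixF (KummerStep.sub D γ) C := div_mem he (K.le_sub hb)
  set a := -(p * (ζ - 1) * η) with ha
  have ha0 : a ≠ 0 := neg_ne_zero.2 (mul_ne_zero (mul_ne_zero hp0 hl0) hη0)
  have haD : a ∈ FixF D C := neg_mem (mul_mem hpl hη)
  refine ⟨cycNorm g p (e / b) * ((ζ - 1) ^ p / a), mul_mem (K.cycNorm_mem heb)
    (div_mem (_root_.pow_mem hlD p) haD), algebraMap C Ω (b / (ζ - 1)) * cycNorm g p v,
    mul_mem (algebraMap_mem_FixF_iff.2 (div_mem hb hlD)) (K.cycNorm_mem hv), ?_, ?_⟩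
  · rw [map_mul, S.abs_cycNorm, map_div₀, hwb, div_self (w.ne_zero_iff.2 he0), one_pow, one_mul,
      map_div₀, map_pow, S.abs_zeta_sub_one_pow hζ, ha, map_neg_eq_map, map_mul w _ η, hwη, mul_one,
      div_self]
    exact w.ne_zero_iff.2 (mul_ne_zero hp0 hl0)
  · have haΩ : algebraMap C Ω a ≠ 0 := (map_ne_zero _).2 ha0
    have hlΩ : algebraMap C Ω (ζ - 1) ≠ 0 := (map_ne_zero _).2 hl0
    rw [hev, cycNorm_mul, cycNorm_map, cycNorm_pow, hNe] at hN
    rw [eq_comm, ← mul_right_inj' haΩ, ← hN]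
    simp only [map_mul, map_div₀, map_pow, mul_pow, div_pow]
    field_simp

theorem wildPair (hD : GoodSubgroup p ℓ ξ ζ D) :
    WildPair (FixF D C) (FixF D Ω) (fixAbs w D) p (S.tameRing hD) where
  isLocal := S.isLocalAbs hD.isOpen
  complete π h0 h1 u hu := by
    obtain ⟨a, ha, h⟩ := S.complete D hD.isOpen π π.2 h0 h1 (fun n => u n) (fun n => (u n).2) hu
    exact ⟨⟨a, ha⟩, h⟩
  p_lt := S.w_p
  perfect c hc := by
    have hfin := S.finite_residue hD.isOpen
    have hres := S.residue_eq_iff hD.isOpen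
    set O := (S.isLocalAbs hD.isOpen).integers with hO
    have hchar : CharP (IsLocalRing.ResidueField O) p := by
      refine (CharP.charP_iff_prime_eq_zero hp.out).2 ?_
      rw [← map_natCast (IsLocalRing.residue O), IsLocalAbs.residue_eq_zero_iff]
      exact S.w_p
    obtain ⟨b, hb⟩ := surjective_frobenius (IsLocalRing.ResidueField O) p
      (IsLocalRing.residue O ⟨c, hc⟩)
    obtain ⟨b, rfl⟩ := IsLocalRing.residue_surjective b
    rw [frobenius_def, ← map_pow, hres] at hb
    refine ⟨b, ?_⟩
    rw [(fixAbs w D).map_sub]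
    exact hb
  mem_iff c := S.map_mem_tameRing hD c
  unit_pow y hy := by
    obtain ⟨c, hc, t, ht, hwc, h⟩ := exists_unit_mul_pow (S := S) (hD := hD) ⟨y.2, hy⟩
    exact ⟨⟨c, hc⟩, ⟨t, ht⟩, hwc, Subtype.ext h⟩
  descent c z e := by
    have : NeZero p := ⟨hp.out.ne_zero⟩
    obtain ⟨d, hd, h⟩ := exists_pow_of_map_eq_pow hD.prim_zeta hD.zeta_mem z.2
      (congrArg Subtype.val e)
    exact ⟨⟨d, hd⟩, Subtype.ext h⟩

include S in
/-- The fixed field of a good subgroup carries a valuation ring whose residue field is the fixed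
field on constants. -/
theorem exists_valuationSubring_fixed (hD : GoodSubgroup p ℓ ξ ζ D) :
    ∃ R : ValuationSubring (FixF D Ω), (∀ c, algebraMap (FixF D C) (FixF D Ω) c ∈ R) ∧
      ∀ x ∈ R, ∃ e : FixF D C, x - algebraMap _ _ e = 0 ∨ (x - algebraMap _ _ e)⁻¹ ∉ R :=
  (S.wildPair hD).exists_coarsening

end GaloisSetup

/-- A valuation subring of `L` contains `E` and its residue field is the image of `E`. -/
structure HasConstantResidues (E : Type*) {L : Type*} [Field E] [Field L] [Algebra E L]
    (R : ValuationSubring L) : Prop where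
  algebraMap_mem : ∀ c, algebraMap E L c ∈ R
  exists_sub_lt : ∀ x ∈ R, ∃ e, R.valuation (x - algebraMap E L e) < 1

lemma ValuationSubring.valuation_lt_one_iff_inv_notMem {L : Type*} [Field L]
    (R : ValuationSubring L) (x : L) : R.valuation x < 1 ↔ x = 0 ∨ x⁻¹ ∉ R := by
  rw [← R.valuation_le_one_iff, map_inv₀, not_le]
  by_cases hx : x = 0
  · simp [hx]
  · rw [one_lt_inv₀ (zero_lt_iff.2 ((map_ne_zero _).2 hx))]
    simp [hx]

lemma ValuationSubring.mem_iff_inv_valuation_lt_one {L : Type*} [Field L]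
    (R : ValuationSubring L) (x : L) : x ∈ R ↔ x = 0 ∨ ¬ R.valuation x⁻¹ < 1 := by
  rw [R.valuation_lt_one_iff_inv_notMem, inv_eq_zero, inv_inv]
  by_cases hx : x = 0 <;> simp [hx]

namespace HasConstantResidues

variable {E L : Type*} [Field E] [Field L] [Algebra E L] {R : ValuationSubring L}
  (h : HasConstantResidues E R)

include h

lemma valuation_eq_one {c : E} (hc : c ≠ 0) : R.valuation (algebraMap E L c) = 1 := by
  refine le_antisymm ((R.valuation_le_one_iff _).2 (h.algebraMap_mem c)) ?_
  have := (R.valuation_le_one_iff _).2 (h.algebraMap_mem c⁻¹)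
  rw [map_inv₀, map_inv₀] at this
  exact (inv_le_one₀ (zero_lt_iff.2 (by simpa using hc))).1 this

lemma eq_zero_of_lt {c : E} (hc : R.valuation (algebraMap E L c) < 1) : c = 0 := by
  by_contra h0
  exact hc.ne (h.valuation_eq_one h0)

/-- Elements congruent to `1` are squares if all elements are squares up to constants. -/
lemma exists_sq (hk : ∀ x : L, x ≠ 0 → ∃ (c : E) (z : L), x = algebraMap E L c * z ^ 2) {x : L}
    (hx : R.valuation x < 1) : ∃ t, 1 + x = t ^ 2 := by
  have hv : R.valuation (1 + x) = 1 := by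
    rw [← map_one R.valuation] at hx ⊢
    rw [add_comm]
    exact Valuation.map_add_eq_of_lt_right _ hx
  obtain ⟨d, t, e⟩ := hk (1 + x) (by rintro h0; simp [h0] at hv)
  have hd : d ≠ 0 := by rintro rfl; simp [e] at hv
  rw [e, map_mul, h.valuation_eq_one hd, one_mul, map_pow] at hv
  have ht : R.valuation t = 1 := by simpa using hv
  obtain ⟨a, ha⟩ := h.exists_sub_lt t ((R.valuation_le_one_iff _).1 ht.le)
  have h1 : d * a ^ 2 - 1 = 0 := by
    refine h.eq_zero_of_lt ?_
    have e1 : algebraMap E L (d * a ^ 2 - 1) =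
        x - algebraMap E L d * (t + algebraMap E L a) * (t - algebraMap E L a) := by
      push_cast
      linear_combination -e
    rw [e1]
    refine Valuation.map_sub_lt _ hx ?_
    rw [map_mul]
    refine (mul_le_of_le_one_left' ((R.valuation_le_one_iff _).2 ?_)).trans_lt ha
    exact mul_mem (h.algebraMap_mem d)
      (add_mem ((R.valuation_le_one_iff _).1 ht.le) (h.algebraMap_mem a))
  have ha0 : a ≠ 0 := by rintro rfl; simp at h1
  refine ⟨t / algebraMap E L a, ?_⟩
  have ha0' : algebraMap E L a ≠ 0 := by simpa using ha0
  rw [e, div_pow, eq_div_iff (pow_ne_zero _ ha0')]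
  have h2 : algebraMap E L d * algebraMap E L a ^ 2 = 1 := by
    rw [← map_pow, ← map_mul, sub_eq_zero.1 h1, map_one]
  linear_combination t ^ 2 * h2

/-- The maximal ideal of a valuation ring with constant residues is determined by squares. -/
theorem valuation_lt_one_iff
    (hk : ∀ x : L, x ≠ 0 → ∃ (c : E) (z : L), x = algebraMap E L c * z ^ 2) {π : E}
    (hπ : ¬ ∃ t : L, algebraMap E L π = t ^ 2) (x : L) :
    R.valuation x < 1 ↔ ∀ c : E, ∃ t : L, 1 + algebraMap E L c * x = t ^ 2 := by
  have hπ0 : π ≠ 0 := by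
    rintro rfl
    exact hπ ⟨0, by simp⟩
  have hπ0' : algebraMap E L π ≠ 0 := by simpa using hπ0
  have hmul : ∀ (c : E) (y : L), R.valuation y < 1 → R.valuation (algebraMap E L c * y) < 1 := by
    intro c y hy
    rw [map_mul]
    exact (mul_le_of_le_one_left' ((R.valuation_le_one_iff _).2 (h.algebraMap_mem c))).trans_lt hy
  refine ⟨fun hx c => h.exists_sq hk (hmul c x hx), fun hx => ?_⟩
  by_contra hlt
  by_cases hx1 : x ∈ R
  · obtain ⟨e, he⟩ := h.exists_sub_lt x hx1
    have he0 : e ≠ 0 := by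
      rintro rfl
      rw [map_zero, sub_zero] at he
      exact hlt he
    have he0' : algebraMap E L e ≠ 0 := by simpa using he0
    obtain ⟨t, ht⟩ := hx ((π - 1) / e)
    obtain ⟨u, hu⟩ := h.exists_sq hk (hmul ((π - 1) / e / π) _ he)
    have hu1 : algebraMap E L π * u ^ 2 = t ^ 2 := by
      rw [← ht, ← hu]
      push_cast [map_div₀]
      field_simp
      ring
    have hu0 : u ≠ 0 := by
      rintro rfl
      have h1 : R.valuation (-1 : L) < 1 := by
        have h2 := hmul ((π - 1) / e / π) _ he
        have h3 : algebraMap E L ((π - 1) / e / π) * (x - algebraMap E L e) = -1 := by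
          linear_combination hu
        rwa [h3] at h2
      simp at h1
    refine hπ ⟨t / u, ?_⟩
    rw [div_pow, ← hu1]
    field_simp
  · have hx0 : x ≠ 0 := by
      rintro rfl
      exact hx1 (zero_mem _)
    have hxi : R.valuation x⁻¹ < 1 := by
      rw [R.valuation_lt_one_iff_inv_notMem, inv_inv]
      exact Or.inr hx1
    have key : ∀ c : E, c ≠ 0 → ∃ t, t ≠ 0 ∧ algebraMap E L c * x = t ^ 2 := by
      intro c hc
      have hc' : algebraMap E L c ≠ 0 := by simpa using hc
      obtain ⟨t, ht⟩ := hx c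
      have h1 := hmul c⁻¹ _ hxi
      obtain ⟨u, hu⟩ := h.exists_sq hk h1
      have hu0 : u ≠ 0 := by
        rintro rfl
        have h3 : algebraMap E L c⁻¹ * x⁻¹ = -1 := by linear_combination hu
        rw [h3] at h1
        simp at h1
      have e : algebraMap E L c * x = (t / u) ^ 2 := by
        rw [div_pow, ← ht, ← hu, eq_div_iff (by rw [hu]; exact pow_ne_zero _ hu0), map_inv₀]
        field_simp
        ring
      refine ⟨t / u, ?_, e⟩
      intro h0
      rw [h0] at e
      simp [hc, hx0] at e
    obtain ⟨t, ht0, ht⟩ := key 1 one_ne_zero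
    obtain ⟨u, hu0, hu⟩ := key π hπ0
    refine hπ ⟨u / t, ?_⟩
    rw [div_pow, ← ht, ← hu]
    simp [hx0]

end HasConstantResidues

/-- All multiples of `x` by fixed constants become squares after adding `1`. -/
def SquareCondition {G C Ω : Type*} [Group G] [Field C] [Field Ω] [MulSemiringAction G C]
    [MulSemiringAction G Ω] [Algebra C Ω] (D : Subgroup G) (x : Ω) : Prop :=
  ∀ c ∈ FixF D C, ∃ t ∈ FixF D Ω, 1 + algebraMap C Ω c * x = t ^ 2

/-- The fixed field of a normal subgroup is stable under the group. -/
lemma smul_mem_FixF {G A : Type*} [Group G] [Field A] [MulSemiringAction G A] {D : Subgroup G}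
    [hD : D.Normal] (g : G) {y : A} (hy : y ∈ FixF D A) : g • y ∈ FixF D A := by
  refine mem_FixF.2 fun d hd => ?_
  have := smul_of_mem_FixF hy (hD.conj_mem d hd g⁻¹)
  rw [inv_inv, mul_smul, mul_smul, inv_smul_eq_iff] at this
  exact this

lemma squareCondition_smul {G C Ω : Type*} [Group G] [Field C] [Field Ω] [MulSemiringAction G C]
    [MulSemiringAction G Ω] [Algebra C Ω] [SMulDistribClass G C Ω] {D : Subgroup G} [D.Normal]
    (g : G) {x : Ω} (h : SquareCondition (C := C) D x) : SquareCondition (C := C) D (g • x) := by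
  intro c hc
  obtain ⟨t, ht, e⟩ := h (g⁻¹ • c) (smul_mem_FixF g⁻¹ hc)
  refine ⟨g • t, smul_mem_FixF g ht, ?_⟩
  rw [← smul_pow', ← e, smul_add, smul_one, smul_mul', smul_algebraMap_eq, smul_inv_smul]

lemma ValuationSubring.comap_valuation_lt_one_iff {K L : Type*} [Field K] [Field L]
    (R : ValuationSubring L) (f : K →+* L) (x : K) :
    (R.comap f).valuation x < 1 ↔ R.valuation (f x) < 1 := by
  rw [valuation_lt_one_iff_inv_notMem, valuation_lt_one_iff_inv_notMem, mem_comap, map_inv₀,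
    map_eq_zero]

namespace GaloisSetup

open MulAction

variable {G C Ω : Type*} [Group G] [TopologicalSpace G] [Field C] [Field Ω]
  [MulSemiringAction G C] [MulSemiringAction G Ω] [Algebra C Ω] [SMulDistribClass G C Ω]
  [IsAlgClosed C] [CharZero C] {w : AbsoluteValue C ℝ} {p ℓ : ℕ} [hp : Fact p.Prime]
  [hℓ : Fact ℓ.Prime] {ξ ζ : C} {D : Subgroup G} (S : GaloisSetup G C Ω w p)

/-- A valuation ring with constant residues which is stable under the group restricts to
fixed fields. -/
lemma hasConstantResidues_comap_subtype {O : ValuationSubring Ω} (hO : HasConstantResidues C O)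
    (hg : ∀ (g : G) x, x ∈ O → g • x ∈ O) (D : Subgroup G) :
    HasConstantResidues (FixF D C) (O.comap (FixF D Ω).subtype) where
  algebraMap_mem c := hO.algebraMap_mem c
  exists_sub_lt x hx := by
    obtain ⟨e, he⟩ := hO.exists_sub_lt _ hx
    have hfix : e ∈ FixF D C := by
      refine mem_FixF.2 fun g hgD => ?_
      have h0 : g • (x : Ω) = x := smul_of_mem_FixF x.2 hgD
      have h2 : O.valuation ((x : Ω) - algebraMap C Ω (g • e)) < 1 := by
        rw [O.valuation_lt_one_iff_inv_notMem] at he ⊢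
        have e1 : (x : Ω) - algebraMap C Ω (g • e) = g • ((x : Ω) - algebraMap C Ω e) := by
          rw [smul_sub, h0, smul_algebraMap_eq]
        rw [e1, smul_eq_zero_iff_eq]
        refine he.imp_right fun h h' => h ?_
        have := hg g⁻¹ _ h'
        rwa [← smul_inv'', inv_smul_smul] at this
      have h1 : O.valuation (algebraMap C Ω (g • e - e)) < 1 := by
        have e1 : algebraMap C Ω (g • e - e) =
            ((x : Ω) - algebraMap C Ω e) - ((x : Ω) - algebraMap C Ω (g • e)) := by
          rw [map_sub]; ring
        rw [e1]
        exact Valuation.map_sub_lt _ he h2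
      exact sub_eq_zero.1 (hO.eq_zero_of_lt h1)
    refine ⟨⟨e, hfix⟩, ?_⟩
    rw [ValuationSubring.comap_valuation_lt_one_iff]
    exact he

include S

lemma exists_not_sq (hD : IsOpen (D : Set G)) :
    ∃ π : FixF D C, ¬ ∃ t, algebraMap (FixF D C) (FixF D Ω) π = t ^ 2 := by
  obtain ⟨π, hπ, h0, h1, h⟩ := S.unif D hD
  refine ⟨⟨π, hπ⟩, fun ⟨t, ht⟩ => ?_⟩
  have hz : IsPrimitiveRoot (-1 : C) 2 := IsPrimitiveRoot.neg_one 0 (by norm_num)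
  obtain ⟨d, hd, rfl⟩ := exists_pow_of_map_eq_pow hz (neg_mem (one_mem _)) t.2
    (congrArg Subtype.val ht)
  rw [map_pow] at h0 h1 h
  have hd1 : w d < 1 := (pow_lt_one_iff_of_nonneg (w.nonneg _) two_ne_zero).1 h1
  have hd0 : 0 < w d := lt_of_le_of_ne (w.nonneg _) fun h' => by simp [← h'] at h0
  have := h d hd hd1
  nlinarith

lemma exists_sq_mul (D : Subgroup G) (x : FixF D Ω) (hx : x ≠ 0) :
    ∃ (c : FixF D C) (z : FixF D Ω), x = algebraMap _ _ c * z ^ 2 := by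
  obtain ⟨c, hc, z, hz, h⟩ := S.kummer D 2 two_pos x x.2 (by simpa using hx)
  exact ⟨⟨c, hc⟩, ⟨z, hz⟩, Subtype.ext h⟩

lemma valuation_lt_one_iff (hD : IsOpen (D : Set G)) {R : ValuationSubring (FixF D Ω)}
    (hR : HasConstantResidues (FixF D C) R) (x : FixF D Ω) :
    R.valuation x < 1 ↔ SquareCondition (C := C) D (x : Ω) := by
  obtain ⟨π, hπ⟩ := S.exists_not_sq (Ω := Ω) hD
  rw [hR.valuation_lt_one_iff (S.exists_sq_mul D) hπ]
  refine ⟨fun h c hc => ?_, fun h c => ?_⟩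
  · obtain ⟨t, ht⟩ := h ⟨c, hc⟩
    exact ⟨t, t.2, congrArg Subtype.val ht⟩
  · obtain ⟨t, ht, e⟩ := h c c.2
    exact ⟨⟨t, ht⟩, Subtype.ext e⟩

lemma mem_iff_squareCondition (hD : IsOpen (D : Set G)) {R : ValuationSubring (FixF D Ω)}
    (hR : HasConstantResidues (FixF D C) R) (x : FixF D Ω) :
    x ∈ R ↔ x = 0 ∨ ¬ SquareCondition (C := C) D (x : Ω)⁻¹ := by
  rw [R.mem_iff_inv_valuation_lt_one, S.valuation_lt_one_iff hD hR]
  rfl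

lemma hasConstantResidues_unique (hD : IsOpen (D : Set G)) {R R' : ValuationSubring (FixF D Ω)}
    (hR : HasConstantResidues (FixF D C) R) (hR' : HasConstantResidues (FixF D C) R') : R = R' := by
  ext x
  rw [S.mem_iff_squareCondition hD hR, S.mem_iff_squareCondition hD hR']

lemma comap_inclusion {D' : Subgroup G} [D'.Normal] (hle : D' ≤ D) (hD' : IsOpen (D' : Set G))
    {R : ValuationSubring (FixF D' Ω)} (hR : HasConstantResidues (FixF D' C) R) :
    HasConstantResidues (FixF D C) (R.comap (Subfield.inclusion (FixF_anti (A := Ω) hle))) where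
  algebraMap_mem c := by
    have := hR.algebraMap_mem ⟨c, FixF_anti hle c.2⟩
    exact this
  exists_sub_lt x hx := by
    obtain ⟨e, he⟩ := hR.exists_sub_lt _ hx
    have hfix : (e : C) ∈ FixF D C := by
      refine mem_FixF.2 fun g hg => ?_
      rw [S.valuation_lt_one_iff hD' hR] at he
      have he' := squareCondition_smul g he
      have h0 : g • (x : Ω) = x := smul_of_mem_FixF x.2 hg
      have h1 : R.valuation (algebraMap (FixF D' C) (FixF D' Ω) ⟨g • e, smul_mem_FixF g e.2⟩ -
          algebraMap (FixF D' C) (FixF D' Ω) e) < 1 := by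
        have e1 : algebraMap (FixF D' C) (FixF D' Ω) ⟨g • e, smul_mem_FixF g e.2⟩ -
            algebraMap (FixF D' C) (FixF D' Ω) e =
            (Subfield.inclusion (FixF_anti hle) x - algebraMap (FixF D' C) (FixF D' Ω) e) -
            (Subfield.inclusion (FixF_anti hle) x -
              algebraMap (FixF D' C) (FixF D' Ω) ⟨g • e, smul_mem_FixF g e.2⟩) := by
          ring
        rw [e1]
        refine Valuation.map_sub_lt _ ((S.valuation_lt_one_iff hD' hR _).2 he)
          ((S.valuation_lt_one_iff hD' hR _).2 ?_)
        convert he' using 1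
        change (x : Ω) - algebraMap C Ω (g • (e : C)) = g • ((x : Ω) - algebraMap C Ω e)
        rw [smul_sub, h0, smul_algebraMap_eq]
      rw [← map_sub] at h1
      exact congrArg Subtype.val (sub_eq_zero.1 (hR.eq_zero_of_lt h1))
    refine ⟨⟨e, hfix⟩, ?_⟩
    rw [ValuationSubring.comap_valuation_lt_one_iff]
    exact he

/-- There is at most one stable valuation ring with constant residues. -/
theorem valuationSubring_unique (hΩ : ∀ x : Ω, IsOpen (stabilizer G x : Set G))
    {O O' : ValuationSubring Ω} (hO : HasConstantResidues C O)
    (hg : ∀ (g : G) x, x ∈ O → g • x ∈ O) (hO' : HasConstantResidues C O')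
    (hg' : ∀ (g : G) x, x ∈ O' → g • x ∈ O') : O = O' := by
  ext x
  have hx : x ∈ FixF (stabilizer G x) Ω := mem_FixF.2 fun g hg => hg
  have := congrArg (fun R => (⟨x, hx⟩ : FixF (stabilizer G x) Ω) ∈ R)
    (S.hasConstantResidues_unique (hΩ x) (hasConstantResidues_comap_subtype hO hg _)
      (hasConstantResidues_comap_subtype hO' hg' _))
  exact Iff.of_eq this

/-- Existence of a stable valuation ring with constant residues. -/
theorem exists_valuationSubring (hΩ : ∀ x : Ω, IsOpen (stabilizer G x : Set G))
    (hN : ∀ U : Subgroup G, IsOpen (U : Set G) → ∃ V ≤ U, V.Normal ∧ IsOpen (V : Set G))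
    (hD : GoodSubgroup p ℓ ξ ζ D) :
    ∃ O : ValuationSubring Ω, HasConstantResidues C O ∧ ∀ (g : G) x, x ∈ O → g • x ∈ O := by
  let F : Subgroup G → Prop := fun D => GoodSubgroup p ℓ ξ ζ D ∧ D.Normal
  have hF : ∀ U : Subgroup G, IsOpen (U : Set G) → ∃ V ≤ U, F V := by
    intro U hU
    obtain ⟨V, hV, hVn, hVo⟩ := hN (U ⊓ D) (hU.inter hD.isOpen)
    have hVD := hV.trans inf_le_right
    exact ⟨V, hV.trans inf_le_left, { hD with
      isOpen := hVo
      xi_mem := FixF_anti hVD hD.xi_mem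
      zeta_mem := FixF_anti hVD hD.zeta_mem }, hVn⟩
  have hR : ∀ V, F V → ∃ R : ValuationSubring (FixF V Ω), HasConstantResidues (FixF V C) R := by
    intro V hV
    obtain ⟨R, h1, h2⟩ := S.exists_valuationSubring_fixed hV.1
    refine ⟨R, h1, fun x hx => ?_⟩
    simp only [R.valuation_lt_one_iff_inv_notMem]
    exact h2 x hx
  choose R hR using hR
  have hle : ∀ V (hV : F V) V' (hV' : F V') (hVV : V' ≤ V) (x : Ω) (hx : x ∈ FixF V Ω),
      (⟨x, hx⟩ : FixF V Ω) ∈ R V hV ↔ (⟨x, FixF_anti hVV hx⟩ : FixF V' Ω) ∈ R V' hV' := by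
    intro V hV V' hV' hVV x hx
    have := hV'.2
    rw [S.hasConstantResidues_unique hV.1.isOpen (hR V hV)
      (S.comap_inclusion hVV hV'.1.isOpen (hR V' hV'))]
    rfl
  have hiff : ∀ V (hV : F V) V' (hV' : F V') (x : Ω) (hx : x ∈ FixF V Ω) (hx' : x ∈ FixF V' Ω),
      (⟨x, hx⟩ : FixF V Ω) ∈ R V hV ↔ (⟨x, hx'⟩ : FixF V' Ω) ∈ R V' hV' := by
    intro V hV V' hV' x hx hx'
    obtain ⟨W, hW, hFW⟩ := hF (V ⊓ V') (hV.1.isOpen.inter hV'.1.isOpen)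
    rw [hle V hV W hFW (hW.trans inf_le_left), hle V' hV' W hFW (hW.trans inf_le_right)]
  have hex : ∀ x : Ω, ∃ V, F V ∧ x ∈ FixF V Ω := by
    intro x
    obtain ⟨V, hV, hFV⟩ := hF _ (hΩ x)
    exact ⟨V, hFV, mem_FixF.2 fun g hg => hV hg⟩
  have hex2 : ∀ x y : Ω, ∃ V, F V ∧ x ∈ FixF V Ω ∧ y ∈ FixF V Ω := by
    intro x y
    obtain ⟨V, hV, hFV⟩ := hF (stabilizer G x ⊓ stabilizer G y) ((hΩ x).inter (hΩ y))
    exact ⟨V, hFV, mem_FixF.2 fun g hg => (hV hg).1, mem_FixF.2 fun g hg => (hV hg).2⟩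
  let P : Ω → Prop := fun x => ∃ V, ∃ hV : F V, ∃ hx : x ∈ FixF V Ω, (⟨x, hx⟩ : FixF V Ω) ∈ R V hV
  have hP : ∀ V (hV : F V) (x : Ω) (hx : x ∈ FixF V Ω), P x ↔ (⟨x, hx⟩ : FixF V Ω) ∈ R V hV := by
    intro V hV x hx
    refine ⟨fun ⟨V', hV', hx', h⟩ => ?_, fun h => ⟨V, hV, hx, h⟩⟩
    rwa [hiff V hV V' hV' x hx hx']
  let O : ValuationSubring Ω :=
  { carrier := {x | P x}
    mul_mem' := fun {x y} hx hy => by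
      obtain ⟨V, hV, hxV, hyV⟩ := hex2 x y
      exact (hP V hV _ (mul_mem hxV hyV)).2 (mul_mem ((hP V hV x hxV).1 hx) ((hP V hV y hyV).1 hy))
    one_mem' := by
      obtain ⟨V, hV, h⟩ := hex 1
      exact (hP V hV _ h).2 (one_mem (R V hV))
    add_mem' := fun {x y} hx hy => by
      obtain ⟨V, hV, hxV, hyV⟩ := hex2 x y
      exact (hP V hV _ (add_mem hxV hyV)).2 (add_mem ((hP V hV x hxV).1 hx) ((hP V hV y hyV).1 hy))
    zero_mem' := by
      obtain ⟨V, hV, h⟩ := hex 0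
      exact (hP V hV _ h).2 (zero_mem (R V hV))
    neg_mem' := fun {x} hx => by
      obtain ⟨V, hV, h⟩ := hex x
      exact (hP V hV _ (neg_mem h)).2 (neg_mem ((hP V hV x h).1 hx))
    mem_or_inv_mem' := fun x => by
      obtain ⟨V, hV, h⟩ := hex x
      exact ((R V hV).mem_or_inv_mem ⟨x, h⟩).imp (hP V hV x h).2 (hP V hV _ (inv_mem h)).2 }
  have hO : ∀ V (hV : F V) (x : Ω) (hx : x ∈ FixF V Ω), x ∈ O ↔ (⟨x, hx⟩ : FixF V Ω) ∈ R V hV := hP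
  refine ⟨O, ⟨fun c => ?_, fun x hx => ?_⟩, fun g x hx => ?_⟩
  · obtain ⟨V, hV, h⟩ := hF _ (S.isOpen_stabilizer c)
    have hc : c ∈ FixF V C := mem_FixF.2 fun g hg => hV hg
    exact (hO V h _ (algebraMap_mem_FixF_iff.2 hc)).2 ((hR V h).algebraMap_mem ⟨c, hc⟩)
  · obtain ⟨V, hV, h⟩ := hex x
    obtain ⟨e, he⟩ := (hR V hV).exists_sub_lt _ ((hO V hV x h).1 hx)
    refine ⟨e, ?_⟩
    rw [ValuationSubring.valuation_lt_one_iff_inv_notMem] at he ⊢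
    have h1 : x - algebraMap C Ω e ∈ FixF V Ω := sub_mem h (algebraMap_mem_FixF_iff.2 e.2)
    rw [hO V hV _ (inv_mem h1)]
    exact he.imp_left (congrArg Subtype.val)
  · obtain ⟨V, hV, h⟩ := hex x
    have := hV.2
    rw [hO V hV _ h, S.mem_iff_squareCondition hV.1.isOpen (hR V hV)] at hx
    rw [hO V hV _ (smul_mem_FixF g h), S.mem_iff_squareCondition hV.1.isOpen (hR V hV)]
    refine hx.imp (fun h0 => Subtype.ext ?_) fun h0 h1 => h0 ?_
    · have h2 : x = 0 := congrArg Subtype.val h0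
      change g • x = 0
      rw [h2, smul_zero]
    · have h2 := squareCondition_smul g⁻¹ h1
      change SquareCondition (C := C) V (g⁻¹ • (g • x)⁻¹) at h2
      rwa [smul_inv'', inv_smul_smul] at h2

end GaloisSetup

/-- Kummer theory over fixed fields, up to constants: every fixed element of `Ω` is the product of a
fixed constant and an `n`-th power of a fixed element. -/
theorem exists_eq_mul_pow {k C Ω : Type*} [Field k] [Field C] [Algebra k C] [Field Ω]
    [Algebra C Ω] [MulSemiringAction (C ≃ₐ[k] C) Ω] [SMulDistribClass (C ≃ₐ[k] C) C Ω]
    [IsAlgClosed C] [IsAlgClosed Ω] [CharZero C]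
    (hΩ : ∀ y : Ω, IsOpen (MulAction.stabilizer (C ≃ₐ[k] C) y : Set (C ≃ₐ[k] C)))
    (D : Subgroup (C ≃ₐ[k] C)) {n : ℕ} (hn : 0 < n) {x : Ω} (hx : x ∈ FixF D Ω) (hx0 : x ≠ 0) :
    ∃ c ∈ FixF D C, ∃ z ∈ FixF D Ω, x = algebraMap C Ω c * z ^ n := by
  classical
  have : NeZero n := ⟨hn.ne'⟩
  have : NeZero (n : C) := ⟨Nat.cast_ne_zero.2 hn.ne'⟩
  obtain ⟨y, hy⟩ := IsAlgClosed.exists_pow_nat_eq x hn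
  have hy0 : y ≠ 0 := by
    rintro rfl
    rw [zero_pow hn.ne'] at hy
    exact hx0 hy.symm
  have := IsSepClosed.hasEnoughRootsOfUnity C n
  obtain ⟨ζ, hζ⟩ := HasEnoughRootsOfUnity.exists_primitiveRoot C n
  have key : ∀ g : C ≃ₐ[k] C, ∃ a : C, g ∈ D → a ^ n = 1 ∧ g • y = algebraMap C Ω a * y := by
    intro g
    by_cases hg : g ∈ D
    · obtain ⟨i, -, hi⟩ := (hζ.map_of_injective (algebraMap C Ω).injective).eq_pow_of_pow_eq_one
        (ξ := g • y / y)
        (by rw [div_pow, ← smul_pow', hy, smul_of_mem_FixF hx hg, div_self hx0])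
      refine ⟨ζ ^ i, fun _ => ⟨?_, ?_⟩⟩
      · rw [← pow_mul, mul_comm, pow_mul, hζ.pow_eq_one, one_pow]
      · rw [map_pow, hi, div_mul_cancel₀ _ hy0]
    · exact ⟨0, fun h => absurd h hg⟩
  choose a ha using key
  have ha0 : ∀ g ∈ D, a g ≠ 0 := fun g hg h0 => by
    have := (ha g hg).1
    rw [h0, zero_pow hn.ne'] at this
    exact zero_ne_one this
  have hinj : ∀ {c d : C}, algebraMap C Ω c * y = algebraMap C Ω d * y → c = d := fun h =>
    (algebraMap C Ω).injective (mul_right_cancel₀ hy0 h)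
  have hmul : ∀ g ∈ D, ∀ h ∈ D, a (g * h) = a g * g (a h) := by
    intro g hg h hh
    apply hinj
    rw [← (ha _ (mul_mem hg hh)).2, mul_smul, (ha h hh).2, smul_mul', smul_algebraMap_eq, (ha g hg).2,
      map_mul, AlgEquiv.smul_def]
    ring
  obtain ⟨E, hE, hEy⟩ := (krullTopology_mem_nhds_one_iff k C _).1
    ((hΩ y).mem_nhds (one_mem (MulAction.stabilizer (C ≃ₐ[k] C) y)))
  have hEa : ∀ g ∈ D, ∀ h ∈ D, (∀ e : E, g e = h e) → a g = a h := by
    intro g hg h hh hgh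
    apply hinj
    rw [← (ha g hg).2, ← (ha h hh).2]
    have h1 : g⁻¹ * h ∈ E.fixingSubgroup := by
      rw [IntermediateField.mem_fixingSubgroup_iff]
      intro e he
      rw [AlgEquiv.mul_apply, ← hgh ⟨e, he⟩]
      exact g.symm_apply_apply e
    have h2 : (g⁻¹ * h) • y = y := hEy h1
    rw [mul_smul, inv_smul_eq_iff] at h2
    exact h2.symm
  let res : (C ≃ₐ[k] C) → (E →ₐ[k] C) := fun g => (g : C →ₐ[k] C).comp E.val
  have hres : ∀ g (e : E), res g e = g e := fun _ _ => rfl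
  let _ : Fintype (E →ₐ[k] C) := minpoly.AlgHom.fintype k E C
  let Φ : Finset (E →ₐ[k] C) := Finset.univ.filter fun φ => ∃ g ∈ D, φ = res g
  have hΦ : ∀ φ, φ ∈ Φ ↔ ∃ g ∈ D, φ = res g := fun φ => by simp [Φ]
  have hlift : ∀ φ, ∃ g, φ ∈ Φ → g ∈ D ∧ φ = res g := by
    intro φ
    by_cases h : φ ∈ Φ
    · obtain ⟨g, hg⟩ := (hΦ φ).1 h
      exact ⟨g, fun _ => hg⟩
    · exact ⟨1, fun h' => absurd h' h⟩
  choose l hl using hlift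
  have hal : ∀ g ∈ D, a (l (res g)) = a g := by
    intro g hg
    have := hl (res g) ((hΦ _).2 ⟨g, hg, rfl⟩)
    refine hEa _ this.1 _ hg fun e => ?_
    rw [← hres, ← this.2, hres]
  have hli : LinearIndependent C fun φ : E →ₐ[k] C => (φ : E → C) := by
    have h := linearIndependent_monoidHom E C
    exact h.comp (fun φ : E →ₐ[k] C => (φ : E →* C)) fun φ ψ h => AlgHom.ext fun e =>
      DFunLike.congr_fun h e
  obtain ⟨b, hb⟩ : ∃ b : E, ∑ φ ∈ Φ, (a (l φ))⁻¹ * φ b ≠ 0 := by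
    by_contra! hcon
    have h1 := linearIndependent_iff'.1 hli Φ (fun φ => (a (l φ))⁻¹) (by
      ext e
      simpa using hcon e)
    have h2 : res 1 ∈ Φ := (hΦ _).2 ⟨1, one_mem _, rfl⟩
    exact inv_ne_zero (ha0 _ (hl _ h2).1) (h1 _ h2)
  set u := ∑ φ ∈ Φ, (a (l φ))⁻¹ * φ b with hu
  have hgu : ∀ g ∈ D, g u = a g * u := by
    intro g hg
    rw [hu, map_sum, Finset.mul_sum]
    refine Finset.sum_bij (fun φ _ => res (g * l φ)) (fun φ hφ => ?_) (fun φ hφ ψ hψ h => ?_)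
      (fun φ hφ => ?_) (fun φ hφ => ?_)
    · exact (hΦ _).2 ⟨_, mul_mem hg (hl φ hφ).1, rfl⟩
    · rw [(hl φ hφ).2, (hl ψ hψ).2]
      refine AlgHom.ext fun e => g.injective ?_
      exact DFunLike.congr_fun h e
    · obtain ⟨h, hh, rfl⟩ := (hΦ φ).1 hφ
      have h1 : res (g⁻¹ * h) ∈ Φ := (hΦ _).2 ⟨_, mul_mem (inv_mem hg) hh, rfl⟩
      refine ⟨_, h1, AlgHom.ext fun e => ?_⟩
      rw [hres, AlgEquiv.mul_apply, ← hres (l _), ← (hl _ h1).2, hres, hres, AlgEquiv.mul_apply]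
      exact g.apply_symm_apply _
    · have h1 := (hl φ hφ).1
      rw [hal _ (mul_mem hg h1), hmul g hg _ h1, map_mul, map_inv₀, hres, AlgEquiv.mul_apply,
        ← hres (l φ), ← (hl φ hφ).2, mul_inv, ← mul_assoc, mul_inv_cancel_left₀ (ha0 g hg)]
  have hu' : algebraMap C Ω u ≠ 0 := by simpa using hb
  refine ⟨u ^ n, mem_FixF.2 fun g hg => ?_, y / algebraMap C Ω u, mem_FixF.2 fun g hg => ?_, ?_⟩
  · rw [AlgEquiv.smul_def, map_pow, hgu g hg, mul_pow, (ha g hg).1, one_mul]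
  · rw [smul_div₀', smul_algebraMap_eq, AlgEquiv.smul_def, hgu g hg, (ha g hg).2, map_mul]
    have : algebraMap C Ω (a g) ≠ 0 := by simpa using ha0 g hg
    field_simp
  · rw [div_pow, map_pow, hy]
    field_simp

section LocallyCompact

variable {F C : Type*} [NontriviallyNormedField F] [LocallyCompactSpace F] [NormedField C]
  [NormedSpace F C] (V : Submodule F C) [FiniteDimensional F V]

include F V

lemma exists_norm_max [IsUltrametricDist C] {a : C} (ha : a ∈ V) (h0 : 0 < ‖a‖) (h1 : ‖a‖ < 1) :
    ∃ π ∈ V, 0 < ‖π‖ ∧ ‖π‖ < 1 ∧ ∀ x ∈ V, ‖x‖ < 1 → ‖x‖ ≤ ‖π‖ := by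
  have : ProperSpace V := FiniteDimensional.proper F V
  have hcl : IsClosed {x : V | ‖(x : C)‖ < 1} := by
    have h := (IsUltrametricDist.isClosed_ball (0 : C) 1).preimage (continuous_subtype_val (p := (· ∈ V)))
    convert h using 1
    ext x
    simp
  have hc : IsCompact {x : V | ‖(x : C)‖ < 1} := by
    refine (isCompact_closedBall (0 : V) 1).of_isClosed_subset hcl fun x hx => ?_
    rw [mem_closedBall_zero_iff]
    exact le_of_lt hx
  obtain ⟨π, hπ, hmax⟩ := hc.exists_isMaxOn ⟨⟨a, ha⟩, h1⟩
    (f := fun x : V => ‖(x : C)‖) (by fun_prop)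
  exact ⟨π, π.2, h0.trans_le (hmax (a := ⟨a, ha⟩) h1), hπ, fun x hx hx1 => hmax (a := ⟨x, hx⟩) hx1⟩

lemma exists_finite_cover : ∃ T : Set C, T.Finite ∧
    ∀ x ∈ V, ‖x‖ ≤ 1 → ∃ t ∈ T, t ∈ V ∧ ‖t‖ ≤ 1 ∧ ‖x - t‖ < 1 := by
  have : ProperSpace V := FiniteDimensional.proper F V
  obtain ⟨T, hT1, hT2, hT⟩ := (isCompact_closedBall (0 : V) 1).finite_cover_balls one_pos
  refine ⟨Subtype.val '' T, hT2.image _, fun x hx hx1 => ?_⟩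
  have h1 := hT (show (⟨x, hx⟩ : V) ∈ _ by rw [mem_closedBall_zero_iff]; exact hx1)
  simp only [Set.mem_iUnion, Metric.mem_ball, exists_prop] at h1
  obtain ⟨t, ht, h⟩ := h1
  rw [dist_eq_norm] at h
  have h2 := hT1 ht
  rw [mem_closedBall_zero_iff] at h2
  exact ⟨t, ⟨t, ht, rfl⟩, t.2, h2, h⟩

lemma exists_limit [IsUltrametricDist C] {r : ℝ} (h0 : 0 < r) (h1 : r < 1) (u : ℕ → C)
    (hu : ∀ n, u n ∈ V) (hr : ∀ n, ‖u (n + 1) - u n‖ ≤ r ^ n) :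
    ∃ a ∈ V, ∀ n, ‖a - u n‖ ≤ r ^ n := by
  have : ProperSpace V := FiniteDimensional.proper F V
  have hle : ∀ n m, ‖u (n + m) - u n‖ ≤ r ^ n := by
    intro n m
    induction m with
    | zero => simp [h0.le]
    | succ m ih =>
      rw [← sub_add_sub_cancel _ (u (n + m))]
      refine (IsUltrametricDist.norm_add_le_max _ _).trans (max_le ?_ ih)
      exact (hr (n + m)).trans (pow_le_pow_of_le_one h0.le h1.le (Nat.le_add_right _ _))
  let v : ℕ → V := fun n => ⟨u n, hu n⟩
  have hv : CauchySeq v := by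
    refine cauchySeq_of_le_geometric r 1 h1 fun n => ?_
    rw [one_mul, dist_comm, dist_eq_norm]
    exact hr n
  obtain ⟨a, ha⟩ := cauchySeq_tendsto_of_complete hv
  refine ⟨a, a.2, fun n => ?_⟩
  have h2 : Filter.Tendsto (fun m => ‖u (n + m) - u n‖) Filter.atTop (nhds ‖(a : C) - u n‖) := by
    have h3 : Filter.Tendsto (fun m => u (n + m)) Filter.atTop (nhds (a : C)) := by
      have h4 := (continuous_subtype_val.tendsto a).comp ha
      simp only [add_comm n]
      exact h4.comp (Filter.tendsto_add_atTop_nat n)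
    exact (h3.sub_const _).norm
  exact le_of_tendsto h2 (Filter.Eventually.of_forall fun m => hle n m)

end LocallyCompact

/-- The Galois group of a `p`-adic field acting on an extension of its algebraic closure. -/
theorem exists_galoisSetup {p : ℕ} [Fact p.Prime] {k C Ω : Type*} [Field k] [Algebra ℚ_[p] k]
    [FiniteDimensional ℚ_[p] k] [Field C] [Algebra k C] [Algebra.IsAlgebraic k C] [Field Ω]
    [Algebra C Ω] [MulSemiringAction (C ≃ₐ[k] C) Ω] [SMulDistribClass (C ≃ₐ[k] C) C Ω]
    [IsAlgClosed C] [IsAlgClosed Ω] [CharZero C]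
    (hΩ : ∀ y : Ω, IsOpen (MulAction.stabilizer (C ≃ₐ[k] C) y : Set (C ≃ₐ[k] C))) :
    ∃ w : AbsoluteValue C ℝ, GaloisSetup (C ≃ₐ[k] C) C Ω w p := by
  let _ : Algebra ℚ_[p] C := ((algebraMap k C).comp (algebraMap ℚ_[p] k)).toAlgebra
  have : IsScalarTower ℚ_[p] k C := IsScalarTower.of_algebraMap_eq fun _ => rfl
  have : Algebra.IsAlgebraic ℚ_[p] C := Algebra.IsAlgebraic.trans ℚ_[p] k C
  have : CharZero k := charZero_of_injective_algebraMap (algebraMap ℚ_[p] k).injective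
  have : IsAlgClosure k C := ⟨inferInstance, inferInstance⟩
  have : IsGalois k C := IsAlgClosure.isGalois k C
  let _ : NormedField C := spectralNorm.normedField ℚ_[p] C
  let _ : NormedSpace ℚ_[p] C := spectralNorm.normedSpace ℚ_[p] C
  have hnorm : ∀ x : C, ‖x‖ = spectralNorm ℚ_[p] C x := fun _ => rfl
  have hult : ∀ x y : C, ‖x + y‖ ≤ max ‖x‖ ‖y‖ := isNonarchimedean_spectralNorm
  have : IsUltrametricDist C := IsUltrametricDist.isUltrametricDist_of_forall_norm_add_le_max_norm hult
  have hnat : ∀ n : ℕ, ‖(n : C)‖ = ‖(n : ℚ_[p])‖ := fun n => by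
    rw [hnorm, ← map_natCast (algebraMap ℚ_[p] C), spectralNorm_extends]
  let w : AbsoluteValue C ℝ :=
  { toFun := fun x => ‖x‖
    map_mul' := norm_mul
    nonneg' := norm_nonneg
    eq_zero' := fun _ => norm_eq_zero
    add_le' := norm_add_le }
  have hw : ∀ x, w x = ‖x‖ := fun _ => rfl
  have hV : ∀ D : Subgroup (C ≃ₐ[k] C), IsOpen (D : Set (C ≃ₐ[k] C)) → ∃ V : Submodule ℚ_[p] C,
      FiniteDimensional ℚ_[p] V ∧ ∀ x, x ∈ V ↔ x ∈ FixF D C := by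
    intro D hD
    obtain ⟨E, hE, hED⟩ := (krullTopology_mem_nhds_one_iff k C _).1 (hD.mem_nhds (one_mem D))
    let V : Submodule ℚ_[p] C :=
    { carrier := FixF D C
      add_mem' := add_mem
      zero_mem' := zero_mem (FixF D C)
      smul_mem' := fun c x hx => by
        rw [Algebra.smul_def]
        refine mul_mem (mem_FixF.2 fun g hg => ?_) hx
        rw [IsScalarTower.algebraMap_apply ℚ_[p] k C, AlgEquiv.smul_def, AlgEquiv.commutes] }
    have hle : V ≤ (E.toSubalgebra.toSubmodule).restrictScalars ℚ_[p] := by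
      intro x hx
      have hx' : x ∈ FixF D C := hx
      change x ∈ E
      rw [← InfiniteGalois.fixedField_fixingSubgroup E, IntermediateField.mem_fixedField_iff]
      exact fun g hg => smul_of_mem_FixF hx' (hED hg)
    have hfin : FiniteDimensional ℚ_[p] E := Module.Finite.trans k E
    have hfin' : FiniteDimensional ℚ_[p] ((E.toSubalgebra.toSubmodule).restrictScalars ℚ_[p]) := hfin
    exact ⟨V, Submodule.finiteDimensional_of_le hle, fun x => Iff.rfl⟩
  have hp1 : ‖(p : C)‖ < 1 := by
    rw [hnat]
    exact Padic.norm_p_lt_one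
  exact ⟨w,
  { add_le := hult
    w_smul := fun g x => by
      rw [hw, hw, hnorm, hnorm]
      exact (spectralNorm_eq_of_equiv (g.restrictScalars ℚ_[p]) x).symm
    w_p := hp1
    w_coprime := fun n hn => by
      rw [hw, hnat, Padic.norm_natCast_eq_one_iff]
      exact hn.symm
    isOpen_stabilizer := fun c => by
      convert hΩ (algebraMap C Ω c) using 1
      ext g
      simp [MulAction.mem_stabilizer_iff, smul_algebraMap_eq]
    kummer := fun D n hn x hx hx0 => exists_eq_mul_pow hΩ D hn hx hx0
    unif := fun D hD => by
      obtain ⟨V, _, hV⟩ := hV D hD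
      simp only [← hV]
      have hp0 : (p : C) ≠ 0 := Nat.cast_ne_zero.2 (Fact.out : p.Prime).ne_zero
      exact exists_norm_max V ((hV _).2 (natCast_mem _ p)) (norm_pos_iff.2 hp0) hp1
    finite := fun D hD => by
      obtain ⟨V, _, hV⟩ := hV D hD
      simp only [← hV]
      exact exists_finite_cover V
    complete := fun D hD π _ h0 h1 u hu hr => by
      obtain ⟨V, _, hV⟩ := hV D hD
      simp only [← hV] at hu ⊢
      exact exists_limit V h0 h1 u hu hr }⟩

/-- A Galois action extending the one on the algebraic closure of a `p`-adic field stabilizes a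
unique valuation ring with residue field that algebraic closure. -/
theorem existsUnique_hasConstantResidues {p : ℕ} [Fact p.Prime] {k C Ω : Type*} [Field k]
    [Algebra ℚ_[p] k] [FiniteDimensional ℚ_[p] k] [Field C] [Algebra k C]
    [Algebra.IsAlgebraic k C] [Field Ω] [Algebra C Ω] [MulSemiringAction (C ≃ₐ[k] C) Ω]
    [SMulDistribClass (C ≃ₐ[k] C) C Ω] [IsAlgClosed C] [IsAlgClosed Ω] [CharZero C]
    (hΩ : ∀ y : Ω, IsOpen (MulAction.stabilizer (C ≃ₐ[k] C) y : Set (C ≃ₐ[k] C))) :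
    ∃! O : ValuationSubring Ω, HasConstantResidues C O ∧
      ∀ (g : C ≃ₐ[k] C) x, x ∈ O → g • x ∈ O := by
  have hp : p.Prime := Fact.out
  have : CharZero k := charZero_of_injective_algebraMap (algebraMap ℚ_[p] k).injective
  have : IsAlgClosure k C := ⟨inferInstance, inferInstance⟩
  have : IsGalois k C := IsAlgClosure.isGalois k C
  obtain ⟨w, S⟩ := exists_galoisSetup (p := p) hΩ
  obtain ⟨ℓ, hℓp, hℓ⟩ := Nat.exists_infinite_primes (p + 3)
  have : Fact ℓ.Prime := ⟨hℓ⟩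
  have : NeZero ((ℓ ^ 4 : ℕ) : C) := ⟨Nat.cast_ne_zero.2 (pow_ne_zero 4 hℓ.ne_zero)⟩
  have : NeZero (p : C) := ⟨Nat.cast_ne_zero.2 hp.ne_zero⟩
  have := IsSepClosed.hasEnoughRootsOfUnity C (ℓ ^ 4)
  have := IsSepClosed.hasEnoughRootsOfUnity C p
  obtain ⟨ξ, hξ⟩ := HasEnoughRootsOfUnity.exists_primitiveRoot C (ℓ ^ 4)
  obtain ⟨ζ, hζ⟩ := HasEnoughRootsOfUnity.exists_primitiveRoot C p
  have hN : ∀ U : Subgroup (C ≃ₐ[k] C), IsOpen (U : Set (C ≃ₐ[k] C)) →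
      ∃ V ≤ U, V.Normal ∧ IsOpen (V : Set (C ≃ₐ[k] C)) := by
    intro U hU
    obtain ⟨E, hE, hEn, hEU⟩ := (krullTopology_mem_nhds_one_iff_of_normal k C _).1
      (hU.mem_nhds (one_mem U))
    refine ⟨E.fixingSubgroup, hEU, ?_, E.fixingSubgroup_isOpen⟩
    rw [← IntermediateField.restrictNormalHom_ker]
    infer_instance
  have hD : GoodSubgroup p ℓ ξ ζ
      (MulAction.stabilizer (C ≃ₐ[k] C) ξ ⊓ MulAction.stabilizer (C ≃ₐ[k] C) ζ) :=
  { isOpen := (S.isOpen_stabilizer ξ).inter (S.isOpen_stabilizer ζ)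
    three_le := by omega
    coprime := (Nat.coprime_primes hℓ hp).2 (by omega)
    prim_xi := hξ
    prim_zeta := hζ
    xi_mem := mem_FixF.2 fun g hg => hg.1
    zeta_mem := mem_FixF.2 fun g hg => hg.2 }
  obtain ⟨O, hO, hg⟩ := S.exists_valuationSubring hΩ hN hD
  exact ⟨O, ⟨hO, hg⟩, fun O' h => S.valuationSubring_unique hΩ h.1 h.2 hO hg⟩

section AlgebraicResidues

open Polynomial

variable {C Ω : Type*} [Field C] [Field Ω] [Algebra C Ω] {O : ValuationSubring Ω}

lemma exists_valuation_sub_lt_one [IsAlgClosed C] {P : C[X]} (hP : P ≠ 0)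
    (hO : ∀ c, algebraMap C Ω c ∈ O) {x : Ω} (hx : O.valuation (aeval x P) < 1) :
    ∃ d, O.valuation (x - algebraMap C Ω d) < 1 := by
  by_contra! hcon
  refine hx.not_ge ?_
  have h1 := (IsAlgClosed.splits P).eq_prod_roots
  rw [h1, map_mul, aeval_C, map_mul]
  refine Left.one_le_mul ?_ ?_
  · have h2 := (O.valuation_le_one_iff _).2 (hO P.leadingCoeff⁻¹)
    rw [map_inv₀, map_inv₀] at h2
    refine (inv_le_one₀ (zero_lt_iff.2 ?_)).1 h2
    simpa using hP
  · rw [map_multiset_prod, map_multiset_prod, Multiset.map_map, Multiset.map_map]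
    refine Multiset.one_le_prod fun y hy => ?_
    obtain ⟨d, -, rfl⟩ := Multiset.mem_map.1 hy
    simpa using hcon d

/-- If the elements of `O ∩ K` have constant residues and `Ω` is algebraic over `K`, then all
elements of `O` have constant residues. -/
lemma hasConstantResidues_of_isAlgebraic [IsAlgClosed C] {K : Type*} [Field K] [Algebra K Ω]
    [Algebra.IsAlgebraic K Ω] (hO : ∀ c, algebraMap C Ω c ∈ O)
    (hK : ∀ a : K, algebraMap K Ω a ∈ O → ∃ d, O.valuation (algebraMap K Ω a - algebraMap C Ω d) < 1) :
    HasConstantResidues C O := by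
  refine ⟨hO, fun x hx => ?_⟩
  obtain ⟨q, hq, hqx⟩ := Algebra.IsAlgebraic.isAlgebraic (R := K) x
  obtain ⟨j, hj, hmax⟩ := q.support.exists_max_image
    (fun i => O.valuation (algebraMap K Ω (q.coeff i))) (nonempty_support_iff.2 hq)
  have hj0 : q.coeff j ≠ 0 := mem_support_iff.1 hj
  have hb : ∀ i, algebraMap K Ω (q.coeff i / q.coeff j) ∈ O := by
    intro i
    by_cases hi : i ∈ q.support
    · rw [← O.valuation_le_one_iff, map_div₀, map_div₀]
      exact div_le_one_of_le₀ (hmax i hi) zero_le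
    · rw [notMem_support_iff.1 hi, zero_div, map_zero]
      exact zero_mem _
  choose c hc using fun i => hK _ (hb i)
  set P : C[X] := ∑ i ∈ q.support, monomial i (c i) with hP
  have hP0 : P ≠ 0 := by
    intro h0
    have h1 : P.coeff j = c j := by
      rw [hP, finsetSum_coeff]
      simp only [coeff_monomial]
      rw [Finset.sum_ite_eq' q.support j]
      exact if_pos hj
    have h2 := hc j
    rw [← h1, h0, coeff_zero, div_self hj0] at h2
    simp at h2
  refine exists_valuation_sub_lt_one hP0 hO ?_
  have h1 : ∑ i ∈ q.support, algebraMap K Ω (q.coeff i / q.coeff j) * x ^ i = 0 := by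
    have h2 : aeval x q = ∑ i ∈ q.support, algebraMap K Ω (q.coeff i) * x ^ i := by
      rw [aeval_eq_sum_range' (Nat.lt_succ_self _), ← Finset.sum_subset (s₁ := q.support)]
      · simp only [Algebra.smul_def]
      · exact fun i hi => Finset.mem_range_succ_iff.2 (le_natDegree_of_mem_supp i hi)
      · intro i _ hi
        rw [notMem_support_iff.1 hi, zero_smul]
    rw [hqx] at h2
    simp only [map_div₀, div_mul_eq_mul_div]
    rw [← Finset.sum_div, ← h2, zero_div]
  have h3 : aeval x P = -∑ i ∈ q.support,
      (algebraMap K Ω (q.coeff i / q.coeff j) - algebraMap C Ω (c i)) * x ^ i := by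
    simp only [sub_mul]
    rw [Finset.sum_sub_distrib, h1, hP, map_sum]
    simp [aeval_monomial]
  rw [h3, Valuation.map_neg]
  refine Valuation.map_sum_lt' _ one_pos fun i _ => ?_
  rw [map_mul, map_pow, mul_comm]
  exact (mul_le_of_le_one_left' (pow_le_one' ((O.valuation_le_one_iff _).2 hx) i)).trans_lt (hc i)

end AlgebraicResidues

section BirationalSection

variable {k F Ω : Type*} [Field k] [Field F] [Field Ω] [Algebra k F] [Algebra F Ω] [Algebra k Ω]
  [IsScalarTower k F Ω] [IsAlgClosed Ω]

lemma algebraMap_apply_of_section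
    {s : (algebraicClosure k Ω ≃ₐ[k] algebraicClosure k Ω) →* (Ω ≃ₐ[F] Ω)}
    (hs : ∀ g, resHom k F Ω (s g) = g) (g : algebraicClosure k Ω ≃ₐ[k] algebraicClosure k Ω)
    (c : algebraicClosure k Ω) : s g (algebraMap _ Ω c) = algebraMap _ Ω (g c) := by
  conv_rhs => rw [← hs g]
  exact (AlgEquiv.restrictNormal_commutes ((s g).restrictScalars k) (algebraicClosure k Ω) c).symm

lemma smulDistribClass_of_section
    {s : (algebraicClosure k Ω ≃ₐ[k] algebraicClosure k Ω) →* (Ω ≃ₐ[F] Ω)}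
    (hs : ∀ g, resHom k F Ω (s g) = g) :
    let _ : MulSemiringAction (algebraicClosure k Ω ≃ₐ[k] algebraicClosure k Ω) Ω :=
      MulSemiringAction.compHom Ω s
    SMulDistribClass (algebraicClosure k Ω ≃ₐ[k] algebraicClosure k Ω)
      (algebraicClosure k Ω) Ω := by
  intro _
  refine ⟨fun g c x => ?_⟩
  rw [Algebra.smul_def, Algebra.smul_def, smul_mul']
  exact congrArg (· * _) (algebraMap_apply_of_section hs g c)

lemma residueEmbedHom_eq_residue_iff {O : ValuationSubring F} (h : ∀ a : k, algebraMap k F a ∈ O)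
    (c : k) (a : O) :
    residueEmbedHom O h c = IsLocalRing.residue O a ↔ O.valuation (a - algebraMap k F c) < 1 := by
  rw [eq_comm, residueEmbedHom, RingHom.comp_apply, ← sub_eq_zero, ← map_sub,
    IsLocalRing.residue_eq_zero_iff, ValuationSubring.valuation_lt_one_iff]
  rfl

omit [IsAlgClosed Ω] in
lemma algebraMap_algebraicClosure_mem {O : ValuationSubring Ω} (hk : ∀ a : k, algebraMap k Ω a ∈ O)
    (c : algebraicClosure k Ω) : algebraMap _ Ω c ∈ O := by
  let f : k →+* O := (algebraMap k Ω).codRestrict O.toSubring hk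
  obtain ⟨q, hq, hqc⟩ := ((mem_algebraicClosure_iff.1 c.2).isIntegral : IsIntegral k (c : Ω))
  have : IsIntegral O (c : Ω) := by
    refine ⟨q.map f, hq.map f, ?_⟩
    rw [Polynomial.eval₂_map]
    exact hqc
  obtain ⟨y, hy⟩ := IsIntegrallyClosed.isIntegral_iff.1 this
  rw [show algebraMap (algebraicClosure k Ω) Ω c = (c : Ω) from rfl, ← hy]
  exact y.2

variable [Algebra.IsAlgebraic F Ω]

/-- An algebraic residue field downstairs forces constant residues upstairs. -/
lemma hasConstantResidues_of_isIntegralElem {O : ValuationSubring Ω}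
    (hk : ∀ a : k, algebraMap k Ω a ∈ O)
    (hkF : ∀ a : k, algebraMap k F a ∈ O.comap (algebraMap F Ω))
    (h : ∀ y, (residueEmbedHom (O.comap (algebraMap F Ω)) hkF).IsIntegralElem y) :
    HasConstantResidues (algebraicClosure k Ω) O := by
  have : IsAlgClosed (algebraicClosure k Ω) := (algebraicClosure.isAlgClosure k Ω).isAlgClosed
  have hC := algebraMap_algebraicClosure_mem hk
  refine hasConstantResidues_of_isAlgebraic (K := F) hC fun a ha => ?_
  let a' : O.comap (algebraMap F Ω) := ⟨a, ha⟩
  obtain ⟨q, hq, hqa⟩ := h (IsLocalRing.residue _ a')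
  refine exists_valuation_sub_lt_one (P := q.map (algebraMap k _))
    (hq.map (algebraMap k (algebraicClosure k Ω))).ne_zero hC ?_
  rw [residueEmbedHom, ← Polynomial.hom_eval₂, IsLocalRing.residue_eq_zero_iff,
    ValuationSubring.valuation_lt_one_iff, ValuationSubring.comap_valuation_lt_one_iff] at hqa
  convert hqa using 2
  rw [Polynomial.aeval_map_algebraMap, Polynomial.aeval_def,
    ← ValuationSubring.subtype_apply, Polynomial.hom_eval₂, Polynomial.hom_eval₂]
  congr 1
  ext c
  exact IsScalarTower.algebraMap_apply k F Ω c

omit [Algebra.IsAlgebraic F Ω] in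
/-- Constant residues, descended along a section, identify the residue field downstairs. -/
lemma residueEmbedHom_bijective_of_section [CharZero k]
    {s : (algebraicClosure k Ω ≃ₐ[k] algebraicClosure k Ω) →* (Ω ≃ₐ[F] Ω)}
    (hs : ∀ g, resHom k F Ω (s g) = g) {O : ValuationSubring Ω}
    (hO : HasConstantResidues (algebraicClosure k Ω) O) (hg : ∀ g, ∀ x ∈ O, s g x ∈ O)
    (hkF : ∀ a : k, algebraMap k F a ∈ O.comap (algebraMap F Ω)) :
    Function.Bijective (residueEmbedHom (O.comap (algebraMap F Ω)) hkF) := by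
  refine ⟨RingHom.injective _, fun y => ?_⟩
  obtain ⟨a, rfl⟩ := IsLocalRing.residue_surjective y
  have hC : IsAlgClosure k (algebraicClosure k Ω) := algebraicClosure.isAlgClosure k Ω
  have : IsAlgClosed (algebraicClosure k Ω) := hC.isAlgClosed
  have : IsGalois k (algebraicClosure k Ω) := IsAlgClosure.isGalois k _
  have : CharZero (algebraicClosure k Ω) :=
    charZero_of_injective_algebraMap (algebraMap k _).injective
  let _ : MulSemiringAction (algebraicClosure k Ω ≃ₐ[k] algebraicClosure k Ω) Ω :=
    MulSemiringAction.compHom Ω s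
  have := smulDistribClass_of_section hs
  let _ : TopologicalSpace (algebraicClosure k Ω ≃ₐ[k] algebraicClosure k Ω) := krullTopology _ _
  have H := GaloisSetup.hasConstantResidues_comap_subtype hO hg ⊤
  obtain ⟨e, he⟩ := H.exists_sub_lt
    ⟨algebraMap F Ω a, mem_FixF.2 fun g _ => (s g).commutes a⟩ a.2
  obtain ⟨c, hc⟩ := IntermediateField.mem_bot.1 ((InfiniteGalois.mem_bot_iff_fixed
    (e : algebraicClosure k Ω)).2 fun g => mem_FixF.1 e.2 g trivial)
  refine ⟨c, (residueEmbedHom_eq_residue_iff hkF c a).2 ?_⟩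
  rw [ValuationSubring.comap_valuation_lt_one_iff] at he ⊢
  convert he using 2
  rw [map_sub, map_sub, ← IsScalarTower.algebraMap_apply k F Ω,
    IsScalarTower.algebraMap_apply k (algebraicClosure k Ω) Ω, hc]
  rfl

/-- The conditions on a valuation ring in terms of the residue field of its restriction are
equivalent to having constant residues. -/
lemma isIntegralElem_and_stable_iff [CharZero k]
    {s : (algebraicClosure k Ω ≃ₐ[k] algebraicClosure k Ω) →* (Ω ≃ₐ[F] Ω)}
    (hs : ∀ g, resHom k F Ω (s g) = g) (O : ValuationSubring Ω) :
    (∃ hk : ∀ a : k, algebraMap k Ω a ∈ O, (∀ g, ∀ x : Ω, x ∈ O ↔ s g x ∈ O) ∧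
      ∀ y : IsLocalRing.ResidueField (O.comap (algebraMap F Ω)),
        (residueEmbedHom (O.comap (algebraMap F Ω)) (fun a => by
          rw [ValuationSubring.mem_comap, ← IsScalarTower.algebraMap_apply k F Ω]
          exact hk a)).IsIntegralElem y) ↔
    HasConstantResidues (algebraicClosure k Ω) O ∧ ∀ g, ∀ x ∈ O, s g x ∈ O := by
  constructor
  · rintro ⟨hk, hg, h⟩
    exact ⟨hasConstantResidues_of_isIntegralElem hk _ h, fun g x => (hg g x).1⟩
  · rintro ⟨hO, hg⟩
    have hk : ∀ a : k, algebraMap k Ω a ∈ O := fun a => by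
      rw [IsScalarTower.algebraMap_apply k (algebraicClosure k Ω) Ω]
      exact hO.algebraMap_mem _
    refine ⟨hk, fun g x => ⟨hg g x, fun h => ?_⟩, fun y => ?_⟩
    · have h1 := hg g⁻¹ _ h
      rwa [← AlgEquiv.mul_apply, ← map_mul, inv_mul_cancel, map_one] at h1
    · obtain ⟨c, hc⟩ := (residueEmbedHom_bijective_of_section hs hO hg _).2 y
      rw [← hc]
      exact RingHom.isIntegralElem_map _

/-- A continuous section stabilizes a unique valuation ring with constant residues. -/
lemma existsUnique_hasConstantResidues_of_section (p : ℕ) [Fact p.Prime] [Algebra ℚ_[p] k]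
    [FiniteDimensional ℚ_[p] k]
    {s : (algebraicClosure k Ω ≃ₐ[k] algebraicClosure k Ω) →* (Ω ≃ₐ[F] Ω)}
    (hs_cont : Continuous s) (hs : ∀ g, resHom k F Ω (s g) = g) :
    ∃! O : ValuationSubring Ω, HasConstantResidues (algebraicClosure k Ω) O ∧
      ∀ g, ∀ x ∈ O, s g x ∈ O := by
  have : CharZero k := charZero_of_injective_algebraMap (algebraMap ℚ_[p] k).injective
  have hC : IsAlgClosure k (algebraicClosure k Ω) := algebraicClosure.isAlgClosure k Ω
  have : IsAlgClosed (algebraicClosure k Ω) := hC.isAlgClosed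
  have : CharZero (algebraicClosure k Ω) :=
    charZero_of_injective_algebraMap (algebraMap k _).injective
  let _ : MulSemiringAction (algebraicClosure k Ω ≃ₐ[k] algebraicClosure k Ω) Ω :=
    MulSemiringAction.compHom Ω s
  have := smulDistribClass_of_section hs
  exact existsUnique_hasConstantResidues (p := p) fun y =>
    (stabilizer_isOpen_of_isIntegral (K := F) y).preimage hs_cont

end BirationalSection

/-- Let `k/ℚ_p` be finite and let `X` be an integral scheme, projective
and normal over `k`, with `k` relatively algebraically closed in `K = k(X)`.  For every
birational Galois section `s : Gal_k → Gal_K` there is exactly one valuation subring `Ō`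
of `Kbar` containing `k` with `s(Gal_k) ⊆ D_Ō` whose restriction `Ō ∩ K` has residue
field algebraic over `k`; moreover, for this unique `Ō` the residue field of `Ō ∩ K`
equals `k`. -/
theorem birational_section_unique_valuation_with_algebraic_residue_field
    (p : ℕ) [Fact p.Prime]
    (k : Type) [Field k] [Algebra ℚ_[p] k] [FiniteDimensional ℚ_[p] k]
    (X : Scheme) [IsIntegral X]
    (f : X ⟶ Spec (CommRingCat.of k))
    -- `X` is projective over `k`
    (hproj : ∃ (n : ℕ) (i : X ⟶ Proj (MvPolynomial.homogeneousSubmodule (Fin n) k)),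
      IsClosedImmersion i ∧ i ≫ projectiveSpaceToSpec k n = f)
    -- `X` is normal
    (hnormal : ∀ x : X, IsIntegrallyClosed (X.presheaf.stalk x))
    [Algebra k X.functionField]
    -- the `k`-algebra structure on the function field `K = k(X)` is the one induced by `f`
    (halg : ∀ a : k, algebraMap k X.functionField a =
      (@Scheme.germToFunctionField X _ ⊤ ⟨⟨Nonempty.some inferInstance, trivial⟩⟩)
        (f.appTop ((Scheme.ΓSpecIso (CommRingCat.of k)).inv a)))
    -- `k` is relatively algebraically closed in `K` (geometric irreducibility)
    (hrac : ∀ x : X.functionField, IsAlgebraic k x → x ∈ (algebraMap k X.functionField).range)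
    (Kbar : Type) [Field Kbar] [Algebra X.functionField Kbar] [Algebra k Kbar]
    [IsScalarTower k X.functionField Kbar] [IsAlgClosed Kbar]
    [Algebra.IsAlgebraic X.functionField Kbar]
    -- a birational Galois section
    (s : ((algebraicClosure k Kbar) ≃ₐ[k] (algebraicClosure k Kbar)) →*
      (Kbar ≃ₐ[X.functionField] Kbar))
    (hs_cont : Continuous s)
    (hs_sec : ∀ g, resHom k X.functionField Kbar (s g) = g) :
    (∃! Obar : ValuationSubring Kbar,
      ∃ hk : ∀ a : k, algebraMap k Kbar a ∈ Obar,
        (∀ g, ∀ x : Kbar, x ∈ Obar ↔ s g x ∈ Obar) ∧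
        (∀ y : IsLocalRing.ResidueField (Obar.comap (algebraMap X.functionField Kbar)),
          (residueEmbedHom (Obar.comap (algebraMap X.functionField Kbar))
            (fun a => by
              rw [ValuationSubring.mem_comap,
                ← IsScalarTower.algebraMap_apply k X.functionField Kbar]
              exact hk a)).IsIntegralElem y)) ∧
    (∀ Obar : ValuationSubring Kbar,
      (∃ hk : ∀ a : k, algebraMap k Kbar a ∈ Obar,
        (∀ g, ∀ x : Kbar, x ∈ Obar ↔ s g x ∈ Obar) ∧
        (∀ y : IsLocalRing.ResidueField (Obar.comap (algebraMap X.functionField Kbar)),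
          (residueEmbedHom (Obar.comap (algebraMap X.functionField Kbar))
            (fun a => by
              rw [ValuationSubring.mem_comap,
                ← IsScalarTower.algebraMap_apply k X.functionField Kbar]
              exact hk a)).IsIntegralElem y)) →
      ∃ hk : ∀ a : k, algebraMap k Kbar a ∈ Obar,
        Function.Bijective (residueEmbedHom (Obar.comap (algebraMap X.functionField Kbar))
          (fun a => by
            rw [ValuationSubring.mem_comap,
              ← IsScalarTower.algebraMap_apply k X.functionField Kbar]
            exact hk a))) := by
  have : CharZero k := charZero_of_injective_algebraMap (algebraMap ℚ_[p] k).injective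
  have key := isIntegralElem_and_stable_iff (F := X.functionField) (Ω := Kbar) hs_sec
  refine ⟨?_, fun O hO => ?_⟩
  · rw [existsUnique_congr key]
    exact existsUnique_hasConstantResidues_of_section p hs_cont hs_sec
  · obtain ⟨hcr, hg⟩ := (key O).1 hO
    obtain ⟨hk, -⟩ := hO
    exact ⟨hk, residueEmbedHom_bijective_of_section hs_sec hcr hg _⟩
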